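/- A smallest counterexample contains no even cycle of length at most 8, i.e., no cycle of length 4, 6, or 8. -/

import Mathlib

open SimpleGraph

/-- The degree of a vertex, as the cardinality of its neighbor set. -/
noncomputable def deg {V : Type} (G : SimpleGraph V) (v : V) : ℕ :=
  (G.neighborSet v).ncard

/-- The potential of a finite graph: `5 n(G) - 4 e(G)`. -/
noncomputable def pot {V : Type} [Fintype V] (G : SimpleGraph V) : ℤ :=
  5 * (Fintype.card V : ℤ) - 4 * (G.edgeSet.ncard : ℤ)

/-- A graph is 5/2-critical if it has no homomorphism to the 5-cycle
but every proper subgraph has one. -/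
def Critical52 {V : Type} (G : SimpleGraph V) : Prop :=
  IsEmpty (G →g cycleGraph 5) ∧
  ∀ H : G.Subgraph, H ≠ ⊤ → Nonempty (H.coe →g cycleGraph 5)

/-- The exceptional graph `E₁`: a 9-cycle `0 1 2 3 4 5 6 7 8` together
with a vertex `9` adjacent to `0`, `3` and `6`. -/
def E1 : SimpleGraph (Fin 10) := SimpleGraph.fromEdgeSet
  {s(0,1), s(1,2), s(2,3), s(3,4), s(4,5), s(5,6), s(6,7), s(7,8), s(8,0),
   s(9,0), s(9,3), s(9,6)}

/-- The exceptional graph `E₂`: two 5-cycles `0 1 2 3 4` and `0 1 5 6 7`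
sharing exactly the edge `01`, together with a path `3 8 9 6`. -/
def E2 : SimpleGraph (Fin 10) := SimpleGraph.fromEdgeSet
  {s(0,1), s(1,2), s(2,3), s(3,4), s(4,0),
   s(1,5), s(5,6), s(6,7), s(7,0),
   s(3,8), s(8,9), s(9,6)}

/-- A smallest counterexample: a 5/2-critical graph, not isomorphic to `C₃`, `E₁`, `E₂`,
with potential at least 2, such that every smaller 5/2-critical graph not isomorphic
to `C₃`, `E₁`, `E₂` has potential at most 1. -/
def SmallestCex {V : Type} [Fintype V] (G : SimpleGraph V) : Prop :=
  Critical52 G ∧ IsEmpty (G ≃g cycleGraph 3) ∧ IsEmpty (G ≃g E1) ∧ IsEmpty (G ≃g E2) ∧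
  2 ≤ pot G ∧
  ∀ (m : ℕ) (H : SimpleGraph (Fin m)), Critical52 H →
    IsEmpty (H ≃g cycleGraph 3) → IsEmpty (H ≃g E1) → IsEmpty (H ≃g E2) →
    m < Fintype.card V → pot H ≤ 1

/-- A string: a path of positive length whose endvertices have degree at least 3
and whose internal vertices have degree 2. A `k`-string is a string of length `k+1`. -/
def IsString {V : Type} (G : SimpleGraph V) {u v : V} (p : G.Walk u v) : Prop :=
  p.IsPath ∧ 0 < p.length ∧ 3 ≤ deg G u ∧ 3 ≤ deg G v ∧
  ∀ w ∈ p.support, w ≠ u → w ≠ v → deg G w = 2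

/-- `v` lies on a 5-cycle of `G`. -/
def InFiveCycle {V : Type} (G : SimpleGraph V) (v : V) : Prop :=
  ∃ (w : V) (c : G.Walk w w), c.IsCycle ∧ c.length = 5 ∧ v ∈ c.support

/-- `v` is a `(k₁,k₂,k₃)`-vertex: it has degree 3 and is the end of a `k₁`-string,
a `k₂`-string and a `k₃`-string leaving `v` through its three distinct edges. -/
def IsVertex3 {V : Type} (G : SimpleGraph V) (v : V) (k1 k2 k3 : ℕ) : Prop :=
  deg G v = 3 ∧ ∃ (u1 u2 u3 : V) (p1 : G.Walk v u1) (p2 : G.Walk v u2) (p3 : G.Walk v u3),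
    IsString G p1 ∧ IsString G p2 ∧ IsString G p3 ∧
    p1.getVert 1 ≠ p2.getVert 1 ∧ p1.getVert 1 ≠ p3.getVert 1 ∧ p2.getVert 1 ≠ p3.getVert 1 ∧
    p1.length = k1 + 1 ∧ p2.length = k2 + 1 ∧ p3.length = k3 + 1

/-- `v` is a `(k₁,k₂,k₃,k₄)`-vertex: it has degree 4 and is the end of strings of the
corresponding lengths leaving `v` through its four distinct edges. -/
def IsVertex4 {V : Type} (G : SimpleGraph V) (v : V) (k1 k2 k3 k4 : ℕ) : Prop :=
  deg G v = 4 ∧ ∃ (u1 u2 u3 u4 : V) (p1 : G.Walk v u1) (p2 : G.Walk v u2)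
    (p3 : G.Walk v u3) (p4 : G.Walk v u4),
    IsString G p1 ∧ IsString G p2 ∧ IsString G p3 ∧ IsString G p4 ∧
    p1.getVert 1 ≠ p2.getVert 1 ∧ p1.getVert 1 ≠ p3.getVert 1 ∧ p1.getVert 1 ≠ p4.getVert 1 ∧
    p2.getVert 1 ≠ p3.getVert 1 ∧ p2.getVert 1 ≠ p4.getVert 1 ∧ p3.getVert 1 ≠ p4.getVert 1 ∧
    p1.length = k1 + 1 ∧ p2.length = k2 + 1 ∧ p3.length = k3 + 1 ∧ p4.length = k4 + 1

/-- `H` contains at least two distinct cycles, where cycles are counted as subgraphs,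
i.e. two cycles are distinct if their edge sets differ. -/
def TwoDistinctCycles {V : Type} (H : SimpleGraph V) : Prop :=
  ∃ (v1 v2 : V) (c1 : H.Walk v1 v1) (c2 : H.Walk v2 v2),
    c1.IsCycle ∧ c2.IsCycle ∧ {e | e ∈ c1.edges} ≠ {e | e ∈ c2.edges}

/-- The degree of a 5-cycle (cell) `c` in `G`: the number of strings not contained in `c`
that intersect `c`, strings being counted by their edge sets. -/
noncomputable def cellDegree {V : Type} (G : SimpleGraph V) {w : V} (c : G.Walk w w) : ℕ :=
  {S : Set (Sym2 V) | ∃ (u v : V) (p : G.Walk u v), IsString G p ∧ S = {e | e ∈ p.edges} ∧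
    ¬ S ⊆ {e | e ∈ c.edges} ∧ ∃ x ∈ p.support, x ∈ c.support}.ncard

namespace C52

/-! ### Colourings, potentials of subgraphs -/

def c5 (a b : Fin 5) : Prop := b = a + 1 ∨ a = b + 1

instance : DecidableRel c5 := fun a b => by unfold c5; infer_instance

theorem c5_symm {a b : Fin 5} (h : c5 a b) : c5 b a := Or.symm h

theorem c5_iff : ∀ a b : Fin 5, (cycleGraph 5).Adj a b ↔ c5 a b := by decide

variable {V : Type}

def IsCol (H : SimpleGraph V) (c : V → Fin 5) : Prop := ∀ a b, H.Adj a b → c5 (c a) (c b)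

def Col (H : SimpleGraph V) : Prop := ∃ c : V → Fin 5, IsCol H c

def MinNC (W : SimpleGraph V) : Prop := ¬ Col W ∧ ∀ W', W' < W → Col W'

noncomputable def pp [Fintype V] (H : SimpleGraph V) : ℤ :=
  5 * (H.support.ncard : ℤ) - 4 * (H.edgeSet.ncard : ℤ)

theorem IsCol.mono {H K : SimpleGraph V} {c} (h : H ≤ K) (hc : IsCol K c) : IsCol H c :=
  fun a b hab => hc a b (h hab)

theorem Col.mono {H K : SimpleGraph V} (h : H ≤ K) (hc : Col K) : Col H :=
  hc.imp fun _ hc => hc.mono h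

theorem exists_minNC [Fintype V] (H : SimpleGraph V) (hH : ¬ Col H) : ∃ W, W ≤ H ∧ MinNC W := by
  classical
  obtain ⟨W, hW, hm⟩ := (Set.toFinite {W : SimpleGraph V | W ≤ H ∧ ¬ Col W}).exists_minimal
    ⟨H, le_rfl, hH⟩
  refine ⟨W, hW.1, hW.2, fun W' hW' => ?_⟩
  by_contra hc
  exact hW'.not_ge (hm ⟨hW'.le.trans hW.1, hc⟩ hW'.le)

/-- concrete graph given by a list of edges, placed on vertices by `e` -/
def img {n : ℕ} (l : List (Fin n × Fin n)) (e : Fin n → V) : SimpleGraph V where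
  Adj u v := u ≠ v ∧ ∃ p ∈ l, (e p.1 = u ∧ e p.2 = v) ∨ (e p.1 = v ∧ e p.2 = u)
  symm := ⟨fun u v ⟨h, p, hp, hh⟩ => ⟨h.symm, p, hp, hh.symm⟩⟩
  loopless := ⟨fun u h => h.1 rfl⟩

def ladj {n : ℕ} (l : List (Fin n × Fin n)) (i j : Fin n) : Prop := (i, j) ∈ l ∨ (j, i) ∈ l

instance {n : ℕ} (l : List (Fin n × Fin n)) : DecidableRel (ladj l) := fun a b => by
  unfold ladj; infer_instance

def good {n : ℕ} (l : List (Fin n × Fin n)) : Prop :=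
  (l.map fun p => s(p.1, p.2)).Nodup ∧ ∀ p ∈ l, p.1 ≠ p.2

instance {n : ℕ} (l : List (Fin n × Fin n)) : Decidable (good l) := by
  unfold good; infer_instance

theorem good.ne {n : ℕ} {l : List (Fin n × Fin n)} (h : good l) {i j} (hl : ladj l i j) : i ≠ j := by
  rcases hl with hl | hl
  · exact h.2 _ hl
  · exact (h.2 _ hl).symm

theorem img_adj {n : ℕ} {l : List (Fin n × Fin n)} {e : Fin n → V} {u v : V} :
    (img l e).Adj u v ↔ u ≠ v ∧ ∃ i j, ladj l i j ∧ e i = u ∧ e j = v := by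
  constructor
  · rintro ⟨h, p, hp, ⟨h1, h2⟩ | ⟨h1, h2⟩⟩
    · exact ⟨h, p.1, p.2, Or.inl hp, h1, h2⟩
    · exact ⟨h, p.2, p.1, Or.inr hp, h2, h1⟩
  · rintro ⟨h, i, j, hp | hp, h1, h2⟩
    · exact ⟨h, _, hp, Or.inl ⟨h1, h2⟩⟩
    · exact ⟨h, _, hp, Or.inr ⟨h2, h1⟩⟩

theorem img_adj' {n : ℕ} {l : List (Fin n × Fin n)} {e : Fin n → V} (he : e.Injective)
    (hl : good l) {i j : Fin n} : (img l e).Adj (e i) (e j) ↔ ladj l i j := by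
  rw [img_adj]
  constructor
  · rintro ⟨_, a, b, h, h1, h2⟩
    rwa [← he h1, ← he h2]
  · intro h
    exact ⟨fun h' => hl.ne h (he h'), i, j, h, rfl, rfl⟩

theorem img_le {n : ℕ} {l : List (Fin n × Fin n)} {e : Fin n → V} {G : SimpleGraph V}
    (h : ∀ p ∈ l, G.Adj (e p.1) (e p.2)) : img l e ≤ G := by
  rintro u v ⟨_, p, hp, ⟨rfl, rfl⟩ | ⟨rfl, rfl⟩⟩
  · exact h p hp
  · exact (h p hp).symm

theorem img_supp {n : ℕ} {l : List (Fin n × Fin n)} {e : Fin n → V} {v : V}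
    (h : v ∈ (img l e).support) : ∃ i, e i = v := by
  obtain ⟨w, hw⟩ := h
  obtain ⟨_, i, _, _, h, _⟩ := img_adj.1 hw
  exact ⟨i, h⟩

theorem img_mem_supp {n : ℕ} {l : List (Fin n × Fin n)} {e : Fin n → V} (he : e.Injective)
    (hl : good l) (hc : ∀ i, ∃ j, ladj l i j) (i : Fin n) : e i ∈ (img l e).support := by
  obtain ⟨j, hj⟩ := hc i
  exact ⟨e j, (img_adj' he hl).2 hj⟩

theorem img_edges {n : ℕ} {l : List (Fin n × Fin n)} {e : Fin n → V} (he : e.Injective)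
    (hl : good l) : (img l e).edgeSet.ncard = l.length := by
  classical
  have : (img l e).edgeSet = ↑((l.map fun p => s(p.1, p.2)).map (Sym2.map e)).toFinset := by
    ext x
    induction x with | _ u v
    simp only [mem_edgeSet, List.map_map, List.coe_toFinset, List.mem_map, Set.mem_setOf_eq,
      Function.comp_apply, Sym2.map_mk, Sym2.eq_iff]
    constructor
    · rintro ⟨_, h⟩
      exact h
    · rintro ⟨p, hp, h⟩
      refine ⟨?_, p, hp, h⟩
      have := hl.2 p hp
      rintro rfl
      exact this (he (by rcases h with h | h <;> rw [h.1, h.2]))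
  rw [this, Set.ncard_coe_finset, List.toFinset_card_of_nodup
    (hl.1.map (Sym2.map.injective he))]
  simp

theorem pp_img [Fintype V] {n : ℕ} {l : List (Fin n × Fin n)} {e : Fin n → V} (he : e.Injective)
    (hl : good l) : pp (img l e) ≤ 5 * n - 4 * l.length := by
  have h1 : (img l e).support.ncard ≤ n := by
    calc _ ≤ (Set.range e).ncard := Set.ncard_le_ncard (fun v hv => img_supp hv) (Set.toFinite _)
      _ = n := by rw [← Set.image_univ, Set.ncard_image_of_injective _ he]; simp
  unfold pp
  rw [img_edges he hl]
  omega

theorem img_isCol {n : ℕ} {l : List (Fin n × Fin n)} {e : Fin n → V} (c : V → Fin 5)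
    (h : ∀ p ∈ l, c5 (c (e p.1)) (c (e p.2))) : IsCol (img l e) c := by
  rintro u v ⟨_, p, hp, ⟨rfl, rfl⟩ | ⟨rfl, rfl⟩⟩
  · exact h p hp
  · exact c5_symm (h p hp)

theorem img_isCol' {n : ℕ} {l : List (Fin n × Fin n)} {e : Fin n → V} (he : e.Injective)
    (c : Fin n → Fin 5) (h : ∀ p ∈ l, c5 (c p.1) (c p.2)) :
    ∃ c' : V → Fin 5, IsCol (img l e) c' ∧ ∀ i, c' (e i) = c i := by
  have h0 : ∀ i, Function.extend e c (fun _ => 0) (e i) = c i := fun i => he.extend_apply _ _ _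
  refine ⟨Function.extend e c (fun _ => 0), img_isCol _ ?_, h0⟩
  intro p hp
  rw [h0, h0]
  exact h p hp

theorem support_mono' {A B : SimpleGraph V} (h : A ≤ B) : A.support ⊆ B.support :=
  fun _ ⟨w, hw⟩ => ⟨w, h hw⟩

theorem support_sup {A B : SimpleGraph V} {v : V} : v ∈ (A ⊔ B).support ↔ v ∈ A.support ∨ v ∈ B.support := by
  constructor
  · rintro ⟨w, hw | hw⟩
    · exact Or.inl ⟨w, hw⟩
    · exact Or.inr ⟨w, hw⟩
  · rintro (⟨w, hw⟩ | ⟨w, hw⟩)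
    · exact ⟨w, Or.inl hw⟩
    · exact ⟨w, Or.inr hw⟩

theorem pp_sup [Fintype V] {A B : SimpleGraph V} (s : Set V) (k : ℕ) (hs : s.ncard ≤ k)
    (h1 : ∀ v ∈ B.support, v ∈ A.support ∨ v ∈ s)
    (h2 : ∀ a b, A.Adj a b → ¬ B.Adj a b) :
    pp (A ⊔ B) ≤ pp A + 5 * k - 4 * B.edgeSet.ncard := by
  have h3 : (A ⊔ B).support.ncard ≤ A.support.ncard + s.ncard := by
    refine (Set.ncard_le_ncard ?_ (Set.toFinite _)).trans (Set.ncard_union_le A.support s)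
    intro v hv
    rcases support_sup.1 hv with hv | hv
    · exact Or.inl hv
    · exact h1 v hv
  have h4 : (A ⊔ B).edgeSet.ncard = A.edgeSet.ncard + B.edgeSet.ncard := by
    rw [edgeSet_sup]
    refine Set.ncard_union_eq ?_ (Set.toFinite _) (Set.toFinite _)
    rw [Set.disjoint_left]
    intro x
    induction x with | _ u v
    exact h2 u v
  unfold pp
  rw [h4]
  push_cast
  omega

/-! ### Special graphs -/

def C3l : List (Fin 3 × Fin 3) := [(0,1), (1,2), (2,0)]
def E1l : List (Fin 10 × Fin 10) := [(0,1), (1,2), (2,3), (3,4), (4,5), (5,6), (6,7), (7,8), (8,0),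
   (9,0), (9,3), (9,6)]
def E2l : List (Fin 10 × Fin 10) := [(0,1), (1,2), (2,3), (3,4), (4,0),
   (1,5), (5,6), (6,7), (7,0), (3,8), (8,9), (9,6)]

theorem C3l_adj : ∀ i j, (cycleGraph 3).Adj i j ↔ ladj C3l i j := by decide
theorem E1l_adj (i j) : E1.Adj i j ↔ ladj E1l i j := by
  unfold E1
  rw [fromEdgeSet_adj]
  simp only [Set.mem_insert_iff, Set.mem_singleton_iff, Sym2.eq_iff]
  revert i j
  decide +kernel
theorem E2l_adj (i j) : E2.Adj i j ↔ ladj E2l i j := by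
  unfold E2
  rw [fromEdgeSet_adj]
  simp only [Set.mem_insert_iff, Set.mem_singleton_iff, Sym2.eq_iff]
  revert i j
  decide +kernel

theorem C3_good : good C3l := by decide
theorem E1_good : good E1l := by decide
theorem E2_good : good E2l := by decide
theorem C3_cov : ∀ i, ∃ j, ladj C3l i j := by decide
theorem E1_cov : ∀ i, ∃ j, ladj E1l i j := by decide
theorem E2_cov : ∀ i, ∃ j, ladj E2l i j := by decide

def IsC3 (W : SimpleGraph V) : Prop := ∃ e : Fin 3 → V, e.Injective ∧ W = img C3l e
def IsE (W : SimpleGraph V) : Prop :=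
  ∃ l, (l = E1l ∨ l = E2l) ∧ ∃ e : Fin 10 → V, e.Injective ∧ W = img l e

structure Cex [Fintype V] (G : SimpleGraph V) : Prop where
  nc : ¬ Col G
  crit : ∀ H, H < G → Col H
  supp : ∀ v, v ∈ G.support
  pos : 2 ≤ pp G
  n3 : ¬ IsC3 G
  nE : ¬ IsE G
  small : ∀ (V' : Type) [Fintype V'] (W : SimpleGraph V'), MinNC W →
    W.support.ncard < Fintype.card V → pp W ≤ 1 ∨ IsC3 W ∨ IsE W

theorem iso_of_img {n : ℕ} {K : SimpleGraph (Fin n)} {l : List (Fin n × Fin n)} (hl : good l)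
    (hK : ∀ i j, K.Adj i j ↔ ladj l i j) {G : SimpleGraph V} (hs : ∀ v, v ∈ G.support)
    {e : Fin n → V} (he : e.Injective) (h : G = img l e) : Nonempty (G ≃g K) := by
  have hb : Function.Bijective e := ⟨he, fun v => img_supp (h ▸ hs v)⟩
  refine ⟨SimpleGraph.Iso.symm ⟨Equiv.ofBijective e hb, ?_⟩⟩
  intro a b
  simp only [Equiv.ofBijective_apply]
  rw [h, img_adj' he hl, hK]

theorem img_of_iso {n m : ℕ} {K : SimpleGraph (Fin n)} {l : List (Fin n × Fin n)} (hl : good l)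
    (hK : ∀ i j, K.Adj i j ↔ ladj l i j) {W : SimpleGraph V}
    (f : Fin m ≃ W.support) (g : W.comap (fun i => (f i : V)) ≃g K) :
    ∃ e : Fin n → V, e.Injective ∧ W = img l e := by
  have hi : Function.Injective (fun i => ((f (g.symm i) : W.support) : V)) := by
    intro a b h
    exact g.symm.injective (f.injective (Subtype.ext h))
  refine ⟨_, hi, ?_⟩
  ext u v
  constructor
  · intro h
    obtain ⟨a, ha⟩ := f.surjective ⟨u, v, h⟩
    obtain ⟨b, hb⟩ := f.surjective ⟨v, u, h.symm⟩
    rw [img_adj]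
    refine ⟨h.ne, g a, g b, ?_, ?_, ?_⟩
    · rw [← hK, g.map_adj_iff]
      simp [comap_adj, ha, hb, h]
    · simp [ha]
    · simp [hb]
  · intro h
    obtain ⟨_, i, j, hij, rfl, rfl⟩ := img_adj.1 h
    have := g.symm.map_adj_iff.2 ((hK i j).2 hij)
    exact this

theorem cex_of [Fintype V] {G : SimpleGraph V} (h : SmallestCex G) : Cex G := by
  classical
  obtain ⟨⟨hnc, hcr⟩, h3, hE1, hE2, hp, hs⟩ := h
  have nc : ¬ Col G := by
    rintro ⟨c, hc⟩
    exact hnc.false ⟨c, fun {a b} hab => (c5_iff _ _).2 (hc a b hab)⟩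
  have supp : ∀ v, v ∈ G.support := by
    intro v
    by_contra hv
    let S : G.Subgraph := (⊤ : G.Subgraph).deleteVerts {v}
    have hS : S ≠ ⊤ := by
      intro h
      have : v ∈ S.verts := by rw [h]; trivial
      simp [S] at this
    obtain ⟨f⟩ := hcr S hS
    have hmem : ∀ w, w ≠ v → w ∈ S.verts := by
      intro w hw; simp [S, hw]
    apply nc
    refine ⟨fun w => if hw : w ≠ v then f ⟨w, hmem w hw⟩ else 0, ?_⟩
    intro a b hab
    have ha : a ≠ v := by rintro rfl; exact hv ⟨_, hab⟩
    have hb : b ≠ v := by rintro rfl; exact hv ⟨_, hab.symm⟩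
    simp only [ha, hb, ne_eq, not_false_eq_true, dite_true]
    rw [← c5_iff]
    apply f.map_adj
    simp [S, ha, hb, hab]
  have hpp : pp G = pot G := by
    have : G.support = Set.univ := Set.eq_univ_of_forall supp
    unfold pp pot
    rw [this, Set.ncard_univ, Nat.card_eq_fintype_card]
  refine ⟨nc, ?_, supp, hpp ▸ hp, ?_, ?_, ?_⟩
  · intro H hH
    obtain ⟨f⟩ := hcr (SimpleGraph.toSubgraph H hH.le) (by
      intro h
      apply hH.ne
      ext a b
      have : (SimpleGraph.toSubgraph H hH.le).Adj a b ↔ (⊤ : G.Subgraph).Adj a b := by rw [h]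
      exact this)
    refine ⟨fun v => f ⟨v, trivial⟩, fun a b hab => ?_⟩
    rw [← c5_iff]
    exact f.map_adj hab
  · rintro ⟨e, he, h⟩
    exact (iso_of_img C3_good C3l_adj supp he h).elim fun f => h3.false f
  · rintro ⟨l, rfl | rfl, e, he, h⟩
    · exact (iso_of_img E1_good E1l_adj supp he h).elim fun f => hE1.false f
    · exact (iso_of_img E2_good E2l_adj supp he h).elim fun f => hE2.false f
  · intro V' _ W hW hlt
    by_contra! hcon
    obtain ⟨hpW, h3', hE'⟩ := hcon
    obtain ⟨f⟩ : Nonempty (Fin W.support.ncard ≃ W.support) := by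
      rw [← Nat.card_coe_set_eq]
      exact ⟨(Finite.equivFin _).symm⟩
    set m := W.support.ncard with hm
    let φ : Fin m → V' := fun i => (f i : V')
    have hφ : φ.Injective := fun a b h => f.injective (Subtype.ext h)
    have hφs : ∀ v ∈ W.support, ∃ i, φ i = v := fun v hv => by
      obtain ⟨i, hi⟩ := f.surjective ⟨v, hv⟩
      exact ⟨i, by simp [φ, hi]⟩
    let H : SimpleGraph (Fin m) := W.comap φ
    have hHW : H.map φ = W := by
      ext u v
      rw [show H.map φ = H.map (⟨φ, hφ⟩ : Fin m ↪ V') from rfl, map_adj]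
      constructor
      · rintro ⟨a, b, hab, rfl, rfl⟩
        exact hab
      · intro huv
        obtain ⟨a, rfl⟩ := hφs u ⟨v, huv⟩
        obtain ⟨b, rfl⟩ := hφs v ⟨_, huv.symm⟩
        exact ⟨a, b, huv, rfl, rfl⟩
    have hHc : Critical52 H := by
      constructor
      · refine ⟨fun g => hW.1 ?_⟩
        refine ⟨Function.extend φ g (fun _ => 0), ?_⟩
        intro u v huv
        obtain ⟨a, rfl⟩ := hφs u ⟨v, huv⟩
        obtain ⟨b, rfl⟩ := hφs v ⟨_, huv.symm⟩
        rw [hφ.extend_apply, hφ.extend_apply, ← c5_iff]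
        exact g.map_adj huv
      · intro S hS
        have h1 : S.spanningCoe ≠ H := by
          intro h
          apply hS
          have hv : ∀ a, a ∈ S.verts := by
            intro a
            obtain ⟨w, hw⟩ := (f a).2
            obtain ⟨b, rfl⟩ := hφs w ⟨_, hw.symm⟩
            have h2 : H.Adj a b := hw
            rw [← h] at h2
            exact S.edge_vert h2
          ext a b
          · simp [hv]
          · have : S.spanningCoe.Adj a b ↔ H.Adj a b := by rw [h]
            simpa using this
        have h2 : S.spanningCoe.map φ < W := by
          refine lt_of_le_of_ne ?_ ?_
          · rw [← hHW]
            exact SimpleGraph.map_monotone (⟨φ, hφ⟩ : Fin m ↪ V') (Subgraph.spanningCoe_le S)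
          · intro h
            apply h1
            rw [← hHW] at h
            exact SimpleGraph.map_injective (⟨φ, hφ⟩ : Fin m ↪ V') h
        obtain ⟨c, hc⟩ := hW.2 _ h2
        refine ⟨⟨fun a => c (φ a.1), ?_⟩⟩
        intro a b hab
        rw [c5_iff]
        apply hc
        rw [show S.spanningCoe.map φ = S.spanningCoe.map (⟨φ, hφ⟩ : Fin m ↪ V') from rfl, map_adj]
        exact ⟨a, b, hab, rfl, rfl⟩
    have hpot : pot H = pp W := by
      unfold pot pp
      rw [Fintype.card_fin, ← hm, ← hHW]
      congr 3
      rw [show H.map φ = H.map (⟨φ, hφ⟩ : Fin m ↪ V') from rfl, edgeSet_map,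
        Set.ncard_image_of_injective _ (Function.Embedding.injective _)]
    have := hs m H hHc ⟨fun g => h3' (img_of_iso C3_good C3l_adj f g)⟩
      ⟨fun g => hE' ⟨_, Or.inl rfl, (img_of_iso E1_good E1l_adj f g)⟩⟩
      ⟨fun g => hE' ⟨_, Or.inr rfl, (img_of_iso E2_good E2l_adj f g)⟩⟩ hlt
    omega

end C52

namespace C52
variable {V : Type}

/-! ### Folding -/

open Classical in
noncomputable def pr {k : ℕ} (H : SimpleGraph V) (τ : V → Fin k) (v : V) : V ⊕ Fin k :=
  if v ∈ H.support then Sum.inr (τ v) else Sum.inl v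

theorem pr_in {k : ℕ} {H : SimpleGraph V} {τ : V → Fin k} {v : V} (h : v ∈ H.support) :
    pr H τ v = Sum.inr (τ v) := by simp [pr, h]

theorem pr_out {k : ℕ} {H : SimpleGraph V} {τ : V → Fin k} {v : V} (h : v ∉ H.support) :
    pr H τ v = Sum.inl v := by simp [pr, h]

theorem pr_inl {k : ℕ} {H : SimpleGraph V} {τ : V → Fin k} {v w : V} (h : pr H τ v = Sum.inl w) :
    v = w ∧ w ∉ H.support := by
  by_cases hv : v ∈ H.support
  · simp [pr_in hv] at h
  · rw [pr_out hv] at h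
    cases h
    exact ⟨rfl, hv⟩

theorem pr_inr {k : ℕ} {H : SimpleGraph V} {τ : V → Fin k} {v : V} {i} (h : pr H τ v = Sum.inr i) :
    v ∈ H.support ∧ τ v = i := by
  by_cases hv : v ∈ H.support
  · rw [pr_in hv] at h
    cases h
    exact ⟨hv, rfl⟩
  · simp [pr_out hv] at h

structure Fold {k : ℕ} [Fintype V] (G H : SimpleGraph V) (tl : List (Fin k × Fin k)) (τ : V → Fin k)
    (W : SimpleGraph (V ⊕ Fin k)) (L : SimpleGraph V) : Prop where
  min : MinNC W
  sp : pp W ≤ 1 ∨ IsC3 W ∨ IsE W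
  LG : L < G
  HG : H ≤ G
  gd : good tl
  HT : ∀ a b, H.Adj a b → ladj tl (τ a) (τ b)
  nT : ∀ a b, L.Adj a b → a ∈ H.support → b ∈ H.support → ¬ ladj tl (τ a) (τ b)
  down : ∀ a b, L.Adj a b → W.Adj (pr H τ a) (pr H τ b)
  up : ∀ x y, W.Adj x y → (∃ i j, x = Sum.inr i ∧ y = Sum.inr j ∧ ladj tl i j) ∨
    ∃ a b, L.Adj a b ∧ pr H τ a = x ∧ pr H τ b = y
  inj : ∀ a b a' b', L.Adj a b → L.Adj a' b' → pr H τ a = pr H τ a' → pr H τ b = pr H τ b' →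
    a = a' ∧ b = b'

open Classical in
noncomputable def US {k : ℕ} (W : SimpleGraph (V ⊕ Fin k)) : Finset (Fin k) :=
  Finset.univ.filter fun i => Sum.inr i ∈ W.support

theorem mem_US {k : ℕ} {W : SimpleGraph (V ⊕ Fin k)} {i} : i ∈ US W ↔ Sum.inr i ∈ W.support := by
  simp [US]

def eT {k : ℕ} (tl : List (Fin k × Fin k)) (U : Finset (Fin k)) : ℕ :=
  (tl.filter fun p => p.1 ∈ U ∧ p.2 ∈ U).length

def q {k : ℕ} (tl : List (Fin k × Fin k)) (U : Finset (Fin k)) : ℤ := 5 * U.card - 4 * eT tl U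

variable [Fintype V]

theorem exists_fold {k : ℕ} {G H : SimpleGraph V} (hG : Cex G) (tl : List (Fin k × Fin k))
    (gd : good tl) (τ : V → Fin k) (HG : H ≤ G) (hne : ∃ a b, H.Adj a b)
    (HT : ∀ a b, H.Adj a b → ladj tl (τ a) (τ b))
    (sep : ∀ a b, G.Adj a b → a ∈ H.support → b ∈ H.support → τ a ≠ τ b)
    (ni : ∃ a b, a ≠ b ∧ a ∈ H.support ∧ b ∈ H.support ∧ τ a = τ b) :
    ∃ W L, Fold G H tl τ W L := by
  classical
  have hπ : ∀ a b, G.Adj a b → pr H τ a ≠ pr H τ b := by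
    intro a b hab h
    by_cases ha : a ∈ H.support
    · rw [pr_in ha] at h
      obtain ⟨hb, h2⟩ := pr_inr h.symm
      exact sep a b hab ha hb h2.symm
    · rw [pr_out ha] at h
      exact hab.ne (pr_inl h.symm).1.symm
  let G' : SimpleGraph (V ⊕ Fin k) :=
    { Adj := fun x y => ∃ a b, G.Adj a b ∧ pr H τ a = x ∧ pr H τ b = y
      symm := ⟨fun x y ⟨a, b, h, h1, h2⟩ => ⟨b, a, h.symm, h2, h1⟩⟩
      loopless := ⟨fun x ⟨a, b, h, h1, h2⟩ => hπ a b h (h1.trans h2.symm)⟩ }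
  have hG' : ¬ Col G' := by
    rintro ⟨c, hc⟩
    exact hG.nc ⟨fun v => c (pr H τ v), fun a b hab => hc _ _ ⟨a, b, hab, rfl, rfl⟩⟩
  obtain ⟨W, hWG, hW⟩ := exists_minNC G' hG'
  have hcard : W.support.ncard < Fintype.card V := by
    have h1 : W.support.ncard ≤ (pr H τ '' Set.univ).ncard := by
      refine Set.ncard_le_ncard ?_ (Set.toFinite _)
      rintro x ⟨y, hxy⟩
      obtain ⟨a, b, _, h, _⟩ := hWG hxy
      exact ⟨a, trivial, h⟩
    have h2 : (pr H τ '' Set.univ).ncard ≤ (Set.univ : Set V).ncard := Set.ncard_image_le (Set.toFinite _)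
    have h3 : (Set.univ : Set V).ncard = Fintype.card V := by
      rw [Set.ncard_univ, Nat.card_eq_fintype_card]
    refine lt_of_le_of_ne (by omega) ?_
    intro h4
    have h5 := Set.injOn_of_ncard_image_eq (f := pr H τ) (s := Set.univ) (by omega) (Set.toFinite _)
    obtain ⟨a, b, hab, ha, hb, h⟩ := ni
    exact hab (h5 trivial trivial (by rw [pr_in ha, pr_in hb, h]))
  have hlift : ∀ x ∈ W.edgeSet, ∃ y ∈ G.edgeSet, y.map (pr H τ) = x := by
    intro x
    induction x with | _ x y
    intro h
    obtain ⟨a, b, hab, rfl, rfl⟩ := hWG h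
    exact ⟨s(a, b), hab, rfl⟩
  have : Nonempty (Sym2 V) := hne.elim fun a _ => ⟨s(a, a)⟩
  choose! lam hl1 hl2 using hlift
  let TE : Sym2 (V ⊕ Fin k) → Prop := fun x => ∃ i j, x = s(Sum.inr i, Sum.inr j) ∧ ladj tl i j
  let L : SimpleGraph V := fromEdgeSet (lam '' {x | x ∈ W.edgeSet ∧ ¬ TE x})
  have hL : ∀ a b, L.Adj a b → ∃ x ∈ W.edgeSet, ¬ TE x ∧ lam x = s(a, b) := by
    intro a b h
    obtain ⟨⟨x, ⟨hx, hx2⟩, h1⟩, _⟩ := (fromEdgeSet_adj _).1 h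
    exact ⟨x, hx, hx2, h1⟩
  have hLd : ∀ a b, L.Adj a b → W.Adj (pr H τ a) (pr H τ b) := by
    intro a b h
    obtain ⟨x, hx, _, h1⟩ := hL a b h
    have h2 := hl2 x hx
    rw [h1, Sym2.map_mk] at h2
    rw [← h2] at hx
    exact hx
  have hLG : L ≤ G := by
    intro a b h
    obtain ⟨x, hx, _, h1⟩ := hL a b h
    have := hl1 x hx
    rwa [h1] at this
  have hnT : ∀ a b, L.Adj a b → a ∈ H.support → b ∈ H.support → ¬ ladj tl (τ a) (τ b) := by
    intro a b h ha hb ht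
    obtain ⟨x, hx, h3, h1⟩ := hL a b h
    have h2 := hl2 x hx
    rw [h1, Sym2.map_mk, pr_in ha, pr_in hb] at h2
    exact h3 ⟨_, _, h2.symm, ht⟩
  refine ⟨W, L, hW, hG.small _ W hW hcard, lt_of_le_of_ne hLG ?_, HG, gd, HT, hnT, hLd, ?_, ?_⟩
  · rintro h
    obtain ⟨a, b, hab⟩ := hne
    exact hnT a b (h ▸ HG hab) ⟨_, hab⟩ ⟨_, hab.symm⟩ (HT a b hab)
  · intro x y hxy
    by_cases ht : TE s(x, y)
    · left
      obtain ⟨i, j, h, hij⟩ := ht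
      rcases Sym2.eq_iff.1 h with ⟨rfl, rfl⟩ | ⟨rfl, rfl⟩
      · exact ⟨i, j, rfl, rfl, hij⟩
      · exact ⟨j, i, rfl, rfl, hij.symm⟩
    · right
      have h1 := hl1 s(x, y) hxy
      have h2 := hl2 s(x, y) hxy
      have h3 : lam s(x, y) ∈ lam '' {x | x ∈ W.edgeSet ∧ ¬ TE x} := ⟨_, ⟨hxy, ht⟩, rfl⟩
      revert h1 h2 h3
      generalize lam s(x, y) = z
      induction z with | _ a b
      intro h1 h2 h3
      rw [Sym2.map_mk] at h2
      have h4 : L.Adj a b := (fromEdgeSet_adj _).2 ⟨h3, G.ne_of_adj h1⟩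
      rcases Sym2.eq_iff.1 h2 with ⟨h5, h6⟩ | ⟨h5, h6⟩
      · exact ⟨a, b, h4, h5, h6⟩
      · exact ⟨b, a, h4.symm, h6, h5⟩
  · intro a b a' b' h h' e1 e2
    obtain ⟨x, hx, _, h1⟩ := hL a b h
    obtain ⟨x', hx', _, h1'⟩ := hL a' b' h'
    have h2 := hl2 x hx
    have h2' := hl2 x' hx'
    rw [h1, Sym2.map_mk] at h2
    rw [h1', Sym2.map_mk, ← e1, ← e2] at h2'
    have h3 : s(a, b) = s(a', b') := by rw [← h1, ← h1', ← h2, ← h2']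
    rcases Sym2.eq_iff.1 h3 with h3 | ⟨rfl, rfl⟩
    · exact h3
    · exact absurd e1 (hLd _ _ h).ne

namespace Fold

variable {k : ℕ} {G H : SimpleGraph V} {tl : List (Fin k × Fin k)} {τ : V → Fin k}
  {W : SimpleGraph (V ⊕ Fin k)} {L : SimpleGraph V}

theorem mem_U (F : Fold G H tl τ W L) {a b} (h : L.Adj a b) (ha : a ∈ H.support) : τ a ∈ US W := by
  rw [mem_US]
  have := F.down a b h
  rw [pr_in ha] at this
  exact ⟨_, this⟩

theorem disj (F : Fold G H tl τ W L) {a b} (h : H.Adj a b) : ¬ L.Adj a b := fun h' =>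
  F.nT a b h' ⟨_, h⟩ ⟨_, h.symm⟩ (F.HT a b h)

theorem inl_supp (F : Fold G H tl τ W L) {v} (h : Sum.inl v ∈ W.support) : v ∉ H.support := by
  obtain ⟨y, hy⟩ := h
  rcases F.up _ _ hy with ⟨i, j, h1, _⟩ | ⟨a, b, _, h1, _⟩
  · cases h1
  · exact (pr_inl h1).2

theorem bound (F : Fold G H tl τ W L) (H1 : SimpleGraph V) (h1 : H1 ≤ H)
    (h2 : ∀ v ∈ H.support, τ v ∈ US W → v ∈ H1.support) :
    pp (H1 ⊔ L) ≤ pp H1 + pp W - q tl (US W) := by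
  classical
  set s : Set V := {v | Sum.inl v ∈ W.support} with hs
  have e1 : W.support.ncard = s.ncard + (US W).card := by
    have : W.support = Sum.inl '' s ∪ Sum.inr '' (US W : Set (Fin k)) := by
      ext x
      rcases x with v | i
      · simp [hs]
      · simp [mem_US]
    rw [this, Set.ncard_union_eq _ (Set.toFinite _) (Set.toFinite _),
      Set.ncard_image_of_injective _ Sum.inl_injective,
      Set.ncard_image_of_injective _ Sum.inr_injective, Set.ncard_coe_finset]
    rw [Set.disjoint_left]
    rintro x ⟨a, _, rfl⟩ ⟨b, _, h⟩
    cases h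
  have e2 : W.edgeSet.ncard ≤ L.edgeSet.ncard + eT tl (US W) := by
    set tf := (tl.filter fun p => p.1 ∈ US W ∧ p.2 ∈ US W)
    have h3 : W.edgeSet ⊆ Sym2.map (pr H τ) '' L.edgeSet ∪
        ((tf.toFinset.image fun p => s(Sum.inr p.1, Sum.inr p.2) : Finset (Sym2 (V ⊕ Fin k))) :
          Set (Sym2 (V ⊕ Fin k))) := by
      intro x
      induction x with | _ x y
      intro h
      rcases F.up x y h with ⟨i, j, rfl, rfl, hij⟩ | ⟨a, b, hab, rfl, rfl⟩
      · right
        have hi : i ∈ US W := mem_US.2 ⟨_, h⟩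
        have hj : j ∈ US W := mem_US.2 ⟨_, h.symm⟩
        simp only [Finset.coe_image, Set.mem_image]
        rcases hij with hij | hij
        · exact ⟨(i, j), by simp [tf, hi, hj, hij], rfl⟩
        · exact ⟨(j, i), by simp [tf, hi, hj, hij], Sym2.eq_swap⟩
      · left
        exact ⟨s(a, b), hab, rfl⟩
    refine (Set.ncard_le_ncard h3 (Set.toFinite _)).trans ((Set.ncard_union_le _ _).trans ?_)
    refine add_le_add (Set.ncard_image_le (Set.toFinite _)) ?_
    rw [Set.ncard_coe_finset]
    exact Finset.card_image_le.trans (List.toFinset_card_le _)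
  have e3 : pp (H1 ⊔ L) ≤ pp H1 + 5 * s.ncard - 4 * L.edgeSet.ncard := by
    refine pp_sup s _ le_rfl ?_ ?_
    · rintro v ⟨w, hv⟩
      by_cases hvH : v ∈ H.support
      · exact Or.inl (h2 v hvH (F.mem_U hv hvH))
      · right
        have := F.down _ _ hv
        rw [pr_out hvH] at this
        exact ⟨_, this⟩
    · intro a b hab
      exact F.disj (h1 hab)
  unfold q
  have : pp W = 5 * W.support.ncard - 4 * W.edgeSet.ncard := rfl
  rw [this, e1]
  push_cast
  omega

theorem bound' (F : Fold G H tl τ W L) : pp (H ⊔ L) ≤ pp H + pp W - q tl (US W) :=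
  F.bound H le_rfl fun _ h _ => h

theorem S (F : Fold G H tl τ W L) (v0 : V) (hU : ∀ i ∈ US W, ∀ j ∈ US W, i = j)
    (hv : ∀ a b, L.Adj a b → a ∈ H.support → a = v0) (hc : Col L) : False := by
  obtain ⟨c, hc⟩ := hc
  apply F.min.1
  refine ⟨Sum.elim c fun _ => c v0, ?_⟩
  have key : ∀ a b, L.Adj a b → Sum.elim c (fun _ => c v0) (pr H τ a) = c a := by
    intro a b hab
    by_cases ha : a ∈ H.support
    · rw [pr_in ha, hv a b hab ha]; rfl
    · rw [pr_out ha]; rfl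
  intro x y hxy
  rcases F.up x y hxy with ⟨i, j, rfl, rfl, hij⟩ | ⟨a, b, hab, rfl, rfl⟩
  · exact absurd (hU i (mem_US.2 ⟨_, hxy⟩) j (mem_US.2 ⟨_, hxy.symm⟩)) (F.gd.ne hij)
  · rw [key a b hab, key b a hab.symm]
    exact hc a b hab

theorem colL (F : Fold G H tl τ W L) (hG : Cex G) : Col L := hG.crit _ F.LG

theorem U_ne (F : Fold G H tl τ W L) (hG : Cex G) : (US W).Nonempty := by
  by_contra h
  rw [Finset.not_nonempty_iff_eq_empty] at h
  have : Nonempty V := by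
    by_contra hV
    exact hG.nc ⟨fun _ => 0, fun a => (hV ⟨a⟩).elim⟩
  obtain ⟨v0⟩ := this
  refine F.S v0 (by simp [h]) ?_ (F.colL hG)
  intro a b hab ha
  have := F.mem_U hab ha
  simp [h] at this

theorem out (F : Fold G H tl τ W L) (hY : H ⊔ L = G) {v w : V} (hv : v ∈ H.support)
    (h : G.Adj v w) (hn : ¬ H.Adj v w) : τ v ∈ US W := by
  rw [← hY] at h
  rcases h with h | h
  · exact absurd h hn
  · exact F.mem_U h hv

theorem YG (F : Fold G H tl τ W L) : H ⊔ L ≤ G := sup_le F.HG F.LG.le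

theorem up_ll (F : Fold G H tl τ W L) {a b : V} (h : W.Adj (Sum.inl a) (Sum.inl b)) :
    L.Adj a b ∧ a ∉ H.support ∧ b ∉ H.support := by
  rcases F.up _ _ h with ⟨i, j, h1, _⟩ | ⟨a', b', hab, h1, h2⟩
  · cases h1
  · obtain ⟨rfl, h3⟩ := pr_inl h1
    obtain ⟨rfl, h4⟩ := pr_inl h2
    exact ⟨hab, h3, h4⟩

theorem up_rl (F : Fold G H tl τ W L) {i : Fin k} {b : V} (h : W.Adj (Sum.inr i) (Sum.inl b)) :
    ∃ v ∈ H.support, τ v = i ∧ L.Adj v b ∧ b ∉ H.support := by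
  rcases F.up _ _ h with ⟨i, j, _, h1, _⟩ | ⟨a', b', hab, h1, h2⟩
  · cases h1
  · obtain ⟨h3, h4⟩ := pr_inr h1
    obtain ⟨rfl, h5⟩ := pr_inl h2
    exact ⟨a', h3, h4, hab, h5⟩

theorem up_rr (F : Fold G H tl τ W L) {i j : Fin k} (h : W.Adj (Sum.inr i) (Sum.inr j)) :
    ladj tl i j ∨ ∃ v v', v ∈ H.support ∧ v' ∈ H.support ∧ τ v = i ∧ τ v' = j ∧ L.Adj v v' := by
  rcases F.up _ _ h with ⟨i, j, h1, h2, h3⟩ | ⟨a', b', hab, h1, h2⟩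
  · cases h1
    cases h2
    exact Or.inl h3
  · obtain ⟨h3, h4⟩ := pr_inr h1
    obtain ⟨h5, h6⟩ := pr_inr h2
    exact Or.inr ⟨a', b', h3, h5, h4, h6, hab⟩

/-- outcome of a fold whose critical graph is a triangle -/
theorem c3 (F : Fold G H tl τ W L) (hG : Cex G) (h : IsC3 W) :
    (∃ i, US W = {i} ∧ ∃ v a b v', v ∈ H.support ∧ v' ∈ H.support ∧ τ v = i ∧ τ v' = i ∧
      a ∉ H.support ∧ b ∉ H.support ∧ L.Adj v a ∧ L.Adj a b ∧ L.Adj b v' ∧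
      ∀ p r, L.Adj p r → (p = v ∧ r = a) ∨ (p = a ∧ r = v) ∨ (p = a ∧ r = b) ∨ (p = b ∧ r = a) ∨
        (p = b ∧ r = v') ∨ (p = v' ∧ r = b)) ∨
    (∃ i j, i ≠ j ∧ US W = {i, j} ∧ ∃ v y v', v ∈ H.support ∧ v' ∈ H.support ∧ τ v = i ∧ τ v' = j ∧
      y ∉ H.support ∧ L.Adj v y ∧ L.Adj y v') ∨
    (∃ i j m, i ≠ j ∧ i ≠ m ∧ j ≠ m ∧ US W = {i, j, m} ∧ ∀ x ∈ US W, ∀ y ∈ US W, x ≠ y →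
      ladj tl x y ∨ ∃ v v', v ∈ H.support ∧ v' ∈ H.support ∧ τ v = x ∧ τ v' = y ∧ L.Adj v v') := by
  obtain ⟨e, he, hW⟩ := h
  have hadj : ∀ i j, i ≠ j → W.Adj (e i) (e j) := by
    intro i j hij
    rw [hW, img_adj' he C3_good]
    revert i j; decide
  have hsup : ∀ x ∈ W.support, x = e 0 ∨ x = e 1 ∨ x = e 2 := by
    intro x hx
    rw [hW] at hx
    obtain ⟨i, rfl⟩ := img_supp hx
    fin_cases i <;> simp
  have h01 := hadj 0 1 (by decide)
  have h02 := hadj 0 2 (by decide)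
  have h12 := hadj 1 2 (by decide)
  clear hadj hW he
  revert h01 h02 h12 hsup
  generalize e 0 = x
  generalize e 1 = y
  generalize e 2 = z
  intro hsup h01 h02 h12
  have one : ∀ (i : Fin k) (a b : V), W.Adj (Sum.inr i) (Sum.inl a) → W.Adj (Sum.inr i) (Sum.inl b) →
      W.Adj (Sum.inl a) (Sum.inl b) →
      (∀ x ∈ W.support, x = Sum.inr i ∨ x = Sum.inl a ∨ x = Sum.inl b) →
      (∃ i, US W = {i} ∧ ∃ v a b v', v ∈ H.support ∧ v' ∈ H.support ∧ τ v = i ∧ τ v' = i ∧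
      a ∉ H.support ∧ b ∉ H.support ∧ L.Adj v a ∧ L.Adj a b ∧ L.Adj b v' ∧
      ∀ p r, L.Adj p r → (p = v ∧ r = a) ∨ (p = a ∧ r = v) ∨ (p = a ∧ r = b) ∨ (p = b ∧ r = a) ∨
        (p = b ∧ r = v') ∨ (p = v' ∧ r = b)) := by
    intro i a b h1 h2 h3 hs
    refine ⟨i, ?_, ?_⟩
    · ext j
      simp only [mem_US, Finset.mem_singleton]
      constructor
      · intro h
        rcases hs _ h with h | h | h <;> cases h
        rfl
      · rintro rfl
        exact ⟨_, h1⟩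
    · obtain ⟨v, hv, hv2, hv3, ha⟩ := F.up_rl h1
      obtain ⟨v', hv', hv2', hv3', hb⟩ := F.up_rl h2
      have h3L := (F.up_ll h3).1
      refine ⟨v, a, b, v', hv, hv', hv2, hv2', ha, hb, hv3, h3L, hv3'.symm, ?_⟩
      intro p r hpr
      have hd := F.down p r hpr
      have e1 : pr H τ v = Sum.inr i := by rw [pr_in hv, hv2]
      have e2 : pr H τ v' = Sum.inr i := by rw [pr_in hv', hv2']
      have e3 : pr H τ a = Sum.inl a := pr_out ha
      have e4 : pr H τ b = Sum.inl b := pr_out hb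
      rcases hs _ ⟨_, hd⟩ with hp | hp | hp <;> rcases hs _ ⟨_, hd.symm⟩ with hr | hr | hr
      · exact absurd (hp.trans hr.symm) hd.ne
      · exact Or.inl (F.inj _ _ _ _ hpr hv3 (hp.trans e1.symm) (hr.trans e3.symm))
      · have := F.inj _ _ _ _ hpr hv3' (hp.trans e2.symm) (hr.trans e4.symm)
        tauto
      · have := F.inj _ _ _ _ hpr hv3.symm (hp.trans e3.symm) (hr.trans e1.symm)
        tauto
      · exact absurd (hp.trans hr.symm) hd.ne
      · have := F.inj _ _ _ _ hpr h3L (hp.trans e3.symm) (hr.trans e4.symm)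
        tauto
      · have := F.inj _ _ _ _ hpr hv3'.symm (hp.trans e4.symm) (hr.trans e2.symm)
        tauto
      · have := F.inj _ _ _ _ hpr h3L.symm (hp.trans e4.symm) (hr.trans e3.symm)
        tauto
      · exact absurd (hp.trans hr.symm) hd.ne
  have two : ∀ (i j : Fin k) (b : V), W.Adj (Sum.inr i) (Sum.inr j) → W.Adj (Sum.inr i) (Sum.inl b) →
      W.Adj (Sum.inr j) (Sum.inl b) →
      (∀ x ∈ W.support, x = Sum.inr i ∨ x = Sum.inr j ∨ x = Sum.inl b) →
      (∃ i j, i ≠ j ∧ US W = {i, j} ∧ ∃ v y v', v ∈ H.support ∧ v' ∈ H.support ∧ τ v = i ∧ τ v' = j ∧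
      y ∉ H.support ∧ L.Adj v y ∧ L.Adj y v') := by
    intro i j b h1 h2 h3 hs
    refine ⟨i, j, ?_, ?_, ?_⟩
    · rintro rfl
      exact h1.ne rfl
    · ext m
      simp only [mem_US, Finset.mem_singleton, Finset.mem_insert]
      constructor
      · intro h
        rcases hs _ h with h | h | h <;> cases h <;> simp
      · rintro (rfl | rfl)
        · exact ⟨_, h1⟩
        · exact ⟨_, h3⟩
    · obtain ⟨v, hv, hv2, hv3, ha⟩ := F.up_rl h2
      obtain ⟨v', hv', hv2', hv3', hb⟩ := F.up_rl h3
      exact ⟨v, b, v', hv, hv', hv2, hv2', ha, hv3, hv3'.symm⟩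
  rcases x with x | x <;> rcases y with y | y <;> rcases z with z | z
  · obtain ⟨i, hi⟩ := F.U_ne hG
    rcases hsup _ (mem_US.1 hi) with h | h | h <;> cases h
  · exact Or.inl (one z x y h02.symm h12.symm h01 fun w hw => by have := hsup w hw; tauto)
  · exact Or.inl (one y x z h01.symm h12 h02 fun w hw => by have := hsup w hw; tauto)
  · exact Or.inr (Or.inl (two y z x h12 h01.symm h02.symm fun w hw => by have := hsup w hw; tauto))
  · exact Or.inl (one x y z h01 h02 h12 hsup)
  · exact Or.inr (Or.inl (two x z y h02 h01 h12.symm fun w hw => by have := hsup w hw; tauto))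
  · exact Or.inr (Or.inl (two x y z h01 h02 h12 hsup))
  · right; right
    have hU : US W = {x, y, z} := by
      ext m
      simp only [mem_US, Finset.mem_singleton, Finset.mem_insert]
      constructor
      · intro h
        rcases hsup _ h with h | h | h <;> cases h <;> simp
      · rintro (rfl | rfl | rfl)
        · exact ⟨_, h01⟩
        · exact ⟨_, h12⟩
        · exact ⟨_, h12.symm⟩
    refine ⟨x, y, z, ?_, ?_, ?_, hU, ?_⟩
    · rintro rfl; exact h01.ne rfl
    · rintro rfl; exact h02.ne rfl
    · rintro rfl; exact h12.ne rfl
    · intro i hi j hj hij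
      rw [hU] at hi hj
      simp only [Finset.mem_singleton, Finset.mem_insert] at hi hj
      apply F.up_rr
      rcases hi with rfl | rfl | rfl <;> rcases hj with rfl | rfl | rfl <;>
        first
          | exact absurd rfl hij
          | assumption
          | exact h01.symm
          | exact h02.symm
          | exact h12.symm

end Fold

theorem pp_C3 {W : SimpleGraph V} (h : IsC3 W) : pp W ≤ 3 := by
  obtain ⟨e, he, rfl⟩ := h
  exact (pp_img he C3_good).trans (by simp [C3l])

theorem pp_E {W : SimpleGraph V} (h : IsE W) : pp W ≤ 2 := by
  obtain ⟨l, hl, e, he, rfl⟩ := h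
  rcases hl with rfl | rfl
  · exact (pp_img he E1_good).trans (by simp [E1l])
  · exact (pp_img he E2_good).trans (by simp [E2l])

end C52

namespace C52
variable {V : Type}

/-! ### Triangles, deletion, the gap lemma -/

def del (G : SimpleGraph V) (S : Set V) : SimpleGraph V where
  Adj a b := G.Adj a b ∧ a ∉ S ∧ b ∉ S
  symm := ⟨fun _ _ ⟨h, h1, h2⟩ => ⟨h.symm, h2, h1⟩⟩
  loopless := ⟨fun _ h => h.1.ne rfl⟩

theorem del_le (G : SimpleGraph V) (S : Set V) : del G S ≤ G := fun _ _ h => h.1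

theorem del_lt {G : SimpleGraph V} {S : Set V} {a b : V} (h : G.Adj a b) (ha : a ∈ S) :
    del G S < G :=
  lt_of_le_of_ne (del_le G S) fun h' => by
    rw [← h'] at h
    exact h.2.1 ha

theorem walk4 : ∀ a b : Fin 5, ∃ p r s, c5 a p ∧ c5 p r ∧ c5 r s ∧ c5 s b := by decide
theorem walk3 : ∀ a b : Fin 5, a ≠ b → ∃ p r, c5 a p ∧ c5 p r ∧ c5 r b := by decide

variable [Fintype V]

theorem Cex.tri {G : SimpleGraph V} (hG : Cex G) {a b c : V} (h1 : G.Adj a b) (h2 : G.Adj b c)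
    (h3 : G.Adj a c) : False := by
  have hi : Function.Injective ![a, b, c] := by
    intro i j h
    have := h1.ne; have := h2.ne; have := h3.ne
    have := h1.ne'; have := h2.ne'; have := h3.ne'
    fin_cases i <;> fin_cases j <;> simp_all
  have hle : img C3l ![a, b, c] ≤ G := by
    apply img_le
    simp [C3l, h1, h2, h3.symm]
  rcases hle.lt_or_eq with h | h
  · obtain ⟨f, hf⟩ := hG.crit _ h
    have k1 := hf a b ((img_adj' hi C3_good (i := 0) (j := 1)).2 (by decide))
    have k2 := hf b c ((img_adj' hi C3_good (i := 1) (j := 2)).2 (by decide))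
    have k3 := hf a c ((img_adj' hi C3_good (i := 0) (j := 2)).2 (by decide))
    have : ∀ x y z : Fin 5, c5 x y → c5 y z → c5 x z → False := by decide
    exact this _ _ _ k1 k2 k3
  · exact hG.n3 ⟨_, hi, h.symm⟩

theorem Cex.gap {G : SimpleGraph V} (hG : Cex G) {x0 x1 x2 x3 x4 : V}
    (d12 : x1 ≠ x2) (d13 : x1 ≠ x3) (d23 : x2 ≠ x3)
    (d01 : x0 ≠ x1) (d02 : x0 ≠ x2) (d03 : x0 ≠ x3) (d41 : x4 ≠ x1) (d42 : x4 ≠ x2) (d43 : x4 ≠ x3)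
    (n1 : ∀ w, G.Adj x1 w → w = x0 ∨ w = x2) (n2 : ∀ w, G.Adj x2 w → w = x1 ∨ w = x3)
    (n3 : ∀ w, G.Adj x3 w → w = x2 ∨ w = x4) : False := by
  classical
  obtain ⟨w, hw⟩ := hG.supp x1
  obtain ⟨c, hc⟩ := hG.crit (del G {x1, x2, x3}) (del_lt hw (by simp))
  obtain ⟨p, r, s, h1, h2, h3, h4⟩ := walk4 (c x0) (c x4)
  apply hG.nc
  refine ⟨fun v => if v = x1 then p else if v = x2 then r else if v = x3 then s else c v, ?_⟩
  have key : ∀ a b, G.Adj a b → (a = x1 ∨ a = x2 ∨ a = x3) → 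
      c5 (if a = x1 then p else if a = x2 then r else if a = x3 then s else c a)
        (if b = x1 then p else if b = x2 then r else if b = x3 then s else c b) := by
    rintro a b hab (rfl | rfl | rfl)
    · rcases n1 b hab with rfl | rfl
      · simpa [d01, d02, d03] using c5_symm h1
      · simpa [d12.symm] using h2
    · rcases n2 b hab with rfl | rfl
      · simpa [d12.symm] using c5_symm h2
      · simpa [d12.symm, d13.symm, d23.symm] using h3
    · rcases n3 b hab with rfl | rfl
      · simpa [d12.symm, d13.symm, d23.symm] using c5_symm h3
      · simpa [d41, d42, d43, d13.symm, d23.symm] using h4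
  intro a b hab
  by_cases ha : a = x1 ∨ a = x2 ∨ a = x3
  · exact key a b hab ha
  by_cases hb : b = x1 ∨ b = x2 ∨ b = x3
  · exact c5_symm (key b a hab.symm hb)
  have := hc a b ⟨hab, by simpa using ha, by simpa using hb⟩
  push Not at ha hb
  simpa [ha, hb] using this

/-! ### Lemma A -/

def C5l : List (Fin 5 × Fin 5) := [(0,1), (1,2), (2,3), (3,4), (4,0)]

theorem C5_good : good C5l := by decide
theorem C5_ladj : ∀ a b, c5 a b → ladj C5l a b := by decide
theorem q5 : ∀ U : Finset (Fin 5), U.Nonempty → 5 ≤ q C5l U := by decide +kernel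
theorem q5' : ∀ U : Finset (Fin 5), q C5l U ≤ 5 → U.card ≠ 2 ∧ U.card ≠ 3 := by decide +kernel

/-- the structure of a graph `G` obtained from `H` by adding a 3-path with ends `x`, `y` -/
structure A4 (G H : SimpleGraph V) (x s t y : V) : Prop where
  hs : s ∉ H.support
  ht : t ∉ H.support
  hx : x ∈ H.support
  hy : y ∈ H.support
  hxy : x ≠ y
  cov : ∀ v, v ∈ H.support ∨ v = s ∨ v = t
  xs : G.Adj x s
  st : G.Adj s t
  ty : G.Adj t y
  adj : ∀ a b, G.Adj a b → H.Adj a b ∨ (a = x ∧ b = s) ∨ (a = s ∧ b = x) ∨ (a = s ∧ b = t) ∨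
    (a = t ∧ b = s) ∨ (a = t ∧ b = y) ∨ (a = y ∧ b = t)
  col : ∀ c, IsCol H c → c x = c y

theorem pp_add_edge {H : SimpleGraph V} {a b : V} (ha : a ∈ H.support) (hb : b ∈ H.support)
    (hab : a ≠ b) (hn : ¬ H.Adj a b) : pp (H ⊔ edge a b) ≤ pp H - 4 := by
  have h1 : (edge a b).edgeSet.ncard = 1 := by
    rw [edgeSet_edge_of_ne hab, Set.ncard_singleton]
  have := pp_sup (A := H) (B := edge a b) ∅ 0 (by simp) ?_ ?_
  · rw [h1] at this
    push_cast at this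
    omega
  · rintro v ⟨w, hw⟩
    replace hw : (edge a b).Adj v w := hw
    rw [edge_adj] at hw
    left
    rcases hw.1 with ⟨rfl, rfl⟩ | ⟨rfl, rfl⟩ <;> assumption
  · intro u v huv h
    rw [edge_adj] at h
    rcases h.1 with ⟨rfl, rfl⟩ | ⟨rfl, rfl⟩
    · exact hn huv
    · exact hn huv.symm

theorem Cex.lemA_core {G : SimpleGraph V} (hG : Cex G) {H : SimpleGraph V} (hH : H < G)
    (hne : ∃ a b, H.Adj a b)
    (hmin : ∀ H' : SimpleGraph V, H' < G → (∃ a b, H'.Adj a b) → pp H ≤ pp H') (h4 : pp H ≤ 4) :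
    pp H = 4 ∧ ∃ x s t y, A4 G H x s t y := by
  classical
  have hind : ∀ a b, G.Adj a b → a ∈ H.support → b ∈ H.support → H.Adj a b := by
    intro a b hab ha hb
    by_contra hn
    have h1 := pp_add_edge ha hb hab.ne hn
    have hle : H ⊔ edge a b ≤ G := sup_le hH.le (by rw [edge_le_iff]; exact Or.inr hab)
    rcases hle.lt_or_eq with h | h
    · have := hmin _ h (hne.imp fun a => Exists.imp fun b h => Or.inl h)
      omega
    · have := hG.pos
      rw [← h] at this
      omega
  obtain ⟨c, hc⟩ := hG.crit H hH
  have hni : ∃ a b, a ≠ b ∧ a ∈ H.support ∧ b ∈ H.support ∧ c a = c b := by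
    by_contra! hcon
    have hinj : Set.InjOn c H.support := by
      intro a ha b hb hab
      by_contra hne
      exact hcon a b hne ha hb hab
    set U : Finset (Fin 5) := Finset.univ.filter fun i => ∃ v ∈ H.support, c v = i with hU
    have h1 : U.card = H.support.ncard := by
      rw [← Set.InjOn.ncard_image hinj, ← Set.ncard_coe_finset]
      congr 1
      ext i
      simp [hU]
    have h2 : H.edgeSet.ncard ≤ eT C5l U := by
      have : H.edgeSet.ncard ≤ (((C5l.filter fun p => p.1 ∈ U ∧ p.2 ∈ U).toFinset.image
          fun p => s(p.1, p.2) : Finset (Sym2 (Fin 5))) : Set (Sym2 (Fin 5))).ncard := by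
        refine Set.ncard_le_ncard_of_injOn (Sym2.map c) ?_ ?_ (Set.toFinite _)
        · intro x
          induction x with | _ u v
          intro h
          have hu : c u ∈ U := by simp only [hU, Finset.mem_filter_univ]; exact ⟨u, ⟨v, h⟩, rfl⟩
          have hv : c v ∈ U := by simp only [hU, Finset.mem_filter_univ]; exact ⟨v, ⟨u, h.symm⟩, rfl⟩
          simp only [Finset.coe_image, Set.mem_image, Sym2.map_mk]
          rcases C5_ladj _ _ (hc u v h) with hl | hl
          · exact ⟨(c u, c v), by simp [hu, hv, hl], rfl⟩
          · exact ⟨(c v, c u), by simp [hu, hv, hl], Sym2.eq_swap⟩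
        · intro x hx y hy hxy
          induction x with | _ u v
          induction y with | _ u' v'
          have hx : H.Adj u v := hx
          have hy : H.Adj u' v' := hy
          simp only [Sym2.map_mk, Sym2.eq_iff] at hxy
          rcases hxy with ⟨k1, k2⟩ | ⟨k1, k2⟩
          · rw [hinj ⟨_, hx⟩ ⟨_, hy⟩ k1, hinj ⟨_, hx.symm⟩ ⟨_, hy.symm⟩ k2]
          · rw [hinj ⟨_, hx⟩ ⟨_, hy.symm⟩ k1, hinj ⟨_, hx.symm⟩ ⟨_, hy⟩ k2, Sym2.eq_swap]
      refine this.trans ?_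
      rw [Set.ncard_coe_finset]
      exact Finset.card_image_le.trans (List.toFinset_card_le _)
    have h3 := q5 U (by
      obtain ⟨a, b, hab⟩ := hne
      exact ⟨c a, by simp only [hU, Finset.mem_filter_univ]; exact ⟨a, ⟨b, hab⟩, rfl⟩⟩)
    unfold q at h3
    unfold pp at h4
    omega
  obtain ⟨W, L, F⟩ := exists_fold hG C5l C5_good c hH.le hne (fun a b h => C5_ladj _ _ (hc a b h))
    (fun a b h ha hb h' => by
      have := hc a b (hind a b h ha hb)
      rw [h'] at this
      revert this
      generalize c b = z
      revert z; decide) hni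
  have hb := F.bound'
  have hU := F.U_ne hG
  have hq := q5 _ hU
  have hw : pp W ≤ 3 := by
    rcases F.sp with h | h | h
    · omega
    · exact pp_C3 h
    · linarith [pp_E h]
  rcases F.YG.lt_or_eq with hY | hY
  · have := hmin _ hY (hne.imp fun a => Exists.imp fun b h => Or.inl h)
    omega
  · have hpos := hG.pos
    rw [← hY] at hpos
    have hp4 : pp H = 4 := by omega
    refine ⟨hp4, ?_⟩
    have hC : IsC3 W := by
      rcases F.sp with h | h | h
      · omega
      · exact h
      · have := pp_E h; omega
    have hcard := q5' (US W) (by omega)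
    rcases F.c3 hG hC with h | h | h
    · obtain ⟨i, _, v, a, b, v', hv, hv', hi, hi', ha, hb', l1, l2, l3, hall⟩ := h
      have hvv : v ≠ v' := by
        rintro rfl
        exact hG.tri (F.LG.le l1) (F.LG.le l2) (F.LG.le l3.symm)
      have hadj : ∀ p r, G.Adj p r → H.Adj p r ∨ L.Adj p r := by
        intro p r h
        rw [← hY] at h
        exact h
      refine ⟨v, a, b, v', ha, hb', hv, hv', hvv, ?_, F.LG.le l1, F.LG.le l2, F.LG.le l3, ?_, ?_⟩
      · intro w
        obtain ⟨z, hz⟩ := hG.supp w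
        rcases hadj w z hz with h | h
        · exact Or.inl ⟨_, h⟩
        · rcases hall _ _ h with h | h | h | h | h | h <;> obtain ⟨rfl, rfl⟩ := h <;> tauto
      · intro p r h
        rcases hadj p r h with h | h
        · exact Or.inl h
        · exact Or.inr (hall p r h)
      · intro c' hc'
        by_contra hcc
        obtain ⟨p, r, h1, h2, h3⟩ := walk3 _ _ hcc
        have hva : v ≠ a := fun h => ha (h ▸ hv)
        have hvb : v ≠ b := fun h => hb' (h ▸ hv)
        have hva' : v' ≠ a := fun h => ha (h ▸ hv')
        have hvb' : v' ≠ b := fun h => hb' (h ▸ hv')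
        have hab := l2.ne
        apply hG.nc
        refine ⟨fun z => if z = a then p else if z = b then r else c' z, ?_⟩
        intro x y hxy
        rcases hadj x y hxy with h | h
        · have hx : x ∈ H.support := ⟨_, h⟩
          have hy : y ∈ H.support := ⟨_, h.symm⟩
          have n1 : x ≠ a := fun h => ha (h ▸ hx)
          have n2 : x ≠ b := fun h => hb' (h ▸ hx)
          have n3 : y ≠ a := fun h => ha (h ▸ hy)
          have n4 : y ≠ b := fun h => hb' (h ▸ hy)
          simpa [n1, n2, n3, n4] using hc' x y h
        · rcases hall _ _ h with h | h | h | h | h | h <;> obtain ⟨rfl, rfl⟩ := h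
          · simpa [hva, hvb] using h1
          · simpa [hva, hvb] using c5_symm h1
          · simpa [hab.symm] using h2
          · simpa [hab.symm] using c5_symm h2
          · simpa [hva', hvb', hab.symm] using h3
          · simpa [hva', hvb', hab.symm] using c5_symm h3
    · obtain ⟨i, j, hij, h, _⟩ := h
      rw [h, Finset.card_pair hij] at hcard
      omega
    · obtain ⟨i, j, m, hij, him, hjm, h, _⟩ := h
      rw [h, Finset.card_eq_three.2 ⟨i, j, m, hij, him, hjm, rfl⟩] at hcard
      omega

theorem Cex.lemA' {G : SimpleGraph V} (hG : Cex G) {H : SimpleGraph V} (hH : H < G)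
    (hne : ∃ a b, H.Adj a b) (h4 : pp H ≤ 4) : pp H = 4 ∧ ∃ x s t y, A4 G H x s t y := by
  obtain ⟨K, ⟨hK1, hK2⟩, hm⟩ := Set.exists_min_image
    {K : SimpleGraph V | K < G ∧ ∃ a b, K.Adj a b} pp (Set.toFinite _) ⟨H, hH, hne⟩
  have hKH := hm H ⟨hH, hne⟩
  have h1 := hG.lemA_core hK1 hK2 (fun H' a b => hm H' ⟨a, b⟩) (by omega)
  exact hG.lemA_core hH hne (fun H' a b => by have := hm H' ⟨a, b⟩; omega) h4

theorem Cex.lemA {G : SimpleGraph V} (hG : Cex G) {H : SimpleGraph V} (hH : H < G)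
    (hne : ∃ a b, H.Adj a b) : 4 ≤ pp H := by
  by_contra h
  have := hG.lemA' hH hne (by omega)
  omega

theorem Cex.induced {G : SimpleGraph V} (hG : Cex G) {H : SimpleGraph V} (hH : H < G)
    (h5 : pp H ≤ 5) {a b : V} (hab : G.Adj a b) (ha : a ∈ H.support) (hb : b ∈ H.support) :
    H.Adj a b := by
  by_contra hn
  have h1 := pp_add_edge ha hb hab.ne hn
  have hle : H ⊔ edge a b ≤ G := sup_le hH.le (by rw [edge_le_iff]; exact Or.inr hab)
  rcases hle.lt_or_eq with h | h
  · have := hG.lemA h ⟨a, ha.imp fun _ h => Or.inl h⟩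
    omega
  · have := hG.pos
    rw [← h] at this
    omega

end C52

set_option linter.unusedSectionVars false
namespace C52
variable {V : Type} [Fintype V]

/-! ### Folding concrete subgraphs -/

def cv {n : ℕ} (l : List (Fin n × Fin n)) : ℕ := (Finset.univ.filter fun i => ∃ j, ladj l i j).card

theorem pp_img' {n : ℕ} {l : List (Fin n × Fin n)} {e : Fin n → V} (he : e.Injective)
    (hl : good l) : pp (img l e) ≤ 5 * cv l - 4 * l.length := by
  have h1 : (img l e).support.ncard ≤ cv l := by
    unfold cv
    rw [← Set.ncard_coe_finset, ← Set.ncard_image_of_injective _ he]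
    refine Set.ncard_le_ncard ?_ (Set.toFinite _)
    rintro v ⟨w, hw⟩
    obtain ⟨_, i, j, hij, h, _⟩ := img_adj.1 hw
    exact ⟨i, by simpa using ⟨j, hij⟩, h⟩
  unfold pp
  rw [img_edges he hl]
  omega

theorem img_mem_supp' {n : ℕ} {l : List (Fin n × Fin n)} {e : Fin n → V} (he : e.Injective)
    (hl : good l) {i j : Fin n} (h : ladj l i j) : e i ∈ (img l e).support :=
  ⟨e j, (img_adj' he hl).2 h⟩

/-- extend a vertex map by one more vertex -/
def ex {n : ℕ} (e : Fin n → V) (y : V) : Fin (n + 1) → V :=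
  fun i => if h : i.1 < n then e ⟨i.1, h⟩ else y

theorem ex_inj {n : ℕ} {e : Fin n → V} {y : V} (he : e.Injective) (hy : ∀ i, e i ≠ y) :
    (ex e y).Injective := by
  intro i j h
  unfold ex at h
  split_ifs at h with h1 h2 h2
  · have := he h
    simp only [Fin.mk.injEq] at this
    exact Fin.ext this
  · exact absurd h (hy _)
  · exact absurd h.symm (hy _)
  · apply Fin.ext; omega

structure FI {n k : ℕ} (G : SimpleGraph V) (l : List (Fin n × Fin n)) (e : Fin n → V)
    (tl : List (Fin k × Fin k)) (t : Fin n → Fin k) (W : SimpleGraph (V ⊕ Fin k))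
    (L : SimpleGraph V) (τ : V → Fin k) : Prop where
  he : e.Injective
  hl : good l
  cov : ∀ i, ∃ j, ladj l i j
  ht : ∀ i, τ (e i) = t i
  F : Fold G (img l e) tl τ W L

theorem exists_FI {n k : ℕ} [NeZero k] {G : SimpleGraph V} (hG : Cex G) (l : List (Fin n × Fin n))
    {e : Fin n → V} (tl : List (Fin k × Fin k)) (t : Fin n → Fin k) (he : e.Injective)
    (hle : img l e ≤ G) (sep : ∀ i j, t i = t j → ¬ G.Adj (e i) (e j))
    (hdec : (good l ∧ (∀ i, ∃ j, ladj l i j)) ∧ good tl ∧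
      (∀ p ∈ l, ladj tl (t p.1) (t p.2)) ∧ (∃ i j, i ≠ j ∧ t i = t j)) :
    ∃ W L τ, FI G l e tl t W L τ := by
  obtain ⟨⟨hl, cov⟩, gd, hT, i, j, hij, htij⟩ := hdec
  have h0 : ∀ i, Function.extend e t (fun _ => 0) (e i) = t i := fun i => he.extend_apply _ _ _
  suffices hF : ∃ W L, Fold G (img l e) tl (Function.extend e t fun _ => 0) W L by
    obtain ⟨W, L, F⟩ := hF
    exact ⟨W, L, _, he, hl, cov, h0, F⟩
  refine exists_fold hG tl gd (Function.extend e t fun _ => 0) hle ?_ ?_ ?_ ?_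
  · obtain ⟨j, hj⟩ := cov i
    exact ⟨_, _, (img_adj' he hl).2 hj⟩
  · intro a b hab
    obtain ⟨_, i, j, hij, rfl, rfl⟩ := img_adj.1 hab
    rw [h0, h0]
    rcases hij with h | h
    · exact hT _ h
    · exact (hT _ h).symm
  · intro a b hab ha hb
    obtain ⟨i, rfl⟩ := img_supp ha
    obtain ⟨j, rfl⟩ := img_supp hb
    rw [h0, h0]
    exact fun h => sep i j h hab
  · refine ⟨e i, e j, fun h => hij (he h), img_mem_supp he hl cov i, img_mem_supp he hl cov j, ?_⟩
    rw [h0, h0, htij]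

namespace FI

variable {n k : ℕ} {G : SimpleGraph V} {l : List (Fin n × Fin n)} {e : Fin n → V}
    {tl : List (Fin k × Fin k)} {t : Fin n → Fin k} {W : SimpleGraph (V ⊕ Fin k)}
    {L : SimpleGraph V} {τ : V → Fin k}

theorem ms (I : FI G l e tl t W L τ) (i : Fin n) : e i ∈ (img l e).support :=
  img_mem_supp I.he I.hl I.cov i

theorem nms (I : FI G l e tl t W L τ) {v : V} (h : v ∉ (img l e).support) (i : Fin n) : e i ≠ v := by
  rintro rfl
  exact h (I.ms i)

theorem LG (I : FI G l e tl t W L τ) {a b : V} (h : L.Adj a b) : G.Adj a b := I.F.LG.le h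

theorem S (I : FI G l e tl t W L τ) (hG : Cex G) (u0 : Fin n) (hU : US W = {t u0})
    (h : ∀ u, t u = t u0 → u = u0) : False := by
  refine I.F.S (e u0) (by simp [hU]) ?_ (I.F.colL hG)
  intro a b hab ha
  have := I.F.mem_U hab ha
  obtain ⟨i, rfl⟩ := img_supp ha
  rw [I.ht, hU, Finset.mem_singleton] at this
  rw [h i this]

theorem out (I : FI G l e tl t W L τ) (hY : img l e ⊔ L = G) {u : Fin n} {w : V}
    (h : G.Adj (e u) w) (hn : ∀ j, ladj l u j → w ≠ e j) : t u ∈ US W := by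
  rw [← I.ht]
  refine I.F.out hY (I.ms u) h ?_
  intro h'
  obtain ⟨j, rfl⟩ := img_supp ⟨_, h'.symm⟩
  exact hn j ((img_adj' I.he I.hl).1 h') rfl

theorem bd (I : FI G l e tl t W L τ) (N : ℤ) (hN : 5 * (n : ℤ) - 4 * l.length = N) :
    pp (img l e ⊔ L) ≤ N + pp W - q tl (US W) := by
  have := I.F.bound'
  have := pp_img (V := V) I.he I.hl
  omega

theorem bd1 (I : FI G l e tl t W L τ) (l1 : List (Fin n × Fin n)) (g1 : good l1)
    (h1 : ∀ p ∈ l1, p ∈ l) (N : ℤ) (hN : 5 * (cv l1 : ℤ) - 4 * l1.length = N)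
    (h2 : ∀ u, t u ∈ US W → ∃ j, ladj l1 u j) :
    pp (img l1 e ⊔ L) ≤ N + pp W - q tl (US W) := by
  have := I.F.bound (img l1 e) ?_ ?_
  · have := pp_img' (V := V) I.he g1
    omega
  · apply img_le
    intro p hp
    exact (img_adj' I.he I.hl).2 (Or.inl (h1 p hp))
  · intro v hv h
    obtain ⟨i, rfl⟩ := img_supp hv
    rw [I.ht] at h
    obtain ⟨j, hj⟩ := h2 i h
    exact img_mem_supp' I.he g1 hj

theorem c3 (I : FI G l e tl t W L τ) (hG : Cex G) (h : IsC3 W) :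
    (∃ i, US W = {i} ∧ ∃ u u' a b, t u = i ∧ t u' = i ∧ u ≠ u' ∧ (∀ m, e m ≠ a) ∧ (∀ m, e m ≠ b) ∧
      L.Adj (e u) a ∧ L.Adj a b ∧ L.Adj b (e u')) ∨
    (∃ i j, i ≠ j ∧ US W = {i, j} ∧ ∃ u y u', t u = i ∧ t u' = j ∧
      (∀ m, e m ≠ y) ∧ L.Adj (e u) y ∧ L.Adj y (e u')) ∨
    (∃ i j m, i ≠ j ∧ i ≠ m ∧ j ≠ m ∧ US W = {i, j, m} ∧ ∀ x ∈ US W, ∀ y ∈ US W, x ≠ y →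
      ladj tl x y ∨ ∃ u u', t u = x ∧ t u' = y ∧ L.Adj (e u) (e u')) := by
  rcases I.F.c3 hG h with h | h | h
  · left
    obtain ⟨i, hU, v, a, b, v', hv, hv', hi, hi', ha, hb, l1, l2, l3, _⟩ := h
    obtain ⟨u, rfl⟩ := img_supp hv
    obtain ⟨u', rfl⟩ := img_supp hv'
    rw [I.ht] at hi hi'
    refine ⟨i, hU, u, u', a, b, hi, hi', ?_, I.nms ha, I.nms hb, l1, l2, l3⟩
    rintro rfl
    exact hG.tri (I.LG l1) (I.LG l2) (I.LG l3.symm)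
  · right; left
    obtain ⟨i, j, hij, hU, v, y, v', hv, hv', hi, hi', ha, l1, l2⟩ := h
    obtain ⟨u, rfl⟩ := img_supp hv
    obtain ⟨u', rfl⟩ := img_supp hv'
    rw [I.ht] at hi hi'
    exact ⟨i, j, hij, hU, u, y, u', hi, hi', I.nms ha, l1, l2⟩
  · right; right
    obtain ⟨i, j, m, hij, him, hjm, hU, h⟩ := h
    refine ⟨i, j, m, hij, him, hjm, hU, ?_⟩
    intro x hx y hy hxy
    rcases h x hx y hy hxy with h | ⟨v, v', hv, hv', hi, hi', h⟩
    · exact Or.inl h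
    · right
      obtain ⟨u, rfl⟩ := img_supp hv
      obtain ⟨u', rfl⟩ := img_supp hv'
      rw [I.ht] at hi hi'
      exact ⟨u, u', hi, hi', h⟩

theorem c3card (I : FI G l e tl t W L τ) (hG : Cex G) (h : IsC3 W) : (US W).card ≤ 3 := by
  rcases I.F.c3 hG h with ⟨i, h, _⟩ | ⟨i, j, _, h, _⟩ | ⟨i, j, m, _, _, _, h, _⟩ <;> rw [h]
  · simp
  · exact Finset.card_le_two.trans (by norm_num)
  · exact Finset.card_le_three

theorem w3 (I : FI G l e tl t W L τ) : pp W ≤ 3 := by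
  rcases I.F.sp with h | h | h
  · omega
  · exact pp_C3 h
  · linarith [pp_E h]

theorem isC3 (I : FI G l e tl t W L τ) (h : 2 < pp W) : IsC3 W := by
  rcases I.F.sp with h' | h' | h'
  · omega
  · exact h'
  · have := pp_E h'; omega

theorem ne (I : FI G l e tl t W L τ) (hn : 0 < n) : ∃ a b, (img l e ⊔ L).Adj a b := by
  obtain ⟨j, hj⟩ := I.cov ⟨0, hn⟩
  exact ⟨_, _, Or.inl ((img_adj' I.he I.hl).2 hj)⟩

theorem lemA (I : FI G l e tl t W L τ) (hG : Cex G) (hn : 0 < n) (h : pp (img l e ⊔ L) < 4) :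
    img l e ⊔ L = G ∧ 2 ≤ pp (img l e ⊔ L) := by
  rcases I.F.YG.lt_or_eq with hY | hY
  · have := hG.lemA hY (I.ne hn)
    omega
  · refine ⟨hY, ?_⟩
    rw [hY]
    exact hG.pos

end FI

/-- concrete subgraphs of potential four whose colourings separate all pairs do not exist -/
theorem Cex.img4 {n : ℕ} {G : SimpleGraph V} (hG : Cex G) {l : List (Fin n × Fin n)} {e : Fin n → V}
    (he : e.Injective) (hl : good l) (hle : ∀ p ∈ l, G.Adj (e p.1) (e p.2)) (hp : 5 * (n : ℤ) - 4 * l.length ≤ 4)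
    (hne : ∃ i j, ladj l i j) (hc : ∃ c : Fin n → Fin 5, ∀ p ∈ l, c5 (c p.1) (c p.2)) :
    ∃ i j s t, i ≠ j ∧ A4 G (img l e) (e i) s t (e j) ∧
      ∀ c : Fin n → Fin 5, (∀ p ∈ l, c5 (c p.1) (c p.2)) → c i = c j := by
  have hlt : img l e < G := by
    refine lt_of_le_of_ne (img_le hle) ?_
    intro h
    obtain ⟨c, hc⟩ := hc
    obtain ⟨c', h', _⟩ := img_isCol' he c hc
    exact hG.nc ⟨c', h ▸ h'⟩
  obtain ⟨i, j, hij⟩ := hne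
  obtain ⟨_, x, s, t, y, hA⟩ := hG.lemA' hlt ⟨_, _, (img_adj' he hl).2 hij⟩
    ((pp_img he hl).trans hp)
  obtain ⟨i, rfl⟩ := img_supp hA.hx
  obtain ⟨j, rfl⟩ := img_supp hA.hy
  refine ⟨i, j, s, t, fun h => hA.hxy (by rw [h]), hA, ?_⟩
  intro c hc
  obtain ⟨c', h', h''⟩ := img_isCol' he c hc
  have := hA.col c' h'
  rwa [h'', h''] at this

/-! ### Cycles -/

structure Cyc {n : ℕ} [NeZero n] (G : SimpleGraph V) (e : Fin n → V) : Prop where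
  inj : e.Injective
  adj : ∀ i, G.Adj (e i) (e (i + 1))

def Out {n : ℕ} [NeZero n] (G : SimpleGraph V) (e : Fin n → V) (i : Fin n) : Prop :=
  ∃ w, G.Adj (e i) w ∧ w ≠ e (i + 1) ∧ w ≠ e (i - 1)

theorem Cyc.rot {n : ℕ} [NeZero n] {G : SimpleGraph V} {e : Fin n → V} (h : Cyc G e) (r : Fin n) :
    Cyc G fun i => e (i + r) := by
  refine ⟨fun i j hij => add_right_cancel (h.inj hij), fun i => ?_⟩
  have := h.adj (i + r)
  rwa [add_right_comm] at this

theorem Cyc.refl {n : ℕ} [NeZero n] {G : SimpleGraph V} {e : Fin n → V} (h : Cyc G e) (r : Fin n) :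
    Cyc G fun i => e (r - i) := by
  refine ⟨fun i j hij => sub_right_injective (h.inj hij), fun i => ?_⟩
  have := h.adj (r - (i + 1))
  rw [show r - (i + 1) + 1 = r - i by abel] at this
  exact this.symm

theorem out_rot {n : ℕ} [NeZero n] {G : SimpleGraph V} {e : Fin n → V} {r i : Fin n} :
    Out G (fun i => e (i + r)) i ↔ Out G e (i + r) := by
  unfold Out
  beta_reduce
  rw [show i + 1 + r = i + r + 1 by abel, show i - 1 + r = i + r - 1 by abel]

theorem out_refl {n : ℕ} [NeZero n] {G : SimpleGraph V} {e : Fin n → V} {r i : Fin n} :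
    Out G (fun i => e (r - i)) i ↔ Out G e (r - i) := by
  unfold Out
  beta_reduce
  rw [show r - (i + 1) = r - i - 1 by abel, show r - (i - 1) = r - i + 1 by abel]
  simp only [and_comm]

theorem nOut {n : ℕ} [NeZero n] {G : SimpleGraph V} {e : Fin n → V} {i : Fin n}
    (h : ¬ Out G e i) : ∀ w, G.Adj (e i) w → w = e (i - 1) ∨ w = e (i + 1) := by
  intro w hw
  by_contra! hc
  exact h ⟨w, hw, hc.2, hc.1⟩

theorem Cyc.gap {n : ℕ} [NeZero n] {G : SimpleGraph V} {e : Fin n → V} (h : Cyc G e) (hG : Cex G)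
    (i : Fin n) (hd : i ≠ i + 1 ∧ i ≠ i + 1 + 1 ∧ i + 1 ≠ i + 1 + 1 ∧ i - 1 ≠ i ∧ i - 1 ≠ i + 1 ∧
      i - 1 ≠ i + 1 + 1 ∧ i + 1 + 1 + 1 ≠ i ∧ i + 1 + 1 + 1 ≠ i + 1 ∧ i + 1 + 1 + 1 ≠ i + 1 + 1) :
    Out G e i ∨ Out G e (i + 1) ∨ Out G e (i + 1 + 1) := by
  by_contra! hc
  have n1 := nOut hc.1
  have n2 := nOut hc.2.1
  have n3 := nOut hc.2.2
  rw [add_sub_cancel_right] at n2 n3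
  exact hG.gap (h.inj.ne hd.1) (h.inj.ne hd.2.1) (h.inj.ne hd.2.2.1) (h.inj.ne hd.2.2.2.1)
    (h.inj.ne hd.2.2.2.2.1) (h.inj.ne hd.2.2.2.2.2.1) (h.inj.ne hd.2.2.2.2.2.2.1)
    (h.inj.ne hd.2.2.2.2.2.2.2.1) (h.inj.ne hd.2.2.2.2.2.2.2.2) n1 n2 n3

/-! ### Four-cycles -/

def C4l : List (Fin 4 × Fin 4) := [(0,1), (1,2), (2,3), (3,0)]
def T4 : List (Fin 3 × Fin 3) := [(0,1), (0,2)]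

theorem Cex.noC4' {G : SimpleGraph V} (hG : Cex G) {e : Fin 4 → V} (h : Cyc G e)
    (ho : Out G e 1) : False := by
  have a0 := h.adj 0
  have a1 := h.adj 1
  have sep : ∀ i j, ![(0 : Fin 3), 1, 0, 2] i = ![(0 : Fin 3), 1, 0, 2] j → ¬ G.Adj (e i) (e j) := by
    have h02 : ¬ G.Adj (e 0) (e 2) := fun hh => hG.tri a0 a1 hh
    intro i j hij
    have : i = j ∨ (i = 0 ∧ j = 2) ∨ (i = 2 ∧ j = 0) := by revert i j; decide
    intro hadj
    rcases this with rfl | ⟨rfl, rfl⟩ | ⟨rfl, rfl⟩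
    · exact hadj.ne rfl
    · exact h02 hadj
    · exact h02 hadj.symm
  obtain ⟨W, L, τ, I⟩ := exists_FI hG C4l T4 ![0, 1, 0, 2] h.inj
    (img_le (by
      intro p hp
      have : p.2 = p.1 + 1 := by revert p; decide
      rw [this]; exact h.adj _)) sep (by decide)
  have hb := I.bd 4 (by decide)
  have hw := I.w3
  have hU := I.F.U_ne hG
  have hq : 5 ≤ q T4 (US W) := (by decide +kernel : ∀ U : Finset (Fin 3), U.Nonempty → 5 ≤ q T4 U) _ hU
  obtain ⟨hY, hpos⟩ := I.lemA hG (by norm_num) (by omega)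
  obtain ⟨w, hw1, hw2, hw3⟩ := ho
  have h1 : 1 ∈ US W := I.out hY (u := 1) hw1 (by
    intro j hj
    have : j = 0 ∨ j = 2 := by revert j; decide
    rcases this with rfl | rfl
    · exact hw3
    · exact hw2)
  rcases (by decide +kernel : ∀ U : Finset (Fin 3), 1 ∈ U → U = {1} ∨ 6 ≤ q T4 U) _ h1 with h2 | h2
  · exact I.S hG 1 h2 (by decide)
  · omega

theorem Cex.noC4 {G : SimpleGraph V} (hG : Cex G) {e : Fin 4 → V} (h : Cyc G e) : False := by
  have hg : Out G e 0 ∨ Out G e 1 ∨ Out G e 2 := h.gap hG 0 (by decide)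
  rcases hg with hg | hg | hg
  · exact hG.noC4' (h.rot 3) (out_rot.2 hg)
  · exact hG.noC4' h hg
  · exact hG.noC4' (h.rot 1) (out_rot.2 hg)

theorem Cex.c4 {G : SimpleGraph V} (hG : Cex G) {a b c d : V} (h1 : G.Adj a b) (h2 : G.Adj b c)
    (h3 : G.Adj c d) (h4 : G.Adj d a) (hac : a ≠ c) (hbd : b ≠ d) : False := by
  refine hG.noC4 (e := ![a, b, c, d]) ⟨?_, ?_⟩
  · intro i j h
    have := h1.ne; have := h2.ne; have := h3.ne; have := h4.ne
    have := h1.ne'; have := h2.ne'; have := h3.ne'; have := h4.ne'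
    have := hac.symm
    have := hbd.symm
    fin_cases i <;> fin_cases j <;> simp_all
  · intro i
    fin_cases i
    · exact h1
    · exact h2
    · exact h3
    · exact h4

/-! ### Six-cycles -/

def C6l : List (Fin 6 × Fin 6) := [(0,1), (1,2), (2,3), (3,4), (4,5), (5,0)]
def T6 : List (Fin 4 × Fin 4) := [(0,1), (0,2), (0,3)]
def K8l : List (Fin 8 × Fin 8) := [(0,1), (1,2), (2,3), (3,4), (4,5), (5,0), (0,6), (6,7), (7,2)]

end C52

set_option linter.unusedSectionVars false
namespace C52
variable {V : Type} [Fintype V]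

theorem Cyc.nadj2 {n : ℕ} [NeZero n] {G : SimpleGraph V} {e : Fin n → V} (h : Cyc G e) (hG : Cex G)
    (i j : Fin n) (hd : j = i + 1 + 1 ∨ i = j + 1 + 1) : ¬ G.Adj (e i) (e j) := by
  intro hadj
  rcases hd with rfl | rfl
  · exact hG.tri (h.adj i) (h.adj (i + 1)) hadj
  · exact hG.tri (h.adj j) (h.adj (j + 1)) hadj.symm

theorem Cyc.le {n : ℕ} [NeZero n] {G : SimpleGraph V} {e : Fin n → V} (h : Cyc G e)
    {l : List (Fin n × Fin n)} (hl : ∀ p ∈ l, p.2 = p.1 + 1) : ∀ p ∈ l, G.Adj (e p.1) (e p.2) := by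
  intro p hp
  rw [hl p hp]
  exact h.adj _

theorem Cex.noK8 {G : SimpleGraph V} (hG : Cex G) {e : Fin 6 → V} (h : Cyc G e) {a b : V}
    (ha : ∀ m, e m ≠ a) (hb : ∀ m, e m ≠ b) (h1 : G.Adj (e 0) a) (h2 : G.Adj a b)
    (h3 : G.Adj b (e 2)) : False := by
  have hi : (ex (ex e a) b).Injective := by
    refine ex_inj (ex_inj h.inj ha) ?_
    intro i
    unfold ex
    split_ifs
    · exact hb _
    · exact h2.ne
  obtain ⟨i, j, s, t, hij, _, hc⟩ := hG.img4 (l := K8l) hi (by decide) (by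
      simp only [K8l, List.forall_mem_cons, List.not_mem_nil, false_imp_iff, implies_true, and_true]
      exact ⟨h.adj 0, h.adj 1, h.adj 2, h.adj 3, h.adj 4, h.adj 5, h1, h2, h3⟩)
    (by decide) (by decide) ⟨![0, 1, 2, 3, 2, 1, 4, 3], by decide⟩
  have k1 := hc ![0, 1, 2, 3, 2, 1, 4, 3] (by decide)
  have k2 := hc ![0, 1, 2, 1, 0, 4, 4, 3] (by decide)
  exact (by decide : ∀ i j : Fin 8, i ≠ j →
    ![(0 : Fin 5), 1, 2, 3, 2, 1, 4, 3] i = ![(0 : Fin 5), 1, 2, 3, 2, 1, 4, 3] j →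
    ![(0 : Fin 5), 1, 2, 1, 0, 4, 4, 3] i = ![(0 : Fin 5), 1, 2, 1, 0, 4, 4, 3] j → False) i j hij k1 k2

theorem Cex.noC6' {G : SimpleGraph V} (hG : Cex G) {e : Fin 6 → V} (h : Cyc G e)
    (ho : Out G e 1) (ho3 : Out G e 3) : False := by
  have sep : ∀ i j, ![(0 : Fin 4), 1, 0, 2, 0, 3] i = ![(0 : Fin 4), 1, 0, 2, 0, 3] j →
      ¬ G.Adj (e i) (e j) := by
    intro i j hij
    have : i = j ∨ (j = i + 1 + 1 ∨ i = j + 1 + 1) := by revert i j; decide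
    rcases this with rfl | h'
    · exact fun h => h.ne rfl
    · exact h.nadj2 hG i j h'
  obtain ⟨W, L, τ, I⟩ := exists_FI hG C6l T6 ![0, 1, 0, 2, 0, 3] h.inj
    (img_le (h.le (by decide))) sep (by decide)
  have hb := I.bd 6 (by decide)
  have hw := I.w3
  have hU := I.F.U_ne hG
  have hq : 5 ≤ q T6 (US W) ∧ (q T6 (US W) ≤ 5 → (US W).card = 1) :=
    (by decide +kernel : ∀ U : Finset (Fin 4), U.Nonempty → 5 ≤ q T6 U ∧ (q T6 U ≤ 5 → U.card = 1)) _ hU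
  rcases I.F.YG.lt_or_eq with hY | hY
  · have := hG.lemA hY (I.ne (by norm_num))
    have hc := hq.2 (by omega)
    rcases I.c3 hG (I.isC3 (by omega)) with hh | hh | hh
    · obtain ⟨i, hi, u, u', a, b, hu, hu', huu, ha, hb, l1, l2, l3⟩ := hh
      have l1 := I.LG l1
      have l2 := I.LG l2
      have l3 := I.LG l3
      have : u' = 2 + u ∨ u = 2 + u' := (by decide : ∀ u u' : Fin 6,
        ![(0 : Fin 4), 1, 0, 2, 0, 3] u = ![(0 : Fin 4), 1, 0, 2, 0, 3] u' → u ≠ u' →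
        u' = 2 + u ∨ u = 2 + u') u u' (hu.trans hu'.symm) huu
      rcases this with rfl | rfl
      · exact hG.noK8 (h.rot u) (fun _ => ha _) (fun _ => hb _) (by simpa using l1) l2 l3
      · exact hG.noK8 (h.rot u') (fun _ => hb _) (fun _ => ha _) (by simpa using l3.symm) l2.symm l1.symm
    · obtain ⟨i, j, hij, hU, _⟩ := hh
      rw [hU, Finset.card_pair hij] at hc
      omega
    · obtain ⟨i, j, m, hij, him, hjm, hU, _⟩ := hh
      rw [hU, Finset.card_eq_three.2 ⟨i, j, m, hij, him, hjm, rfl⟩] at hc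
      omega
  · have hpos := hG.pos
    rw [← hY] at hpos
    obtain ⟨w, hw1, hw2, hw3⟩ := ho
    have h1 : 1 ∈ US W := I.out hY (u := 1) hw1 (by
      intro j hj
      have : j = 0 ∨ j = 2 := by revert j; decide
      rcases this with rfl | rfl
      · exact hw3
      · exact hw2)
    obtain ⟨w, hw1, hw2, hw3⟩ := ho3
    have h2 : 2 ∈ US W := I.out hY (u := 3) hw1 (by
      intro j hj
      have : j = 2 ∨ j = 4 := by revert j; decide
      rcases this with rfl | rfl
      · exact hw3
      · exact hw2)
    have h3 := (by decide +kernel : ∀ U : Finset (Fin 4), 1 ∈ U → 2 ∈ U → 7 ≤ q T6 U ∧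
      (q T6 U ≤ 7 → U.card = 3)) _ h1 h2
    have hc := h3.2 (by omega)
    rcases I.c3 hG (I.isC3 (by omega)) with hh | hh | hh
    · obtain ⟨i, hU, _⟩ := hh
      rw [hU, Finset.card_singleton] at hc
      omega
    · obtain ⟨i, j, hij, hU, _⟩ := hh
      rw [hU, Finset.card_pair hij] at hc
      omega
    · obtain ⟨_, _, _, _, _, _, _, hall⟩ := hh
      rcases hall 1 h1 2 h2 (by decide) with hh | ⟨u, u', hu, hu', hL⟩
      · exact absurd hh (by decide)
      · have : u = 1 := by clear hL; revert u; decide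
        subst this
        have : u' = 3 := by clear hL; revert u'; decide
        subst this
        exact h.nadj2 hG 1 3 (by decide) (I.LG hL)

theorem Cex.noC6'' {G : SimpleGraph V} (hG : Cex G) {e : Fin 6 → V} (h : Cyc G e)
    (h1 : ¬ Out G e 1) (h2 : ¬ Out G e 2) : False := by
  classical
  obtain ⟨c, hc⟩ := hG.crit (del G {e 1, e 2}) (del_lt (h.adj 1) (by simp))
  have n1 : ∀ w, G.Adj (e 1) w → w = e 0 ∨ w = e 2 := nOut h1
  have n2 : ∀ w, G.Adj (e 2) w → w = e 1 ∨ w = e 3 := nOut h2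
  have d : ∀ i j, i ≠ j → e i ≠ e j := fun i j hij => h.inj.ne hij
  have c34 := hc (e 3) (e 4) ⟨h.adj 3, by simp [h.inj.eq_iff], by simp [h.inj.eq_iff]⟩
  have c45 := hc (e 4) (e 5) ⟨h.adj 4, by simp [h.inj.eq_iff], by simp [h.inj.eq_iff]⟩
  have c50 := hc (e 5) (e 0) ⟨h.adj 5, by simp [h.inj.eq_iff], by simp [h.inj.eq_iff]⟩
  apply hG.nc
  refine ⟨fun v => if v = e 1 then c (e 5) else if v = e 2 then c (e 4) else c v, ?_⟩
  have key : ∀ a b, G.Adj a b → (a = e 1 ∨ a = e 2) →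
      c5 (if a = e 1 then c (e 5) else if a = e 2 then c (e 4) else c a)
        (if b = e 1 then c (e 5) else if b = e 2 then c (e 4) else c b) := by
    rintro a b hab (rfl | rfl)
    · rcases n1 b hab with rfl | rfl
      · simpa [h.inj.eq_iff] using c50
      · simpa [h.inj.eq_iff] using c5_symm c45
    · rcases n2 b hab with rfl | rfl
      · simpa [h.inj.eq_iff] using c45
      · simpa [h.inj.eq_iff] using c5_symm c34
  intro a b hab
  by_cases ha : a = e 1 ∨ a = e 2
  · exact key a b hab ha
  by_cases hb : b = e 1 ∨ b = e 2
  · exact c5_symm (key b a hab.symm hb)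
  have := hc a b ⟨hab, by simpa using ha, by simpa using hb⟩
  push Not at ha hb
  simpa [ha, hb] using this

theorem Cex.noC6 {G : SimpleGraph V} (hG : Cex G) {e : Fin 6 → V} (h : Cyc G e) : False := by
  classical
  have hg : ∀ i, Out G e i ∨ Out G e (i + 1) ∨ Out G e (i + 1 + 1) :=
    fun i => h.gap hG i (by revert i; decide)
  have comb : ∀ b : Fin 6 → Bool, (∀ i, b i = true ∨ b (i + 1) = true ∨ b (i + 1 + 1) = true) →
      (∃ r, b (1 + r) = true ∧ b (3 + r) = true) ∨
      (∃ r, ¬ b (1 + r) = true ∧ ¬ b (2 + r) = true) := by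
    decide +kernel
  rcases comb (fun i => decide (Out G e i)) (by simpa using hg) with ⟨r, h1, h2⟩ | ⟨r, h1, h2⟩
  · simp only [decide_eq_true_eq] at h1 h2
    exact hG.noC6' (h.rot r) (out_rot.2 h1) (out_rot.2 h2)
  · simp only [decide_eq_true_eq] at h1 h2
    exact hG.noC6'' (h.rot r) (out_rot.not.2 h1) (out_rot.not.2 h2)

end C52

set_option linter.unusedSectionVars false
namespace C52
variable {V : Type} [Fintype V]

/-! ### Eight-cycles are induced -/

theorem ex_cast {n : ℕ} (e : Fin n → V) (y : V) (i : Fin n) : ex e y i.castSucc = e i := by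
  simp [ex]

theorem ex_last {n : ℕ} (e : Fin n → V) (y : V) : ex e y (Fin.last n) = y := by
  simp [ex]

theorem ex2_inj {n : ℕ} {e : Fin n → V} {a b : V} (he : e.Injective) (ha : ∀ m, e m ≠ a)
    (hb : ∀ m, e m ≠ b) (h2 : a ≠ b) : (ex (ex e a) b).Injective := by
  refine ex_inj (ex_inj he ha) ?_
  intro i
  unfold ex
  split_ifs
  · exact hb _
  · exact h2

theorem A4.isE {G : SimpleGraph V} {l : List (Fin 8 × Fin 8)} {e : Fin 8 → V} {i j : Fin 8} {s t : V}
    (hG : Cex G) (he : e.Injective) (hl : good l) (cov : ∀ i, ∃ j, ladj l i j)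
    (hle : ∀ p ∈ l, G.Adj (e p.1) (e p.2))
    (hA : A4 G (img l e) (e i) s t (e j))
    {m : List (Fin 10 × Fin 10)}
    (hm : m = (l.map fun p => (p.1.castSucc.castSucc, p.2.castSucc.castSucc)) ++
      [(i.castSucc.castSucc, 8), (8, 9), (9, j.castSucc.castSucc)])
    {El : List (Fin 10 × Fin 10)} (hEl : El = E1l ∨ El = E2l) (σ : Fin 10 → Fin 10)
    (hσ : σ.Bijective) (hd : ∀ a b, ladj El a b ↔ ladj m (σ a) (σ b)) : False := by
  have hes : ∀ k, e k ≠ s := by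
    rintro k rfl
    exact hA.hs (img_mem_supp he hl cov k)
  have het : ∀ k, e k ≠ t := by
    rintro k rfl
    exact hA.ht (img_mem_supp he hl cov k)
  set f := ex (ex e s) t with hf
  have hfi : f.Injective := ex2_inj he hes het hA.st.ne
  have fc : ∀ k : Fin 8, f k.castSucc.castSucc = e k := by
    intro k; rw [hf, ex_cast, ex_cast]
  have f8 : f 8 = s := rfl
  have f9 : f 9 = t := rfl
  have hmG : ∀ p ∈ m, G.Adj (f p.1) (f p.2) := by
    intro p hp
    rw [hm, List.mem_append] at hp
    rcases hp with hp | hp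
    · obtain ⟨p', hp', rfl⟩ := List.mem_map.1 hp
      simp only [fc]
      exact hle p' hp'
    · simp only [List.mem_cons, List.not_mem_nil, or_false] at hp
      rcases hp with rfl | rfl | rfl
      · simp only [fc, f8]; exact hA.xs
      · simp only [f8, f9]; exact hA.st
      · simp only [fc, f9]; exact hA.ty
  apply hG.nE
  refine ⟨El, hEl, f ∘ σ, hfi.comp hσ.1, ?_⟩
  have key : ∀ a b, ladj m a b → (img El (f ∘ σ)).Adj (f a) (f b) := by
    intro a b hab
    obtain ⟨a', rfl⟩ := hσ.2 a
    obtain ⟨b', rfl⟩ := hσ.2 b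
    rw [img_adj]
    refine ⟨?_, a', b', (hd a' b').2 hab, rfl, rfl⟩
    rcases hab with h | h
    · exact (hmG _ h).ne
    · exact (hmG _ h).ne'
  have kx : (img El (f ∘ σ)).Adj (e i) s := by
    rw [← fc, ← f8]; apply key; left; simp [hm]
  have ks : (img El (f ∘ σ)).Adj s t := by
    rw [← f9, ← f8]; apply key; left; simp [hm]
  have kt : (img El (f ∘ σ)).Adj t (e j) := by
    rw [← fc, ← f9]; apply key; left; simp [hm]
  apply le_antisymm
  · intro a b hab
    rcases hA.adj a b hab with h | h | h | h | h | h | h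
    · obtain ⟨_, a', b', hab', rfl, rfl⟩ := img_adj.1 h
      rw [← fc, ← fc]
      apply key
      rw [hm]
      rcases hab' with h | h
      · left; exact List.mem_append_left _ (List.mem_map.2 ⟨_, h, rfl⟩)
      · right; exact List.mem_append_left _ (List.mem_map.2 ⟨_, h, rfl⟩)
    · obtain ⟨rfl, rfl⟩ := h; exact kx
    · obtain ⟨rfl, rfl⟩ := h; exact kx.symm
    · obtain ⟨rfl, rfl⟩ := h; exact ks
    · obtain ⟨rfl, rfl⟩ := h; exact ks.symm
    · obtain ⟨rfl, rfl⟩ := h; exact kt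
    · obtain ⟨rfl, rfl⟩ := h; exact kt.symm
  · apply img_le
    intro p hp
    rcases (hd p.1 p.2).1 (Or.inl hp) with h | h
    · exact hmG _ h
    · exact (hmG _ h).symm

theorem A4.symm {G H : SimpleGraph V} {x s t y : V} (h : A4 G H x s t y) : A4 G H y t s x := by
  refine ⟨h.ht, h.hs, h.hy, h.hx, h.hxy.symm, ?_, h.ty.symm, h.st.symm, h.xs.symm, ?_, ?_⟩
  · intro v; have := h.cov v; tauto
  · intro a b hab; have := h.adj a b hab; tauto
  · intro c hc; exact (h.col c hc).symm

def C8l : List (Fin 8 × Fin 8) := [(0,1), (1,2), (2,3), (3,4), (4,5), (5,6), (6,7), (7,0)]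
def Ch8l : List (Fin 8 × Fin 8) := [(0,1), (1,2), (2,3), (3,4), (4,5), (5,6), (6,7), (7,0), (0,4)]

theorem Cex.noChord0 {G : SimpleGraph V} (hG : Cex G) {e : Fin 8 → V} (h : Cyc G e) :
    ¬ G.Adj (e 0) (e 4) := by
  intro h04
  have hle : ∀ p ∈ Ch8l, G.Adj (e p.1) (e p.2) := by
    simp only [Ch8l, List.forall_mem_cons, List.not_mem_nil, false_imp_iff, implies_true, and_true]
    exact ⟨h.adj 0, h.adj 1, h.adj 2, h.adj 3, h.adj 4, h.adj 5, h.adj 6, h.adj 7, h04⟩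
  obtain ⟨i, j, s, t, hij, hA, hc⟩ := hG.img4 (l := Ch8l) h.inj (by decide) hle
    (by decide) (by decide) ⟨![0, 1, 2, 3, 4, 3, 2, 1], by decide⟩
  have k1 := hc ![0, 1, 2, 3, 4, 3, 2, 1] (by decide)
  have key : ∀ i j : Fin 8, (i = 1 ∧ j = 7) ∨ (i = 3 ∧ j = 5) ∨ (i = 2 ∧ j = 6) →
      ∀ s t, A4 G (img Ch8l e) (e i) s t (e j) → False := by
    rintro i j (⟨rfl, rfl⟩ | ⟨rfl, rfl⟩ | ⟨rfl, rfl⟩) s t hA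
    · exact A4.isE hG h.inj (by decide) (by decide) hle hA rfl (Or.inl rfl)
        ![1, 2, 3, 4, 5, 6, 7, 9, 8, 0] (by decide) (by decide)
    · exact A4.isE hG h.inj (by decide) (by decide) hle hA rfl (Or.inl rfl)
        ![3, 2, 1, 0, 7, 6, 5, 9, 8, 4] (by decide) (by decide)
    · exact A4.isE hG h.inj (by decide) (by decide) hle hA rfl (Or.inr rfl)
        ![0, 4, 3, 2, 1, 5, 6, 7, 8, 9] (by decide) (by decide)
  have hcase := (by decide : ∀ i j : Fin 8, i ≠ j →
    ![(0 : Fin 5), 1, 2, 3, 4, 3, 2, 1] i = ![(0 : Fin 5), 1, 2, 3, 4, 3, 2, 1] j →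
    ((i = 1 ∧ j = 7) ∨ (i = 3 ∧ j = 5) ∨ (i = 2 ∧ j = 6)) ∨
    ((j = 1 ∧ i = 7) ∨ (j = 3 ∧ i = 5) ∨ (j = 2 ∧ i = 6))) i j hij k1
  rcases hcase with hh | hh
  · exact key i j hh s t hA
  · exact key j i hh t s hA.symm

theorem Cex.ind8 {G : SimpleGraph V} (hG : Cex G) {e : Fin 8 → V} (h : Cyc G e) {i j : Fin 8}
    (hij : G.Adj (e i) (e j)) : j = i + 1 ∨ i = j + 1 := by
  have h3 : ∀ i, ¬ G.Adj (e i) (e (i + 1 + 1 + 1)) := by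
    intro i hh
    exact hG.c4 (h.adj i) (h.adj (i + 1)) (h.adj (i + 1 + 1)) hh.symm
      (h.inj.ne ((by decide : ∀ i : Fin 8, i ≠ i + 1 + 1) i))
      (h.inj.ne ((by decide : ∀ i : Fin 8, i ≠ i + 1 + 1) (i + 1)))
  have h4 : ∀ i, ¬ G.Adj (e i) (e (4 + i)) := by
    intro i hh
    apply hG.noChord0 (h.rot i)
    simpa using hh
  have hc := (by decide : ∀ i j : Fin 8, i = j ∨ (j = i + 1 + 1 ∨ i = j + 1 + 1) ∨ j = i + 1 + 1 + 1 ∨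
    i = j + 1 + 1 + 1 ∨ j = 4 + i ∨ (j = i + 1 ∨ i = j + 1)) i j
  rcases hc with rfl | hc | rfl | rfl | rfl | hc
  · exact absurd rfl hij.ne
  · exact absurd hij (h.nadj2 hG i j hc)
  · exact absurd hij (h3 _)
  · exact absurd hij.symm (h3 _)
  · exact absurd hij (h4 _)
  · exact hc

end C52

set_option linter.unusedSectionVars false
namespace C52
variable {V : Type} [Fintype V]

/-! ### A reduction at a vertex of an eight-cycle which ends a 3-path -/

theorem E_mindeg : ∀ l, (l = E1l ∨ l = E2l) → ∀ a b : Fin 10, ladj l a b → ∃ c, c ≠ b ∧ ladj l a c := by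
  rintro l (rfl | rfl) <;> decide +kernel

theorem E_no6 : ∀ l, (l = E1l ∨ l = E2l) → ∀ a b : Fin 10, ladj l a b → ∀ c, ladj l b c → c ≠ a →
    ∀ d, ladj l c d → d ≠ b → d ≠ a → ∀ x, ladj l d x → x ≠ c → x ≠ b → x ≠ a → ∀ y, ladj l x y →
    y ≠ d → y ≠ c → y ≠ b → y ≠ a → ¬ ladj l y a := by
  rintro l (rfl | rfl) <;> decide +kernel

theorem ncard_pair_le' {α : Type} (a b : α) : ({a, b} : Set α).ncard ≤ 2 := by
  refine (Set.ncard_insert_le _ _).trans ?_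
  rw [Set.ncard_singleton]

def P4l : List (Fin 8 × Fin 8) := [(3,4), (4,5), (5,6), (6,7)]

theorem c5_two : ∀ a b y : Fin 5, ¬ c5 a b → ∃ p r s, c5 a p ∧ c5 p r ∧ c5 r s ∧ c5 s b ∧ r ≠ y := by
  decide
theorem c5_tri : ∀ a b c : Fin 5, c5 a b → c5 a c → c5 c b → False := by decide

/-- `r3` with an added vertex `p` adjacent to `a`, `b` -/
def addV (R : SimpleGraph V) (a p b : V) : SimpleGraph V := R ⊔ (edge a p ⊔ edge p b)

theorem addV_adj {R : SimpleGraph V} {a p b u v : V} (h : (addV R a p b).Adj u v) :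
    R.Adj u v ∨ (u = a ∧ v = p) ∨ (u = p ∧ v = a) ∨ (u = p ∧ v = b) ∨ (u = b ∧ v = p) := by
  unfold addV at h
  simp only [sup_adj, edge_adj] at h
  tauto

theorem Cex.lemD_R {G : SimpleGraph V} (hG : Cex G) {e : Fin 8 → V} (h : Cyc G e)
    (n4 : ¬ Out G e 4) (n6 : ¬ Out G e 6) {s t y : V}
    (n5 : ∀ w, G.Adj (e 5) w → w = e 4 ∨ w = e 6 ∨ w = s)
    (ns : ∀ w, G.Adj s w → w = e 5 ∨ w = t) (nt : ∀ w, G.Adj t w → w = s ∨ w = y)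
    (hes : ∀ i, e i ≠ s) (het : ∀ i, e i ≠ t) (st : s ≠ t) (hys : y ≠ s) (hyt : y ≠ t)
    (hy4 : y ≠ e 4) (hy5 : y ≠ e 5) (hy6 : y ≠ e 6)
    (c : V → Fin 5) (hc : IsCol (del G {e 4, e 5, e 6, s, t}) c) : c5 (c (e 3)) (c (e 7)) := by
  classical
  by_contra hn
  obtain ⟨p, r, q, h1, h2, h3, h4, hr⟩ := c5_two _ _ (c y) hn
  obtain ⟨a, b, g1, g2, g3⟩ := walk3 r (c y) hr
  have n4 : ∀ w, G.Adj (e 4) w → w = e 3 ∨ w = e 5 := nOut n4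
  have n6 : ∀ w, G.Adj (e 6) w → w = e 5 ∨ w = e 7 := nOut n6
  apply hG.nc
  set d : V → Fin 5 := fun v => if v = e 4 then p else if v = e 5 then r else if v = e 6 then q else
    if v = s then a else if v = t then b else c v with hd
  have d4 : d (e 4) = p := by simp [hd]
  have d5 : d (e 5) = r := by simp [hd, h.inj.eq_iff]
  have d6 : d (e 6) = q := by simp [hd, h.inj.eq_iff]
  have ds : d s = a := by simp [hd, (hes _).symm]
  have dt : d t = b := by simp [hd, (het _).symm, st.symm]
  have dy : d y = c y := by simp [hd, hys, hyt, hy4, hy5, hy6]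
  have d3 : d (e 3) = c (e 3) := by simp [hd, h.inj.eq_iff, hes, het]
  have d7 : d (e 7) = c (e 7) := by simp [hd, h.inj.eq_iff, hes, het]
  refine ⟨d, ?_⟩
  have key : ∀ u v, G.Adj u v → u ∈ ({e 4, e 5, e 6, s, t} : Set V) → c5 (d u) (d v) := by
    rintro u v huv (rfl | rfl | rfl | rfl | rfl)
    · rcases n4 v huv with rfl | rfl
      · rw [d4, d3]; exact c5_symm h1
      · rw [d4, d5]; exact h2
    · rcases n5 v huv with rfl | rfl | rfl
      · rw [d4, d5]; exact c5_symm h2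
      · rw [d5, d6]; exact h3
      · rw [d5, ds]; exact g1
    · rcases n6 v huv with rfl | rfl
      · rw [d6, d5]; exact c5_symm h3
      · rw [d6, d7]; exact h4
    · rcases ns v huv with rfl | rfl
      · rw [ds, d5]; exact c5_symm g1
      · rw [ds, dt]; exact g2
    · rcases nt v huv with rfl | rfl
      · rw [dt, ds]; exact c5_symm g2
      · rw [dt, dy]; exact g3
  intro u v huv
  by_cases hu : u ∈ ({e 4, e 5, e 6, s, t} : Set V)
  · exact key u v huv hu
  by_cases hv : v ∈ ({e 4, e 5, e 6, s, t} : Set V)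
  · exact c5_symm (key v u huv.symm hv)
  have := hc u v ⟨huv, hu, hv⟩
  simp only [Set.mem_insert_iff, Set.mem_singleton_iff, not_or] at hu hv
  simpa [hd, hu, hv] using this

theorem Cex.lemD {G : SimpleGraph V} (hG : Cex G) {e : Fin 8 → V} (h : Cyc G e)
    (n4 : ¬ Out G e 4) (n6 : ¬ Out G e 6) {Y : SimpleGraph V} {s t y : V}
    (hY : ∀ i, Y.Adj (e i) (e (i + 1))) (hA : A4 G Y (e 5) s t y)
    (hY5 : ∀ w, Y.Adj (e 5) w → w = e 4 ∨ w = e 6) : False := by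
  classical
  have hms : ∀ i, e i ∈ Y.support := fun i => ⟨_, hY i⟩
  have hes : ∀ i, e i ≠ s := by
    intro i hi; exact hA.hs (hi ▸ hms i)
  have het : ∀ i, e i ≠ t := by
    intro i hi; exact hA.ht (hi ▸ hms i)
  have m4 : ∀ w, G.Adj (e 4) w → w = e 3 ∨ w = e 5 := nOut n4
  have m6 : ∀ w, G.Adj (e 6) w → w = e 5 ∨ w = e 7 := nOut n6
  have hys : y ≠ s := by intro hh; exact hA.hs (hh ▸ hA.hy)
  have hyt : y ≠ t := by intro hh; exact hA.ht (hh ▸ hA.hy)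
  have st := hA.st.ne
  have hy4 : y ≠ e 4 := by
    rintro rfl
    rcases m4 _ hA.ty.symm with hh | hh
    · exact het _ hh.symm
    · exact het _ hh.symm
  have hy6 : y ≠ e 6 := by
    rintro rfl
    rcases m6 _ hA.ty.symm with hh | hh
    · exact het _ hh.symm
    · exact het _ hh.symm
  have hy5 : y ≠ e 5 := hA.hxy.symm
  have n5 : ∀ w, G.Adj (e 5) w → w = e 4 ∨ w = e 6 ∨ w = s := by
    intro w hw
    rcases hA.adj _ _ hw with k | k | k | k | k | k | k
    · have := hY5 w k; tauto
    · tauto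
    · exact absurd k.1 (hes _)
    · exact absurd k.1 (hes _)
    · exact absurd k.1 (het _)
    · exact absurd k.1 (het _)
    · exact absurd k.1.symm hy5
  have ns : ∀ w, G.Adj s w → w = e 5 ∨ w = t := by
    intro w hw
    rcases hA.adj _ _ hw with k | k | k | k | k | k | k
    · exact absurd ⟨_, k⟩ hA.hs
    · exact absurd k.1.symm (hes _)
    · tauto
    · tauto
    · exact absurd k.1 st
    · exact absurd k.1 st
    · exact absurd k.1.symm hys
  have nt : ∀ w, G.Adj t w → w = s ∨ w = y := by
    intro w hw
    rcases hA.adj _ _ hw with k | k | k | k | k | k | k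
    · exact absurd ⟨_, k⟩ hA.ht
    · exact absurd k.1.symm (het _)
    · exact absurd k.1.symm st
    · exact absurd k.1.symm st
    · tauto
    · tauto
    · exact absurd k.1.symm hyt
  have hR := hG.lemD_R h n4 n6 n5 ns nt hes het st hys hyt hy4 hy5 hy6
  set R := del G {e 4, e 5, e 6, s, t} with hRd
  have hR4 : ∀ w, ¬ R.Adj (e 4) w := by intro w hw; exact hw.2.1 (by simp)
  have hRG : R < G := del_lt (h.adj 4) (by simp)
  have nc : ¬ Col (addV R (e 3) (e 4) (e 7)) := by
    rintro ⟨c, hc⟩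
    have hc' : IsCol R c := hc.mono le_sup_left
    have k := hR c hc'
    have k1 := hc (e 3) (e 4) (by simp [addV, edge_adj, h.inj.eq_iff])
    have k2 := hc (e 4) (e 7) (by simp [addV, edge_adj, h.inj.eq_iff])
    exact c5_tri _ _ _ k k1 k2
  obtain ⟨W, hWle, hW⟩ := exists_minNC _ nc
  have Wadj : ∀ u v, W.Adj u v → R.Adj u v ∨ (u = e 3 ∧ v = e 4) ∨ (u = e 4 ∧ v = e 3) ∨
      (u = e 4 ∧ v = e 7) ∨ (u = e 7 ∧ v = e 4) := fun u v huv => addV_adj (hWle huv)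
  have W4 : ∀ w, W.Adj (e 4) w → w = e 3 ∨ w = e 7 := by
    intro w hw
    rcases Wadj _ _ hw with k | k | k | k | k
    · exact absurd k (hR4 _)
    · exact absurd (h.inj k.1) (by decide)
    · tauto
    · tauto
    · exact absurd (h.inj k.1) (by decide)
  set H := del W {e 4} with hH
  have HR : H ≤ R := by
    rintro u v ⟨k, h1, h2⟩
    simp only [Set.mem_singleton_iff] at h1 h2
    rcases Wadj _ _ k with k | k | k | k | k
    · exact k
    all_goals tauto
  have HG : H < G := lt_of_le_of_lt HR hRG
  have h4W : e 4 ∈ W.support := by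
    by_contra hn
    apply hW.1
    have : W ≤ H := by
      intro u v huv
      refine ⟨huv, ?_, ?_⟩
      · rintro rfl; exact hn ⟨_, huv⟩
      · rintro rfl; exact hn ⟨_, huv.symm⟩
    exact (hG.crit H HG).mono this
  have hneH : ∃ a b, H.Adj a b := by
    by_contra! hn
    apply hW.1
    refine ⟨fun v => if v = e 4 then 0 else 1, ?_⟩
    intro u v huv
    by_cases hu : u = e 4 <;> by_cases hv : v = e 4
    · exact absurd (hu.trans hv.symm) huv.ne
    · simp [hu, hv, c5]
    · simp [hu, hv, c5]
    · exact absurd ⟨huv, hu, hv⟩ (hn u v)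
  have HS : ∀ v ∈ H.support, v ≠ e 4 ∧ v ≠ e 5 ∧ v ≠ e 6 ∧ v ≠ s ∧ v ≠ t := by
    rintro v ⟨w, hw⟩
    have := (HR hw).2.1
    simpa using this
  have hpp : pp H ≤ pp W + 3 := by
    have k1 : H.support.ncard + 1 ≤ W.support.ncard := by
      rw [← Set.ncard_insert_of_notMem (fun k => (HS (e 4) k).1 rfl) (Set.toFinite _)]
      apply Set.ncard_le_ncard _ (Set.toFinite _)
      apply Set.insert_subset h4W
      exact support_mono' (del_le _ _)
    have k2 : W.edgeSet.ncard ≤ H.edgeSet.ncard + 2 := by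
      have : W.edgeSet ⊆ H.edgeSet ∪ {s(e 3, e 4), s(e 4, e 7)} := by
        intro z hz
        induction z with
        | h u v =>
          by_cases hu : u = e 4
          · subst hu
            rcases W4 v hz with rfl | rfl
            · right; left; exact Sym2.eq_swap
            · right; right; rfl
          by_cases hv : v = e 4
          · subst hv
            rcases W4 u (SimpleGraph.Adj.symm hz) with rfl | rfl
            · right; left; rfl
            · right; right; exact Sym2.eq_swap
          exact Or.inl ⟨hz, hu, hv⟩
      refine (Set.ncard_le_ncard this (Set.toFinite _)).trans ((Set.ncard_union_le _ _).trans ?_)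
      have := ncard_pair_le' s(e 3, e 4) s(e 4, e 7)
      omega
    unfold pp
    omega
  have hp5 : 5 ≤ pp H := by
    by_contra hlt
    obtain ⟨_, x', s', t', y', hA'⟩ := hG.lemA' HG hneH (by omega)
    have c4 := hA'.cov (e 4)
    have c5 := hA'.cov (e 5)
    have c6 := hA'.cov (e 6)
    have q4 : e 4 ∉ H.support := fun k => (HS _ k).1 rfl
    have q5 : e 5 ∉ H.support := fun k => (HS _ k).2.1 rfl
    have q6 : e 6 ∉ H.support := fun k => (HS _ k).2.2.1 rfl
    have d1 : e 4 ≠ e 5 := h.inj.ne (by decide)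
    have d2 : e 4 ≠ e 6 := h.inj.ne (by decide)
    have d3 : e 5 ≠ e 6 := h.inj.ne (by decide)
    grind
  have hsm : W.support.ncard < Fintype.card V := by
    rw [← Nat.card_eq_fintype_card, ← Set.ncard_univ]
    apply Set.ncard_lt_ncard _ (Set.toFinite _)
    refine ⟨Set.subset_univ _, fun hh => ?_⟩
    obtain ⟨w, hw⟩ := hh (Set.mem_univ (e 5))
    rcases Wadj _ _ hw with k | k | k | k | k
    · exact k.2.1 (by simp)
    all_goals exact absurd (h.inj k.1) (by decide)
  rcases hG.small V W hW hsm with hw | hw | hw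
  · omega
  · obtain ⟨f, hf, hWf⟩ := hw
    obtain ⟨w, hw⟩ := h4W
    rw [hWf] at hw
    obtain ⟨_, i, j, hij, hi, hj⟩ := img_adj.1 hw
    obtain ⟨m, him, hjm, hm⟩ := (by decide : ∀ i j : Fin 3, ladj C3l i j →
      ∃ m, ladj C3l i m ∧ ladj C3l j m ∧ j ≠ m) i j hij
    have a1 : W.Adj (e 4) (f j) := by rw [hWf, ← hi]; exact (img_adj' hf C3_good).2 hij
    have a2 : W.Adj (e 4) (f m) := by rw [hWf, ← hi]; exact (img_adj' hf C3_good).2 him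
    have a3 : W.Adj (f j) (f m) := by rw [hWf]; exact (img_adj' hf C3_good).2 hjm
    have key : W.Adj (e 3) (e 7) := by
      rcases W4 _ a1 with k | k <;> rcases W4 _ a2 with k' | k'
      · exact absurd (hf (k.trans k'.symm)) hm
      · rw [← k, ← k']; exact a3
      · rw [← k, ← k']; exact a3.symm
      · exact absurd (hf (k.trans k'.symm)) hm
    rcases Wadj _ _ key with k | k | k | k | k
    · exact absurd (hG.ind8 h k.1) (by decide)
    · exact absurd (h.inj k.2) (by decide)
    · exact absurd (h.inj k.2) (by decide)
    · exact absurd (h.inj k.1) (by decide)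
    · exact absurd (h.inj k.2) (by decide)
  · have hp2 := pp_E hw
    obtain ⟨l, hl, f, hf, hWf⟩ := hw
    have hgl : good l := by rcases hl with rfl | rfl; exacts [E1_good, E2_good]
    have lad : ∀ i j, W.Adj (f i) (f j) ↔ ladj l i j := by
      intro i j; rw [hWf]; exact img_adj' hf hgl
    have fs : ∀ v ∈ W.support, ∃ i, f i = v := by
      intro v hv; rw [hWf] at hv; exact img_supp hv
    have md : ∀ u v, W.Adj u v → ∃ w, w ≠ v ∧ W.Adj u w := by
      intro u v huv
      obtain ⟨i, rfl⟩ := fs u ⟨_, huv⟩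
      obtain ⟨j, rfl⟩ := fs v ⟨_, huv.symm⟩
      obtain ⟨c, h1, h2⟩ := E_mindeg l hl i j ((lad _ _).1 huv)
      exact ⟨f c, hf.ne h1, (lad _ _).2 h2⟩
    have a43 : W.Adj (e 4) (e 3) ∧ W.Adj (e 4) (e 7) := by
      obtain ⟨w, hw⟩ := h4W
      obtain ⟨w', h1, h2⟩ := md _ _ hw
      rcases W4 _ hw with rfl | rfl <;> rcases W4 _ h2 with rfl | rfl
      · exact absurd rfl h1
      · exact ⟨hw, h2⟩
      · exact ⟨h2, hw⟩
      · exact absurd rfl h1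
    have s37 : ∀ v, v ≠ e 4 → W.Adj (e 4) v → v ∈ H.support := by
      intro v hv hh
      obtain ⟨w, h1, h2⟩ := md _ _ hh.symm
      exact ⟨w, h2, hv, h1⟩
    have s3 := s37 _ (h.inj.ne (by decide)) a43.1
    have s7 := s37 _ (h.inj.ne (by decide)) a43.2
    set K := H ⊔ img P4l e with hK
    have hPle : img P4l e ≤ G := img_le (h.le (by decide))
    have hKG : K ≤ G := sup_le HG.le hPle
    have Ksup : ∀ v ∈ K.support, v ≠ s ∧ v ≠ t := by
      rintro v ⟨w, hw | hw⟩
      · exact (HS v ⟨_, hw⟩).2.2.2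
      · obtain ⟨i, rfl⟩ := img_supp ⟨_, hw⟩
        exact ⟨hes i, het i⟩
    have hKlt : K < G := by
      refine lt_of_le_of_ne hKG fun hh => ?_
      have : s ∈ K.support := by rw [hh]; exact hG.supp s
      exact (Ksup s this).1 rfl
    have hKpp : pp K ≤ 4 := by
      have := pp_sup (A := H) (B := img P4l e) {e 4, e 5, e 6} 3 ?_ ?_ ?_
      · rw [img_edges h.inj (by decide)] at this
        have h4 : P4l.length = 4 := rfl
        rw [h4, ← hK] at this
        push_cast at this
        omega
      · refine (Set.ncard_insert_le _ _).trans ?_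
        have := ncard_pair_le' (e 5) (e 6)
        omega
      · rintro v ⟨w, hw⟩
        obtain ⟨_, i, j, hij, rfl, _⟩ := img_adj.1 hw
        rcases (by decide : ∀ i j : Fin 8, ladj P4l i j → i = 3 ∨ i = 7 ∨ i = 4 ∨ i = 5 ∨ i = 6) i j hij
          with rfl | rfl | rfl | rfl | rfl
        · exact Or.inl s3
        · exact Or.inl s7
        all_goals right; simp
      · intro a b hab hab'
        obtain ⟨_, i, j, hij, rfl, rfl⟩ := img_adj.1 hab'
        have h1 := HS _ ⟨_, hab⟩
        have h2 := HS _ ⟨_, hab.symm⟩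
        rcases (by decide : ∀ i j : Fin 8, ladj P4l i j →
          (i = 4 ∨ i = 5 ∨ i = 6) ∨ (j = 4 ∨ j = 5 ∨ j = 6)) i j hij
          with (rfl | rfl | rfl) | (rfl | rfl | rfl)
        · exact h1.1 rfl
        · exact h1.2.1 rfl
        · exact h1.2.2.1 rfl
        · exact h2.1 rfl
        · exact h2.2.1 rfl
        · exact h2.2.2.1 rfl
    have hneK : ∃ a b, K.Adj a b := by
      obtain ⟨a, b, hab⟩ := hneH
      exact ⟨a, b, Or.inl hab⟩
    obtain ⟨_, x', s', t', y', hA'⟩ := hG.lemA' hKlt hneK hKpp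
    have hst : ∀ v, v = s' ∨ v = t' → v = s ∨ v = t := by
      have k1 := hA'.cov s
      have k2 := hA'.cov t
      have k3 := Ksup s
      have k4 := Ksup t
      grind
    have hK8 : ∀ i, K.Adj (e i) (e (i + 1)) := by
      intro i
      have nes : e i ≠ s' := fun hh => by
        rcases hst _ (Or.inl hh) with k | k
        · exact hes _ k
        · exact het _ k
      have net : e i ≠ t' := fun hh => by
        rcases hst _ (Or.inr hh) with k | k
        · exact hes _ k
        · exact het _ k
      have nes' : e (i + 1) ≠ s' := fun hh => by
        rcases hst _ (Or.inl hh) with k | k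
        · exact hes _ k
        · exact het _ k
      have net' : e (i + 1) ≠ t' := fun hh => by
        rcases hst _ (Or.inr hh) with k | k
        · exact hes _ k
        · exact het _ k
      rcases hA'.adj _ _ (h.adj i) with k | k | k | k | k | k | k
      · exact k
      all_goals tauto
    have hW8 : ∀ i : Fin 8, (i = 7 ∨ i = 0 ∨ i = 1 ∨ i = 2) → W.Adj (e i) (e (i + 1)) := by
      intro i hi
      rcases hK8 i with k | k
      · exact k.1
      · have := (img_adj' h.inj (by decide)).1 k
        exact absurd this ((by decide : ∀ i : Fin 8, (i = 7 ∨ i = 0 ∨ i = 1 ∨ i = 2) →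
          ¬ ladj P4l i (i + 1)) i hi)
    have w7 : W.Adj (e 7) (e 0) := hW8 7 (by decide)
    have w0 : W.Adj (e 0) (e 1) := hW8 0 (by decide)
    have w1 : W.Adj (e 1) (e 2) := hW8 1 (by decide)
    have w2 : W.Adj (e 2) (e 3) := hW8 2 (by decide)
    obtain ⟨i4, h4⟩ := fs _ h4W
    obtain ⟨i7, h7⟩ := fs _ ⟨_, w7⟩
    obtain ⟨i0, h0⟩ := fs _ ⟨_, w0⟩
    obtain ⟨i1, h1⟩ := fs _ ⟨_, w1⟩
    obtain ⟨i2, h2⟩ := fs _ ⟨_, w2⟩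
    obtain ⟨i3, h3⟩ := fs _ ⟨_, w2.symm⟩
    have ne : ∀ {i j : Fin 8} {a b : Fin 10}, f a = e i → f b = e j → i ≠ j → a ≠ b := by
      rintro i j a b ha hb hij rfl
      exact hij (h.inj (ha.symm.trans hb))
    have ad : ∀ {i j : Fin 8} {a b : Fin 10}, f a = e i → f b = e j → W.Adj (e i) (e j) → ladj l a b := by
      intro i j a b ha hb hij
      rw [← lad, ha, hb]; exact hij
    exact E_no6 l hl i4 i7 (ad h4 h7 a43.2) i0 (ad h7 h0 w7) (ne h0 h4 (by decide))
      i1 (ad h0 h1 w0) (ne h1 h7 (by decide)) (ne h1 h4 (by decide))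
      i2 (ad h1 h2 w1) (ne h2 h0 (by decide)) (ne h2 h7 (by decide)) (ne h2 h4 (by decide))
      i3 (ad h2 h3 w2) (ne h3 h1 (by decide)) (ne h3 h0 (by decide)) (ne h3 h7 (by decide))
      (ne h3 h4 (by decide)) (ad h3 h4 a43.1.symm)

end C52

set_option linter.unusedSectionVars false
namespace C52
variable {V : Type} [Fintype V]

/-! ### Colourings of `E1` and `E2` with a vertex split -/

def E1t : List (Fin 10 → Fin 5) := [
  ![0, 2, 3, 4, 0, 1, 2, 1, 0, 3],
  ![0, 0, 1, 2, 1, 0, 4, 3, 2, 3],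
  ![0, 0, 4, 3, 4, 0, 1, 2, 3, 2],
  ![2, 0, 3, 2, 1, 0, 4, 0, 1, 3],
  ![3, 0, 2, 3, 2, 1, 0, 1, 2, 4],
  ![3, 2, 0, 3, 2, 1, 0, 1, 2, 4],
  ![2, 3, 0, 2, 1, 0, 4, 0, 1, 3],
  ![4, 3, 2, 0, 0, 1, 2, 1, 0, 3],
  ![1, 2, 3, 0, 2, 3, 4, 3, 2, 0],
  ![1, 2, 3, 0, 0, 4, 3, 4, 0, 2],
  ![0, 4, 3, 2, 0, 3, 2, 3, 4, 1],
  ![0, 1, 2, 3, 0, 2, 3, 2, 1, 4],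
  ![0, 1, 2, 3, 2, 0, 3, 2, 1, 4],
  ![0, 4, 3, 2, 3, 0, 2, 3, 4, 1],
  ![1, 2, 3, 4, 3, 2, 0, 3, 2, 0],
  ![4, 0, 1, 2, 1, 0, 0, 2, 3, 3],
  ![1, 0, 4, 3, 2, 3, 0, 3, 2, 2],
  ![2, 1, 0, 4, 0, 1, 2, 0, 3, 3],
  ![3, 2, 1, 0, 1, 2, 3, 0, 2, 4],
  ![2, 1, 0, 4, 0, 1, 2, 3, 0, 3],
  ![3, 2, 1, 0, 1, 2, 3, 2, 0, 4],
  ![2, 1, 2, 3, 2, 1, 0, 4, 3, 0],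
  ![0, 4, 3, 2, 1, 2, 3, 2, 1, 0],
  ![0, 1, 2, 3, 2, 1, 2, 3, 4, 0]]

def E2t : List (Fin 10 → Fin 5) := [
  ![0, 2, 1, 2, 3, 3, 4, 0, 1, 0],
  ![0, 0, 4, 3, 2, 1, 2, 3, 2, 1],
  ![0, 0, 1, 2, 3, 4, 3, 2, 1, 2],
  ![2, 0, 0, 4, 3, 3, 2, 1, 0, 1],
  ![0, 0, 2, 3, 4, 3, 2, 1, 2, 1],
  ![0, 0, 3, 2, 1, 2, 3, 4, 1, 2],
  ![1, 2, 0, 3, 2, 3, 4, 0, 2, 3],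
  ![2, 3, 0, 2, 1, 4, 0, 1, 3, 4],
  ![2, 3, 2, 0, 3, 4, 0, 1, 0, 1],
  ![3, 2, 3, 0, 2, 1, 0, 4, 0, 1],
  ![1, 2, 3, 0, 0, 3, 4, 0, 2, 3],
  ![2, 1, 2, 3, 0, 0, 4, 3, 2, 3],
  ![3, 2, 1, 2, 0, 1, 0, 4, 3, 4],
  ![1, 2, 3, 4, 0, 0, 3, 2, 0, 4],
  ![2, 3, 4, 0, 1, 0, 2, 1, 4, 3],
  ![2, 3, 4, 0, 1, 2, 0, 3, 1, 0],
  ![3, 2, 1, 0, 4, 3, 0, 2, 1, 0],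
  ![1, 2, 3, 4, 0, 3, 0, 0, 3, 2],
  ![2, 1, 0, 4, 3, 2, 3, 0, 0, 4],
  ![3, 2, 1, 0, 4, 1, 2, 0, 4, 3],
  ![0, 4, 3, 2, 1, 3, 2, 1, 0, 3],
  ![0, 1, 2, 3, 4, 2, 3, 4, 0, 2],
  ![0, 4, 3, 2, 1, 3, 2, 1, 3, 0],
  ![0, 1, 2, 3, 4, 2, 3, 4, 2, 0]]

def spl (l : List (Fin 10 × Fin 10)) (z w : Fin 10) (f : Fin 10 → Fin 5) : Prop :=
  (∀ p ∈ l, p.1 ≠ z → p.2 ≠ z → c5 (f p.1) (f p.2)) ∧ c5 (f w) 1 ∧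
    ∀ w', ladj l z w' → w' ≠ w → c5 (f w') 4

instance (l z w f) : Decidable (spl l z w f) := by unfold spl; infer_instance

theorem E_spl : ∀ l, (l = E1l ∨ l = E2l) → ∀ z w : Fin 10, ladj l z w → ∃ f, spl l z w f := by
  have h1 : ∀ z w : Fin 10, ladj E1l z w → ∃ f ∈ E1t, spl E1l z w f := by decide +kernel
  have h2 : ∀ z w : Fin 10, ladj E2l z w → ∃ f ∈ E2t, spl E2l z w f := by decide +kernel
  rintro l (rfl | rfl) z w h
  · obtain ⟨f, _, hf⟩ := h1 z w h; exact ⟨f, hf⟩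
  · obtain ⟨f, _, hf⟩ := h2 z w h; exact ⟨f, hf⟩

theorem E_deg3 : ∀ l, (l = E1l ∨ l = E2l) → ∀ z a b : Fin 10, ladj l z a → ladj l z b → a ≠ b →
    ∃ c, ladj l z c ∧ ∀ w, ladj l z w → w = a ∨ w = b ∨ w = c := by
  rintro l (rfl | rfl) <;> decide +kernel

theorem E_split {l : List (Fin 10 × Fin 10)} (hl : l = E1l ∨ l = E2l) (z : Fin 10) (P : Fin 10 → Prop)
    (h1 : ∃ w, ladj l z w ∧ P w) (h2 : ∃ w, ladj l z w ∧ ¬ P w) :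
    ∃ f : Fin 10 → Fin 5, (∀ p ∈ l, p.1 ≠ z → p.2 ≠ z → c5 (f p.1) (f p.2)) ∧
      (∀ w, ladj l z w → P w → c5 (f w) 1) ∧ (∀ w, ladj l z w → ¬ P w → c5 (f w) 4) := by
  obtain ⟨a, ha, pa⟩ := h1
  obtain ⟨b, hb, pb⟩ := h2
  obtain ⟨c, hc, h3⟩ := E_deg3 l hl z a b ha hb (by rintro rfl; exact pb pa)
  have neg : ∀ x y : Fin 5, c5 x y → c5 (-x) (-y) := by decide
  by_cases pc : P c
  · obtain ⟨f, k1, k2, k3⟩ := E_spl l hl z b hb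
    refine ⟨fun w => - f w, fun p hp q1 q2 => neg _ _ (k1 p hp q1 q2), ?_, ?_⟩
    · intro w hw pw
      exact neg _ _ (k3 w hw (by rintro rfl; exact pb pw))
    · intro w hw pw
      rcases h3 w hw with rfl | rfl | rfl
      · exact absurd pa pw
      · exact neg _ _ k2
      · exact absurd pc pw
  · obtain ⟨f, k1, k2, k3⟩ := E_spl l hl z a ha
    refine ⟨f, k1, ?_, ?_⟩
    · intro w hw pw
      rcases h3 w hw with rfl | rfl | rfl
      · exact k2
      · exact absurd pw pb
      · exact absurd pw pc
    · intro w hw pw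
      exact k3 w hw (by rintro rfl; exact pw pa)

open Classical in
theorem Fold.star {k : ℕ} {G H L : SimpleGraph V} {tl : List (Fin k × Fin k)} {τ : V → Fin k}
    {W : SimpleGraph (V ⊕ Fin k)} (F : Fold G H tl τ W L) (hE : IsE W) {i : Fin k} (hU : US W = {i})
    {v0 : V} (hv0 : v0 ∈ H.support) (h1 : ∃ a, L.Adj v0 a)
    (h2 : ∃ v a, L.Adj v a ∧ v ∈ H.support ∧ v ≠ v0) :
    (∀ v a, L.Adj v a → v ∈ H.support → a ∉ H.support) ∧
    ∃ col : V → Fin 5, (∀ a b, L.Adj a b → a ∉ H.support → b ∉ H.support → c5 (col a) (col b)) ∧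
      ∀ v a, L.Adj v a → v ∈ H.support → c5 (col a) (if v = v0 then 1 else 4) := by
  have τi : ∀ v a, L.Adj v a → v ∈ H.support → τ v = i := by
    intro v a hva hv
    have := F.mem_U hva hv
    rw [hU] at this
    simpa using this
  have hout : ∀ v a, L.Adj v a → v ∈ H.support → a ∉ H.support := by
    intro v a hva hv ha
    have := F.down v a hva
    rw [pr_in hv, pr_in ha, τi v a hva hv, τi a v hva.symm ha] at this
    exact this.ne rfl
  refine ⟨hout, ?_⟩
  obtain ⟨l, hl, g, hg, hW⟩ := hE
  have hgl : good l := by rcases hl with rfl | rfl; exacts [E1_good, E2_good]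
  have lad : ∀ i j, W.Adj (g i) (g j) ↔ ladj l i j := by
    intro i j; rw [hW]; exact img_adj' hg hgl
  have gs : ∀ v ∈ W.support, ∃ i, g i = v := by
    intro v hv; rw [hW] at hv; exact img_supp hv
  have hi : Sum.inr i ∈ W.support := mem_US.1 (by simp [hU])
  obtain ⟨z, hz⟩ := gs _ hi
  have lift : ∀ v a, L.Adj v a → v ∈ H.support → ∃ w, g w = Sum.inl a ∧ ladj l z w := by
    intro v a hva hv
    have hd := F.down v a hva
    rw [pr_in hv, pr_out (hout v a hva hv), τi v a hva hv] at hd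
    obtain ⟨w, hw⟩ := gs _ ⟨_, hd.symm⟩
    refine ⟨w, hw, ?_⟩
    rw [← lad, hz, hw]; exact hd
  have uniq : ∀ v v' a, L.Adj v a → v ∈ H.support → L.Adj v' a → v' ∈ H.support → v = v' := by
    intro v v' a hva hv hva' hv'
    refine (F.inj v a v' a hva hva' ?_ rfl).1
    rw [pr_in hv, pr_in hv', τi v a hva hv, τi v' a hva' hv']
  obtain ⟨f, k1, k2, k3⟩ := E_split hl z (fun w => ∃ a, g w = Sum.inl a ∧ L.Adj v0 a) (by
      obtain ⟨a, ha⟩ := h1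
      obtain ⟨w, hw, hzw⟩ := lift v0 a ha hv0
      exact ⟨w, hzw, a, hw, ha⟩) (by
      obtain ⟨v, a, hva, hv, hne⟩ := h2
      obtain ⟨w, hw, hzw⟩ := lift v a hva hv
      refine ⟨w, hzw, ?_⟩
      rintro ⟨a', ha', hv0a⟩
      rw [hw] at ha'
      cases ha'
      exact hne (uniq _ _ _ hva hv hv0a hv0))
  refine ⟨fun a => f (Function.invFun g (Sum.inl a)), ?_, ?_⟩
  · intro a b hab ha hb
    have hd := F.down a b hab
    rw [pr_out ha, pr_out hb] at hd
    obtain ⟨x, hx⟩ := gs _ ⟨_, hd⟩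
    obtain ⟨y, hy⟩ := gs _ ⟨_, hd.symm⟩
    rw [← hx, ← hy, lad] at hd
    beta_reduce
    rw [← hx, ← hy, Function.leftInverse_invFun hg, Function.leftInverse_invFun hg]
    have xz : x ≠ z := by rintro rfl; rw [hx] at hz; cases hz
    have yz : y ≠ z := by rintro rfl; rw [hy] at hz; cases hz
    rcases hd with hd | hd
    · exact k1 _ hd xz yz
    · exact c5_symm (k1 _ hd yz xz)
  · intro v a hva hv
    obtain ⟨w, hw, hzw⟩ := lift v a hva hv
    beta_reduce
    rw [← hw, Function.leftInverse_invFun hg]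
    split_ifs with hvv
    · subst hvv
      exact k2 w hzw ⟨a, hw, hva⟩
    · apply k3 w hzw
      rintro ⟨a', ha', hv0a⟩
      rw [hw] at ha'
      cases ha'
      exact hvv (uniq _ _ _ hva hv hv0a hv0)

end C52

set_option linter.unusedSectionVars false
namespace C52
variable {V : Type} [Fintype V]

/-! ### Folding an eight-cycle together with a split `E1` or `E2` -/

theorem Cex.star2 {k : ℕ} {G : SimpleGraph V} (hG : Cex G) {e : Fin 8 → V}
    {tl : List (Fin k × Fin k)} {t : Fin 8 → Fin k} {W : SimpleGraph (V ⊕ Fin k)}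
    {L : SimpleGraph V} {τ : V → Fin k} (I : FI G C8l e tl t W L τ) (hE : IsE W)
    {i : Fin k} (hU : US W = {i}) (hY : img C8l e ⊔ L < G) (hp : pp (img C8l e ⊔ L) ≤ 5)
    {u0 : Fin 8} (h1 : ∃ a, L.Adj (e u0) a) (h2 : ∃ u a, L.Adj (e u) a ∧ u ≠ u0)
    (T2 : List (Fin 7 × Fin 7)) (t2 : Fin 8 → Fin 7) {o1 o2 : Fin 8} (ho1 : Out G e o1)
    (ho2 : Out G e o2) (to1 : t o1 ≠ i) (to2 : t o2 ≠ i)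
    (hd : good T2 ∧ (∀ p ∈ C8l, ladj T2 (t2 p.1) (t2 p.2)) ∧ (∃ i j, i ≠ j ∧ t2 i = t2 j) ∧
      (∀ a b : Fin 5, c5 a b → ladj T2 (Fin.castLE (by norm_num) a) (Fin.castLE (by norm_num) b)))
    (ht2 : ∀ u, t u = i → t2 u = if u = u0 then 1 else 4)
    (hq : ∀ U : Finset (Fin 7), U.Nonempty → 5 ≤ q T2 U ∧ (t2 o1 ∈ U → t2 o2 ∈ U → 7 ≤ q T2 U)) :
    False := by
  classical
  obtain ⟨g2, hC, ⟨i1, i2, i12, ti12⟩, h5⟩ := hd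
  set H := img C8l e ⊔ L with hH
  have tU : ∀ u a, L.Adj (e u) a → t u = i := by
    intro u a hua
    have := I.F.mem_U hua (I.ms u)
    rw [hU, I.ht] at this
    simpa using this
  obtain ⟨hout, col, c1, c2⟩ := I.F.star hE hU (I.ms u0) h1 (by
    obtain ⟨u, a, h, hne⟩ := h2
    exact ⟨e u, a, h, I.ms u, I.he.ne hne⟩)
  set τ2 : V → Fin 7 := Function.extend e t2 (fun v => Fin.castLE (by norm_num) (col v)) with hτ
  have e2 : ∀ u, τ2 (e u) = t2 u := fun u => I.he.extend_apply _ _ _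
  have o2' : ∀ v, v ∉ (img C8l e).support → τ2 v = Fin.castLE (by norm_num) (col v) := by
    intro v hv
    apply Function.extend_apply'
    rintro ⟨u, rfl⟩
    exact hv (I.ms u)
  have hT : ∀ a b, H.Adj a b → ladj T2 (τ2 a) (τ2 b) := by
    have key : ∀ a b, L.Adj a b → a ∈ (img C8l e).support → ladj T2 (τ2 a) (τ2 b) := by
      intro a b hab ha
      have k2 := c2 a b hab ha
      rw [o2' b (hout a b hab ha)]
      obtain ⟨u, rfl⟩ := img_supp ha
      rw [e2, ht2 u (tU u b hab)]
      have hx : (if u = u0 then (1 : Fin 7) else 4) =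
        Fin.castLE (by norm_num) (if e u = e u0 then (1 : Fin 5) else 4) := by
        by_cases huu : u = u0
        · simp [huu]
        · simp [huu, I.he.eq_iff]
      rw [hx]
      exact h5 _ _ (c5_symm k2)
    rintro a b (hab | hab)
    · obtain ⟨_, i, j, hij, rfl, rfl⟩ := img_adj.1 hab
      rw [e2, e2]
      rcases hij with h | h
      · exact hC _ h
      · exact (hC _ h).symm
    · by_cases ha : a ∈ (img C8l e).support
      · exact key a b hab ha
      by_cases hb : b ∈ (img C8l e).support
      · exact (key b a hab.symm hb).symm
      rw [o2' a ha, o2' b hb]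
      exact h5 _ _ (c1 a b hab ha hb)
  have hms : ∀ u, e u ∈ H.support := fun u => support_mono' le_sup_left (I.ms u)
  obtain ⟨W2, L2, F2⟩ := exists_fold hG T2 g2 τ2 hY.le (I.ne (by norm_num)) hT (by
      intro a b hab ha hb
      exact g2.ne (hT a b (hG.induced hY hp hab ha hb)))
    ⟨e i1, e i2, I.he.ne i12, hms _, hms _, by rw [e2, e2, ti12]⟩
  have hb := F2.bound'
  have hw : pp W2 ≤ 3 := by
    rcases F2.sp with h | h | h
    · omega
    · exact pp_C3 h
    · linarith [pp_E h]
  have hq := hq _ (F2.U_ne hG)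
  rcases F2.YG.lt_or_eq with hY2 | hY2
  · have := hG.lemA hY2 (by
      obtain ⟨a, b, hab⟩ := I.ne (by norm_num)
      exact ⟨a, b, Or.inl hab⟩)
    omega
  · have hpos := hG.pos
    rw [← hY2] at hpos
    have key : ∀ o, Out G e o → t o ≠ i → t2 o ∈ US W2 := by
      rintro o ⟨w, w1, w2, w3⟩ hto
      rw [← e2]
      refine F2.out hY2 (hms o) w1 ?_
      rintro (hh | hh)
      · obtain ⟨j, rfl⟩ := img_supp ⟨_, hh.symm⟩
        have := (img_adj' I.he I.hl).1 hh
        rcases (by decide : ∀ o j : Fin 8, ladj C8l o j → j = o + 1 ∨ j = o - 1) o j this with rfl | rfl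
        · exact w2 rfl
        · exact w3 rfl
      · exact hto (tU _ _ hh)
    have := hq.2 (key o1 ho1 to1) (key o2 ho2 to2)
    omega

end C52

set_option linter.unusedSectionVars false
namespace C52
variable {V : Type} [Fintype V]

/-! ### Eight-cycles with a vertex joined to two vertices at distance three -/

theorem A4.endp {G H : SimpleGraph V} {x s t y : V} (hA : A4 G H x s t y) {v w : V}
    (hv : v ∈ H.support) (h : G.Adj v w) (hn : ¬ H.Adj v w) : v = x ∨ v = y := by
  rcases hA.adj _ _ h with k | k | k | k | k | k | k
  · exact absurd k hn
  · exact Or.inl k.1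
  · exact absurd (k.1 ▸ hv) hA.hs
  · exact absurd (k.1 ▸ hv) hA.hs
  · exact absurd (k.1 ▸ hv) hA.ht
  · exact absurd (k.1 ▸ hv) hA.ht
  · exact Or.inr k.1

theorem Cex.nadj8 {G : SimpleGraph V} (hG : Cex G) {e : Fin 8 → V} (h : Cyc G e) {i j : Fin 8}
    (hij : ¬ (j = i + 1 ∨ i = j + 1)) : ¬ G.Adj (e i) (e j) := fun hh => hij (hG.ind8 h hh)

theorem Cex.sep8 {k : ℕ} {G : SimpleGraph V} (hG : Cex G) {e : Fin 8 → V} (h : Cyc G e)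
    (t : Fin 8 → Fin k) (ht : ∀ i j : Fin 8, t i = t j → ¬ (j = i + 1 ∨ i = j + 1)) :
    ∀ i j, t i = t j → ¬ G.Adj (e i) (e j) := fun i j hij => hG.nadj8 h (ht i j hij)

theorem sep_ex {n k : ℕ} {G : SimpleGraph V} {e : Fin n → V} {y : V} (t : Fin (n + 1) → Fin k)
    (h1 : ∀ i j : Fin n, t i.castSucc = t j.castSucc → ¬ G.Adj (e i) (e j))
    (h2 : ∀ i : Fin n, t i.castSucc ≠ t (Fin.last n)) :
    ∀ i j, t i = t j → ¬ G.Adj (ex e y i) (ex e y j) := by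
  intro i j
  refine Fin.lastCases ?_ (fun i => ?_) i
  · refine Fin.lastCases ?_ (fun j => ?_) j
    · intro _ hh; exact hh.ne rfl
    · intro hh; exact absurd hh.symm (h2 j)
  · refine Fin.lastCases ?_ (fun j => ?_) j
    · intro hh; exact absurd hh (h2 i)
    · intro hh; rw [ex_cast, ex_cast]; exact h1 i j hh

theorem ex_ne {n : ℕ} {e : Fin n → V} {y a : V} (h1 : ∀ m, e m ≠ a) (h2 : y ≠ a) :
    ∀ m, ex e y m ≠ a := by
  intro m
  refine Fin.lastCases ?_ (fun i => ?_) m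
  · rw [ex_last]; exact h2
  · rw [ex_cast]; exact h1 i

/-- edges outside the image at a vertex where the image has only cycle edges -/
theorem Out.ex {n m : ℕ} [NeZero n] {G : SimpleGraph V} {e : Fin n → V} {o : Fin n} (h : Out G e o)
    {l : List (Fin m × Fin m)} {f : Fin m → V} {a b c : Fin m} (ha : f a = e o) (hb : f b = e (o + 1))
    (hc : f c = e (o - 1)) (hl : ∀ j, ladj l a j → j = b ∨ j = c) :
    ∃ w, G.Adj (f a) w ∧ ∀ j, ladj l a j → w ≠ f j := by
  obtain ⟨w, h1, h2, h3⟩ := h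
  refine ⟨w, ha ▸ h1, ?_⟩
  intro j hj
  rcases hl j hj with rfl | rfl
  · rwa [hb]
  · rwa [hc]

theorem FI.out' {n k : ℕ} {G : SimpleGraph V} {l : List (Fin n × Fin n)} {e : Fin n → V}
    {tl : List (Fin k × Fin k)} {t : Fin n → Fin k} {W : SimpleGraph (V ⊕ Fin k)}
    {L : SimpleGraph V} {τ : V → Fin k} (I : FI G l e tl t W L τ) (hY : img l e ⊔ L = G) (u : Fin n)
    (h : ∃ w, G.Adj (e u) w ∧ ∀ j, ladj l u j → w ≠ e j) : t u ∈ US W := by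
  obtain ⟨w, h1, h2⟩ := h
  exact I.out hY h1 h2

def K9l : List (Fin 9 × Fin 9) :=
  [(0,1), (1,2), (2,3), (3,4), (4,5), (5,6), (6,7), (7,0), (0,8), (8,3)]
def T9 : List (Fin 6 × Fin 6) := [(0,1), (1,2), (2,3), (3,4), (4,0), (2,5)]
def t9 : Fin 9 → Fin 6 := ![0, 1, 2, 3, 2, 5, 2, 1, 4]

theorem Cex.fold9 {G : SimpleGraph V} (hG : Cex G) {e : Fin 8 → V} (h : Cyc G e) {y : V}
    (hy : ∀ m, e m ≠ y) (h0 : G.Adj (e 0) y) (h3 : G.Adj y (e 3)) (o5 : Out G e 5) :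
    ¬ Out G e 1 ∧ (Out G e 2 → Out G e 4 ∨ Out G e 6) := by
  have hi := ex_inj h.inj hy
  have hle : ∀ p ∈ K9l, G.Adj (ex e y p.1) (ex e y p.2) := by
    simp only [K9l, List.forall_mem_cons, List.not_mem_nil, false_imp_iff, implies_true, and_true]
    exact ⟨h.adj 0, h.adj 1, h.adj 2, h.adj 3, h.adj 4, h.adj 5, h.adj 6, h.adj 7, h0, h3⟩
  obtain ⟨W, L, τ, I⟩ := exists_FI hG K9l T9 t9 hi (img_le hle)
    (sep_ex t9 (hG.sep8 h _ (by decide)) (by decide)) (by decide)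
  have hb := I.bd 5 (by decide)
  have hw := I.w3
  have hq := (by decide +kernel : ∀ U : Finset (Fin 6), U.Nonempty → 5 ≤ q T9 U) _ (I.F.U_ne hG)
  obtain ⟨hY, hpos⟩ := I.lemA hG (by norm_num) (by omega)
  have u5 : 5 ∈ US W := I.out' hY 5 (o5.ex (b := 6) (c := 4) rfl rfl rfl (by decide))
  have hq1 := (by decide +kernel : ∀ U : Finset (Fin 6), 5 ∈ U → 1 ∈ U →
    6 ≤ q T9 U ∧ (q T9 U ≤ 6 → 3 < U.card)) _ u5
  have hq2 := (by decide +kernel : ∀ U : Finset (Fin 6), 5 ∈ U → 2 ∈ U →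
    6 ≤ q T9 U ∧ (q T9 U ≤ 6 → U.card ≤ 3 → U.card = 2)) _ u5
  constructor
  · intro o1
    have u1 : 1 ∈ US W := I.out' hY 1 (o1.ex (b := 2) (c := 0) rfl rfl rfl (by decide))
    have hq1 := hq1 u1
    have := I.c3card hG (I.isC3 (by omega))
    have := hq1.2 (by omega)
    omega
  · intro o2
    have u2 : 2 ∈ US W := I.out' hY 2 (o2.ex (b := 3) (c := 1) rfl rfl rfl (by decide))
    have hq2 := hq2 u2
    have hC := I.isC3 (by omega)
    have := I.c3card hG hC
    have hc := hq2.2 (by omega) (by omega)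
    by_contra! hn
    have key : ∀ u z u', t9 u = 5 → t9 u' = 2 → (∀ m, ex e y m ≠ z) → L.Adj (ex e y u) z →
        L.Adj z (ex e y u') → False := by
      intro u z u' hu hu' hz l1 l2
      have l1 := I.LG l1
      have l2 := I.LG l2
      have hz8 : ∀ m : Fin 8, e m ≠ z := fun m => by
        have := hz m.castSucc
        rwa [ex_cast] at this
      have : u = 5 := (by decide : ∀ u, t9 u = 5 → u = 5) u hu
      subst this
      rcases (by decide : ∀ u, t9 u = 2 → u = 2 ∨ u = 4 ∨ u = 6) u' hu' with rfl | rfl | rfl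
      · have hf := (ex_inj hi hz).comp (by decide : (![2, 1, 0, 8, 3, 4, 5, 9] : Fin 8 → Fin 10).Injective)
        refine absurd (hG.ind8 (e := ex (ex e y) z ∘ ![2, 1, 0, 8, 3, 4, 5, 9]) (i := 0) (j := 4)
          ⟨hf, ?_⟩ (h.adj 2)) (by decide)
        · intro i
          fin_cases i
          · exact (h.adj 1).symm
          · exact (h.adj 0).symm
          · exact h0
          · exact h3
          · exact h.adj 3
          · exact h.adj 4
          · exact l1
          · exact l2
      · apply hn.1
        exact ⟨z, l2.symm, fun hh => hz8 _ hh.symm, fun hh => hz8 _ hh.symm⟩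
      · apply hn.2
        exact ⟨z, l2.symm, fun hh => hz8 _ hh.symm, fun hh => hz8 _ hh.symm⟩
    rcases I.c3 hG hC with hh | hh | hh
    · obtain ⟨i, hU, _⟩ := hh
      rw [hU, Finset.card_singleton] at hc
      omega
    · obtain ⟨i, j, hij, hU, u, z, u', hu, hu', hz, l1, l2⟩ := hh
      rw [hU] at u5 u2
      rcases (by decide : ∀ i j : Fin 6, 5 ∈ ({i, j} : Finset (Fin 6)) → 2 ∈ ({i, j} : Finset (Fin 6)) →
        (i = 5 ∧ j = 2) ∨ (i = 2 ∧ j = 5)) i j u5 u2 with ⟨rfl, rfl⟩ | ⟨rfl, rfl⟩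
      · exact key u z u' hu hu' hz l1 l2
      · exact key u' z u hu' hu hz l2.symm l1.symm
    · obtain ⟨i, j, m, hij, him, hjm, hU, _⟩ := hh
      rw [hU, Finset.card_eq_three.2 ⟨i, j, m, hij, him, hjm, rfl⟩] at hc
      omega

end C52

set_option linter.unusedSectionVars false
namespace C52
variable {V : Type} [Fintype V]

/-! ### Eight-cycles with an additional 3-path -/

theorem Cex.fold10 {G : SimpleGraph V} (hG : Cex G) {f : Fin 10 → V} (hf : f.Injective)
    (l : List (Fin 10 × Fin 10)) (T : List (Fin 7 × Fin 7)) (t : Fin 10 → Fin 7)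
    (hle : ∀ p ∈ l, G.Adj (f p.1) (f p.2)) (sep : ∀ i j, t i = t j → ¬ G.Adj (f i) (f j))
    (hdec : (good l ∧ (∀ i, ∃ j, ladj l i j)) ∧ good T ∧
      (∀ p ∈ l, ladj T (t p.1) (t p.2)) ∧ (∃ i j, i ≠ j ∧ t i = t j)) (hlen : l.length = 11)
    (o1 : ∃ w, G.Adj (f 1) w ∧ ∀ j, ladj l 1 j → w ≠ f j)
    (o5 : ∃ w, G.Adj (f 5) w ∧ ∀ j, ladj l 5 j → w ≠ f j)
    (h15 : t 1 ≠ t 5 ∧ ¬ ladj T (t 1) (t 5))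
    (n15 : ∀ u u', t u = t 1 → t u' = t 5 → ¬ G.Adj (f u) (f u'))
    (hq : ∀ U : Finset (Fin 7), U.Nonempty → 5 ≤ q T U ∧ (q T U ≤ 5 → U.card ≤ 3 → U.card = 1) ∧
      (t 1 ∈ U → t 5 ∈ U → 7 ≤ q T U ∧ (q T U ≤ 7 → U.card ≤ 3 → U.card = 3))) :
    ∃ u u' a b, t u = t u' ∧ u < u' ∧ (∀ m, f m ≠ a) ∧ (∀ m, f m ≠ b) ∧
      G.Adj (f u) a ∧ G.Adj a b ∧ G.Adj b (f u') := by
  obtain ⟨W, L, τ, I⟩ := exists_FI hG l T t hf (img_le hle) sep hdec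
  have hb := I.bd 6 (by rw [hlen]; norm_num)
  have hw := I.w3
  obtain ⟨q1, q2, q3⟩ := hq _ (I.F.U_ne hG)
  rcases I.F.YG.lt_or_eq with hY | hY
  · have := hG.lemA hY (I.ne (by norm_num))
    have hC := I.isC3 (by omega)
    have hc := q2 (by omega) (I.c3card hG hC)
    rcases I.c3 hG hC with hh | hh | hh
    · obtain ⟨i, hi, u, u', a, b, hu, hu', huu, ha, hb, l1, l2, l3⟩ := hh
      have l1 := I.LG l1
      have l2 := I.LG l2
      have l3 := I.LG l3
      rcases lt_or_gt_of_ne huu with hlt | hlt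
      · exact ⟨u, u', a, b, hu.trans hu'.symm, hlt, ha, hb, l1, l2, l3⟩
      · exact ⟨u', u, b, a, hu'.trans hu.symm, hlt, hb, ha, l3.symm, l2.symm, l1.symm⟩
    · obtain ⟨i, j, hij, hU, _⟩ := hh
      rw [hU, Finset.card_pair hij] at hc
      omega
    · obtain ⟨i, j, m, hij, him, hjm, hU, _⟩ := hh
      rw [hU, Finset.card_eq_three.2 ⟨i, j, m, hij, him, hjm, rfl⟩] at hc
      omega
  · exfalso
    have hpos := hG.pos
    rw [← hY] at hpos
    have u1 := I.out' hY 1 o1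
    have u5 := I.out' hY 5 o5
    have hq' := q3 u1 u5
    have hC := I.isC3 (by omega)
    have hc := hq'.2 (by omega) (I.c3card hG hC)
    rcases I.c3 hG hC with hh | hh | hh
    · obtain ⟨i, hU, _⟩ := hh
      rw [hU, Finset.card_singleton] at hc
      omega
    · obtain ⟨i, j, hij, hU, _⟩ := hh
      rw [hU, Finset.card_pair hij] at hc
      omega
    · obtain ⟨_, _, _, _, _, _, _, hall⟩ := hh
      rcases hall _ u1 _ u5 h15.1 with hh | ⟨u, u', hu, hu', hL⟩
      · exact h15.2 hh
      · exact n15 u u' hu hu' (I.LG hL)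

def K12 (l : List (Fin 10 × Fin 10)) (u u' : Fin 10) : List (Fin 12 × Fin 12) :=
  (l.map fun p => (p.1.castSucc.castSucc, p.2.castSucc.castSucc)) ++
      [(u.castSucc.castSucc, 10), (10, 11), (11, u'.castSucc.castSucc)]

theorem K12_le {G : SimpleGraph V} {f : Fin 10 → V} {l : List (Fin 10 × Fin 10)}
    (hle : ∀ p ∈ l, G.Adj (f p.1) (f p.2)) {u u' : Fin 10} {a b : V} (h1 : G.Adj (f u) a)
    (h2 : G.Adj a b) (h3 : G.Adj b (f u')) :
    ∀ p ∈ K12 l u u', G.Adj (ex (ex f a) b p.1) (ex (ex f a) b p.2) := by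
  have fc : ∀ k : Fin 10, ex (ex f a) b k.castSucc.castSucc = f k := by
    intro k; rw [ex_cast, ex_cast]
  have f8 : ex (ex f a) b 10 = a := rfl
  have f9 : ex (ex f a) b 11 = b := rfl
  intro p hp
  rw [K12, List.mem_append] at hp
  rcases hp with hp | hp
  · obtain ⟨p', hp', rfl⟩ := List.mem_map.1 hp
    simp only [fc]
    exact hle p' hp'
  · simp only [List.mem_cons, List.not_mem_nil, or_false] at hp
    rcases hp with rfl | rfl | rfl
    · simp only [fc, f8]; exact h1
    · simp only [f8, f9]; exact h2
    · simp only [fc, f9]; exact h3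

def K2l : List (Fin 10 × Fin 10) :=
  [(0,1), (1,2), (2,3), (3,4), (4,5), (5,6), (6,7), (7,0), (0,8), (8,9), (9,2)]
def T2l : List (Fin 7 × Fin 7) := [(0,1), (1,2), (2,3), (3,4), (4,0), (1,5), (5,6)]
def t2l : Fin 10 → Fin 7 := ![0, 1, 2, 1, 5, 6, 5, 1, 4, 3]
def K3l : List (Fin 10 × Fin 10) :=
  [(0,1), (1,2), (2,3), (3,4), (4,5), (5,6), (6,7), (7,0), (3,8), (8,9), (9,7)]
def T3l : List (Fin 7 × Fin 7) := [(0,1), (1,2), (2,3), (3,4), (4,0), (0,5), (0,6)]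
def t3l : Fin 10 → Fin 7 := ![0, 5, 0, 1, 0, 6, 0, 4, 2, 3]

def K2t : List (Fin 12 → Fin 5) := [
  ![0, 1, 2, 3, 2, 1, 0, 4, 4, 3, 0, 4],
  ![0, 1, 2, 3, 2, 3, 2, 1, 4, 3, 0, 4],
  ![0, 1, 2, 3, 2, 1, 0, 4, 4, 3, 2, 3],
  ![0, 1, 2, 1, 0, 4, 0, 4, 4, 3, 2, 3],
  ![0, 1, 2, 3, 2, 1, 0, 4, 4, 3, 3, 4],
  ![0, 1, 2, 1, 0, 4, 3, 4, 4, 3, 1, 2]]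

def K3t : List (Fin 12 → Fin 5) := [
  ![0, 1, 2, 1, 0, 4, 0, 4, 2, 3, 4, 3],
  ![0, 1, 0, 4, 3, 4, 0, 1, 3, 2, 1, 2],
  ![0, 1, 0, 1, 0, 4, 3, 4, 2, 3, 1, 2]]

def prop12 (l : List (Fin 12 × Fin 12)) (c : Fin 12 → Fin 5) : Prop := ∀ p ∈ l, c5 (c p.1) (c p.2)
instance (l c) : Decidable (prop12 l c) := by unfold prop12; infer_instance

theorem K2_fact : ∀ u u' : Fin 10, t2l u = t2l u' → u < u' → good (K12 K2l u u') ∧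
    (∀ j, ladj (K12 K2l u u') 5 j → j = 6 ∨ j = 4) ∧ (∃ i, ladj (K12 K2l u u') 5 i) ∧
    (K12 K2l u u').length = 14 ∧ ∀ i, i ≠ 5 →
      ∃ c ∈ K2t, prop12 (K12 K2l u u') c ∧ c i ≠ c 5 := by decide +kernel

theorem K3_fact : ∀ u u' : Fin 10, t3l u = t3l u' → u < u' → good (K12 K3l u u') ∧
    (∀ j, ladj (K12 K3l u u') 5 j → j = 6 ∨ j = 4) ∧
    (∀ j, ladj (K12 K3l u u') 1 j → j = 2 ∨ j = 0) ∧ (∃ i, ladj (K12 K3l u u') 5 i) ∧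
    (∃ i, ladj (K12 K3l u u') 1 i) ∧
    (K12 K3l u u').length = 14 ∧ 
      ∃ c ∈ K3t, prop12 (K12 K3l u u') c ∧ c 1 ≠ c 5 := by decide +kernel

theorem Cex.endi {n : ℕ} {G : SimpleGraph V} {l : List (Fin n × Fin n)} {f : Fin n → V}
    (hf : f.Injective) (hl : good l) {i j : Fin n} {s t : V}
    (hA : A4 G (img l f) (f i) s t (f j)) {o o' : Fin n} (ho : ladj l o o')
    (h : ∃ w, G.Adj (f o) w ∧ ∀ j, ladj l o j → w ≠ f j) : o = i ∨ o = j := by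
  obtain ⟨w, h1, h2⟩ := h
  have := hA.endp (img_mem_supp' hf hl ho) h1 (by
    intro hh
    obtain ⟨j, rfl⟩ := img_supp ⟨_, hh.symm⟩
    exact h2 j ((img_adj' hf hl).1 hh) rfl)
  rwa [hf.eq_iff, hf.eq_iff] at this

theorem Cex.foldII {G : SimpleGraph V} (hG : Cex G) {e : Fin 8 → V} (h : Cyc G e) {a b : V}
    (ha : ∀ m, e m ≠ a) (hb : ∀ m, e m ≠ b) (h1 : G.Adj (e 0) a) (h2 : G.Adj a b)
    (h3 : G.Adj b (e 2)) (o1 : Out G e 1) (o5 : Out G e 5) : False := by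
  have hf := ex2_inj h.inj ha hb h2.ne
  have hle : ∀ p ∈ K2l, G.Adj (ex (ex e a) b p.1) (ex (ex e a) b p.2) := by
    simp only [K2l, List.forall_mem_cons, List.not_mem_nil, false_imp_iff, implies_true, and_true]
    exact ⟨h.adj 0, h.adj 1, h.adj 2, h.adj 3, h.adj 4, h.adj 5, h.adj 6, h.adj 7, h1, h2, h3⟩
  obtain ⟨u, u', a', b', huu, hlt, ha', hb', l1, l2, l3⟩ := hG.fold10 hf K2l T2l t2l hle
    (sep_ex t2l (sep_ex _ (hG.sep8 h _ (by decide)) (by decide)) (by decide)) (by decide) rfl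
    (o1.ex (b := 2) (c := 0) rfl rfl rfl (by decide))
    (o5.ex (b := 6) (c := 4) rfl rfl rfl (by decide)) (by decide)
    (by
      intro u u' hu hu'
      have : u' = 5 := (by decide : ∀ u' : Fin 10, t2l u' = t2l 5 → u' = 5) u' hu'
      subst this
      rcases (by decide : ∀ u : Fin 10, t2l u = t2l 1 → u = 1 ∨ u = 3 ∨ u = 7) u hu with rfl | rfl | rfl
      · exact hG.nadj8 h (i := 1) (j := 5) (by decide)
      · exact hG.nadj8 h (i := 3) (j := 5) (by decide)
      · exact hG.nadj8 h (i := 7) (j := 5) (by decide)) (by decide +kernel)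
  obtain ⟨g1, g2, ⟨o', ho'⟩, g3, g4⟩ := K2_fact u u' huu hlt
  have hf' := ex2_inj hf ha' hb' l2.ne
  obtain ⟨c0, _, hc0, _⟩ := g4 0 (by decide)
  obtain ⟨i, j, s, t, hij, hA, hc⟩ := hG.img4 hf' g1 (K12_le hle l1 l2 l3) (by rw [g3]; norm_num)
    ⟨_, _, ho'⟩ ⟨c0, hc0⟩
  have he := Cex.endi hf' g1 hA ho' (o5.ex (b := 6) (c := 4) rfl rfl rfl g2)
  rcases he with rfl | rfl
  · obtain ⟨c, _, k1, k2⟩ := g4 j hij.symm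
    exact k2 (hc c k1).symm
  · obtain ⟨c, _, k1, k2⟩ := g4 i hij
    exact k2 (hc c k1)

theorem Cex.foldIII {G : SimpleGraph V} (hG : Cex G) {e : Fin 8 → V} (h : Cyc G e) {a b : V}
    (ha : ∀ m, e m ≠ a) (hb : ∀ m, e m ≠ b) (h1 : G.Adj (e 3) a) (h2 : G.Adj a b)
    (h3 : G.Adj b (e 7)) (o1 : Out G e 1) (o5 : Out G e 5) : False := by
  have hf := ex2_inj h.inj ha hb h2.ne
  have hle : ∀ p ∈ K3l, G.Adj (ex (ex e a) b p.1) (ex (ex e a) b p.2) := by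
    simp only [K3l, List.forall_mem_cons, List.not_mem_nil, false_imp_iff, implies_true, and_true]
    exact ⟨h.adj 0, h.adj 1, h.adj 2, h.adj 3, h.adj 4, h.adj 5, h.adj 6, h.adj 7, h1, h2, h3⟩
  obtain ⟨u, u', a', b', huu, hlt, ha', hb', l1, l2, l3⟩ := hG.fold10 hf K3l T3l t3l hle
    (sep_ex t3l (sep_ex _ (hG.sep8 h _ (by decide)) (by decide)) (by decide)) (by decide) rfl
    (o1.ex (b := 2) (c := 0) rfl rfl rfl (by decide))
    (o5.ex (b := 6) (c := 4) rfl rfl rfl (by decide)) (by decide)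
    (by
      intro u u' hu hu'
      have : u' = 5 := (by decide : ∀ u' : Fin 10, t3l u' = t3l 5 → u' = 5) u' hu'
      subst this
      have : u = 1 := (by decide : ∀ u : Fin 10, t3l u = t3l 1 → u = 1) u hu
      subst this
      exact hG.nadj8 h (i := 1) (j := 5) (by decide)) (by decide +kernel)
  obtain ⟨g1, g2, g2', ⟨o', ho'⟩, ⟨o'', ho''⟩, g3, c, _, k1, k2⟩ := K3_fact u u' huu hlt
  have hf' := ex2_inj hf ha' hb' l2.ne
  obtain ⟨i, j, s, t, hij, hA, hc⟩ := hG.img4 hf' g1 (K12_le hle l1 l2 l3) (by rw [g3]; norm_num)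
    ⟨_, _, ho'⟩ ⟨c, k1⟩
  have he := Cex.endi hf' g1 hA ho' (o5.ex (b := 6) (c := 4) rfl rfl rfl g2)
  have he' := Cex.endi hf' g1 hA ho'' (o1.ex (b := 2) (c := 0) rfl rfl rfl g2')
  have hcc := hc c k1
  rcases he with rfl | rfl <;> rcases he' with hh | hh
  · exact absurd hh (by decide)
  · subst hh; exact k2 hcc.symm
  · subst hh; exact k2 hcc
  · exact absurd hh (by decide)

end C52

set_option linter.unusedSectionVars false
namespace C52
variable {V : Type} [Fintype V]

/-! ### Eight-cycles -/

section
variable {k : ℕ} {G : SimpleGraph V} {e : Fin 8 → V} {tl : List (Fin k × Fin k)} {t : Fin 8 → Fin k}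
  {W : SimpleGraph (V ⊕ Fin k)} {L : SimpleGraph V} {τ : V → Fin k}

theorem FI.noL (I : FI G C8l e tl t W L τ) {u : Fin 8} (hu : t u ∉ US W) (w : V) : ¬ L.Adj (e u) w := by
  intro h
  have := I.F.mem_U h (I.ms u)
  rw [I.ht] at this
  exact hu this

theorem FI.outL (I : FI G C8l e tl t W L τ) {u : Fin 8} {w : V} (h : L.Adj (e u) w) : Out G e u := by
  refine ⟨w, I.LG h, ?_, ?_⟩
  · rintro rfl
    exact I.F.disj ((img_adj' I.he I.hl).2 ((by decide : ∀ u : Fin 8, ladj C8l u (u + 1)) u)) h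
  · rintro rfl
    exact I.F.disj ((img_adj' I.he I.hl).2 ((by decide : ∀ u : Fin 8, ladj C8l u (u - 1)) u)) h

theorem FI.end8 (I : FI G C8l e tl t W L τ) {x s r y : V} (hA : A4 G (img C8l e ⊔ L) x s r y)
    {u : Fin 8} (hu : t u ∉ US W) (ho : Out G e u) : e u = x ∨ e u = y := by
  obtain ⟨w, w1, w2, w3⟩ := ho
  refine hA.endp (support_mono' le_sup_left (I.ms u)) w1 ?_
  rintro (hh | hh)
  · obtain ⟨j, rfl⟩ := img_supp ⟨_, hh.symm⟩
    have := (img_adj' I.he I.hl).1 hh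
    rcases (by decide : ∀ o j : Fin 8, ladj C8l o j → j = o + 1 ∨ j = o - 1) u j this with rfl | rfl
    · exact w2 rfl
    · exact w3 rfl
  · exact I.noL hu _ hh

theorem FI.three (I : FI G C8l e tl t W L τ) (hG : Cex G) (hY : img C8l e ⊔ L < G)
    (hp : pp (img C8l e ⊔ L) ≤ 4) {u1 u2 u3 : Fin 8} (h12 : u1 ≠ u2) (h13 : u1 ≠ u3) (h23 : u2 ≠ u3)
    (n1 : t u1 ∉ US W) (n2 : t u2 ∉ US W) (n3 : t u3 ∉ US W)
    (o1 : Out G e u1) (o2 : Out G e u2) (o3 : Out G e u3) : False := by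
  obtain ⟨_, x, s, r, y, hA⟩ := hG.lemA' hY (I.ne (by norm_num)) hp
  have k1 := I.end8 hA n1 o1
  have k2 := I.end8 hA n2 o2
  have k3 := I.end8 hA n3 o3
  have d1 := I.he.ne h12
  have d2 := I.he.ne h13
  have d3 := I.he.ne h23
  grind

theorem FI.D8 (I : FI G C8l e tl t W L τ) (hG : Cex G) (h : Cyc G e) (hY : img C8l e ⊔ L < G)
    (hp : pp (img C8l e ⊔ L) ≤ 4) (o o' : Fin 8) (n0 : t o ∉ US W) (n1 : t (o + 1) ∉ US W)
    (n2 : t (o - 1) ∉ US W) (n3 : t o' ∉ US W) (h1 : o ≠ o') (h2 : o' ≠ o + 1) (h3 : o' ≠ o - 1)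
    (o0 : Out G e o) (o3 : Out G e o') : False := by
  have hd := (by decide : ∀ o : Fin 8, o ≠ o + 1 ∧ o ≠ o - 1) o
  have m1 : ¬ Out G e (o + 1) := fun hh => I.three hG hY hp hd.1 h1 h2.symm n0 n1 n3 o0 hh o3
  have m2 : ¬ Out G e (o - 1) := fun hh => I.three hG hY hp hd.2 h1 h3.symm n0 n2 n3 o0 hh o3
  obtain ⟨_, x, s, r, y, hA⟩ := hG.lemA' hY (I.ne (by norm_num)) hp
  have key : ∀ x s r y, A4 G (img C8l e ⊔ L) x s r y → e o = x → False := by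
    rintro x s r y hA rfl
    have r5 : 5 + (o + 3) = o := (by decide : ∀ o : Fin 8, 5 + (o + 3) = o) o
    have r4 : 4 + (o + 3) = o - 1 := (by decide : ∀ o : Fin 8, 4 + (o + 3) = o - 1) o
    have r6 : 6 + (o + 3) = o + 1 := (by decide : ∀ o : Fin 8, 6 + (o + 3) = o + 1) o
    refine hG.lemD (h.rot (o + 3)) (out_rot.not.2 (by rwa [r4])) (out_rot.not.2 (by rwa [r6]))
      (Y := img C8l e ⊔ L) (s := s) (t := r) (y := y) ?_ ?_ ?_
    · intro i
      left
      refine (img_adj' I.he I.hl).2 ?_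
      rw [show i + 1 + (o + 3) = i + (o + 3) + 1 by abel]
      exact (by decide : ∀ u : Fin 8, ladj C8l u (u + 1)) _
    · beta_reduce
      rw [r5]
      exact hA
    · beta_reduce
      rw [r5, r4, r6]
      rintro w (hh | hh)
      · obtain ⟨j, rfl⟩ := img_supp ⟨_, hh.symm⟩
        have := (img_adj' I.he I.hl).1 hh
        rcases (by decide : ∀ o j : Fin 8, ladj C8l o j → j = o + 1 ∨ j = o - 1) o j this with rfl | rfl
        · right; rfl
        · left; rfl
      · exact absurd hh (I.noL n0 _)
  rcases I.end8 hA n0 o0 with hx | hx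
  · exact key _ _ _ _ hA hx
  · exact key _ _ _ _ hA.symm hx

theorem FI.H1 (I : FI G C8l e tl t W L τ) (hG : Cex G) (hY : img C8l e ⊔ L < G)
    (l1 : List (Fin 8 × Fin 8)) (g1 : good l1 ∧ l1 ≠ []) (h1 : ∀ p ∈ l1, p ∈ C8l)
    (hp : pp (img l1 e ⊔ L) ≤ 4)
    {u1 u2 u3 : Fin 8} (h12 : u1 ≠ u2) (h13 : u1 ≠ u3) (h23 : u2 ≠ u3)
    (n1 : t u1 ∉ US W) (n2 : t u2 ∉ US W) (n3 : t u3 ∉ US W)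
    (c1 : ∀ j, ¬ ladj l1 u1 j) (c2 : ∀ j, ¬ ladj l1 u2 j) (c3 : ∀ j, ¬ ladj l1 u3 j) : False := by
  have hle : img l1 e ⊔ L ≤ img C8l e ⊔ L := by
    refine sup_le_sup_right ?_ _
    apply img_le
    intro p hp
    exact (img_adj' I.he I.hl).2 (Or.inl (h1 p hp))
  obtain ⟨_, x, s, r, y, hA⟩ := hG.lemA' (hle.trans_lt hY) (by
    obtain ⟨p, hp⟩ := List.exists_mem_of_ne_nil _ g1.2
    exact ⟨e p.1, e p.2, Or.inl ((img_adj' I.he g1.1).2 (Or.inl hp))⟩) hp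
  have key : ∀ u, t u ∉ US W → (∀ j, ¬ ladj l1 u j) → e u ∉ (img l1 e ⊔ L).support := by
    rintro u nu cu ⟨w, hw | hw⟩
    · obtain ⟨_, i, j, hij, hi, hj⟩ := img_adj.1 hw
      have := I.he hi
      subst this
      exact cu _ hij
    · exact I.noL nu _ hw
  have k1 := hA.cov (e u1)
  have k2 := hA.cov (e u2)
  have k3 := hA.cov (e u3)
  have q1 := key _ n1 c1
  have q2 := key _ n2 c2
  have q3 := key _ n3 c3
  have d1 := I.he.ne h12
  have d2 := I.he.ne h13
  have d3 := I.he.ne h23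
  grind

theorem FI.c38 (I : FI G C8l e tl t W L τ) (hG : Cex G) (h : Cyc G e) (hC : IsC3 W)
    (hT : ∀ p ∈ C8l, ladj tl (t p.1) (t p.2))
    (tf : ∀ x y z, ladj tl x y → ladj tl y z → ladj tl x z → False) :
    (∃ u u' a b, t u = t u' ∧ u ≠ u' ∧ (∀ m, e m ≠ a) ∧ (∀ m, e m ≠ b) ∧ Out G e u ∧ Out G e u' ∧
      G.Adj (e u) a ∧ G.Adj a b ∧ G.Adj b (e u')) ∨
    (∃ u y u', US W = {t u, t u'} ∧ t u ≠ t u' ∧ (∀ m, e m ≠ y) ∧ Out G e u ∧ Out G e u' ∧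
      G.Adj (e u) y ∧ G.Adj y (e u') ∧ u' ≠ u + 1 ∧ u ≠ u' + 1) := by
  rcases I.c3 hG hC with hh | hh | hh
  · obtain ⟨i, hi, u, u', a, b, hu, hu', huu, ha, hb, l1, l2, l3⟩ := hh
    exact Or.inl ⟨u, u', a, b, hu.trans hu'.symm, huu, ha, hb, I.outL l1, I.outL l3.symm,
      I.LG l1, I.LG l2, I.LG l3⟩
  · obtain ⟨i, j, hij, hU, u, y, u', rfl, rfl, hz, l1, l2⟩ := hh
    refine Or.inr ⟨u, y, u', hU, hij, hz, I.outL l1, I.outL l2.symm, I.LG l1, I.LG l2, ?_, ?_⟩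
    · rintro rfl
      exact hG.tri (I.LG l1) (I.LG l2) (h.adj u)
    · rintro rfl
      exact hG.tri (I.LG l1) (I.LG l2) (h.adj u').symm
  · exfalso
    obtain ⟨i, j, m, hij, him, hjm, hU, hall⟩ := hh
    have key : ∀ x ∈ US W, ∀ y ∈ US W, x ≠ y → ladj tl x y := by
      intro x hx y hy hxy
      rcases hall x hx y hy hxy with hh | ⟨u, u', rfl, rfl, hL⟩
      · exact hh
      · rcases hG.ind8 h (I.LG hL) with rfl | rfl
        · exact hT _ ((by decide : ∀ u : Fin 8, (u, u + 1) ∈ C8l) u)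
        · exact (hT _ ((by decide : ∀ u : Fin 8, (u, u + 1) ∈ C8l) u')).symm
    have hi : i ∈ US W := by simp [hU]
    have hj : j ∈ US W := by simp [hU]
    have hm : m ∈ US W := by simp [hU]
    exact tf i j m (key i hi j hj hij) (key j hj m hm hjm) (key i hi m hm him)

end

theorem Cyc.le8 {G : SimpleGraph V} {e : Fin 8 → V} (h : Cyc G e) :
    ∀ p ∈ C8l, G.Adj (e p.1) (e p.2) := h.le (by decide)

def TP : List (Fin 5 × Fin 5) := [(0,1), (1,2), (2,3), (3,4)]
def tP : Fin 8 → Fin 5 := ![1, 0, 1, 2, 3, 4, 3, 2]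

theorem Cex.caseP {G : SimpleGraph V} (hG : Cex G) {e : Fin 8 → V} (h : Cyc G e)
    (o1 : Out G e 1) (o5 : Out G e 5) : False := by
  classical
  obtain ⟨W, L, τ, I⟩ := exists_FI hG C8l TP tP h.inj (img_le h.le8)
    (hG.sep8 h _ (by decide)) (by decide)
  have hb := I.bd 8 (by decide)
  have hw := I.w3
  have hne := I.F.U_ne hG
  rcases I.F.YG.lt_or_eq with hY | hY
  swap
  · have hpos := hG.pos
    rw [← hY] at hpos
    have u1 : 0 ∈ US W := I.out' hY 1 (o1.ex (b := 2) (c := 0) rfl rfl rfl (by decide))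
    have u5 : 4 ∈ US W := I.out' hY 5 (o5.ex (b := 6) (c := 4) rfl rfl rfl (by decide))
    have hq := (by decide +kernel : ∀ U : Finset (Fin 5), 0 ∈ U → 4 ∈ U →
      9 ≤ q TP U ∧ (U.card ≤ 3 → 10 ≤ q TP U)) _ u1 u5
    have := hq.2 (I.c3card hG (I.isC3 (by omega)))
    omega
  have h4 := hG.lemA hY (I.ne (by norm_num))
  have hsp : IsC3 W ∨ (pp W ≤ 2 ∧ (pp W ≤ 1 ∨ IsE W)) := by
    rcases I.F.sp with h | h | h
    · exact Or.inr ⟨by omega, Or.inl h⟩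
    · exact Or.inl h
    · exact Or.inr ⟨pp_E h, Or.inr h⟩
  rcases hsp with hC | ⟨hw2, hw'⟩
  · rcases I.c38 hG h hC (by decide) (by decide) with hh | hh
    · obtain ⟨u, u', a, b, htu, huu, ha, hb, -, -, l1, l2, l3⟩ := hh
      have key : ∀ u u' a b, (∀ m, e m ≠ a) → (∀ m, e m ≠ b) → G.Adj (e u) a → G.Adj a b →
          G.Adj b (e u') → (u = 0 ∧ u' = 2) ∨ (u = 3 ∧ u' = 7) ∨ (u = 4 ∧ u' = 6) → False := by
        rintro u u' a b ha hb l1 l2 l3 (⟨rfl, rfl⟩ | ⟨rfl, rfl⟩ | ⟨rfl, rfl⟩)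
        · exact hG.foldII h ha hb l1 l2 l3 o1 o5
        · exact hG.foldIII h ha hb l1 l2 l3 o1 o5
        · exact hG.foldII (h.rot 4) (fun _ => ha _) (fun _ => hb _) l1 l2 l3
            (out_rot.2 o5) (out_rot.2 o1)
      rcases (by decide : ∀ u u' : Fin 8, tP u = tP u' → u ≠ u' →
        ((u = 0 ∧ u' = 2) ∨ (u = 3 ∧ u' = 7) ∨ (u = 4 ∧ u' = 6)) ∨
        ((u' = 0 ∧ u = 2) ∨ (u' = 3 ∧ u = 7) ∨ (u' = 4 ∧ u = 6))) u u' htu huu with hh | hh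
      · exact key u u' a b ha hb l1 l2 l3 hh
      · exact key u' u b a hb ha l3.symm l2.symm l1.symm hh
    · obtain ⟨u, y, u', hU, htu, hy, -, -, l1, l2, d1, d2⟩ := hh
      have key : ∀ u u', G.Adj (e u) y → G.Adj y (e u') →
          (u = 0 ∧ u' = 3) ∨ (u = 2 ∧ u' = 7) ∨ (u = 4 ∧ u' = 7) ∨ (u = 6 ∧ u' = 3) → False := by
        rintro u u' l1 l2 (⟨rfl, rfl⟩ | ⟨rfl, rfl⟩ | ⟨rfl, rfl⟩ | ⟨rfl, rfl⟩)
        · exact (hG.fold9 h hy l1 l2 o5).1 o1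
        · exact (hG.fold9 (h.refl 2) (fun _ => hy _) l1 l2 (out_refl.2 o5)).1 (out_refl.2 o1)
        · exact (hG.fold9 (h.rot 4) (fun _ => hy _) l1 l2 (out_rot.2 o1)).1 (out_rot.2 o5)
        · exact (hG.fold9 (h.refl 6) (fun _ => hy _) l1 l2 (out_refl.2 o1)).1 (out_refl.2 o5)
      have hq : q TP {tP u, tP u'} ≤ 7 := by rw [← hU]; omega
      rcases (by decide +kernel : ∀ u u' : Fin 8, q TP {tP u, tP u'} ≤ 7 → tP u ≠ tP u' → u' ≠ u + 1 →
        u ≠ u' + 1 →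
        ((u = 0 ∧ u' = 3) ∨ (u = 2 ∧ u' = 7) ∨ (u = 4 ∧ u' = 7) ∨ (u = 6 ∧ u' = 3)) ∨
        ((u' = 0 ∧ u = 3) ∨ (u' = 2 ∧ u = 7) ∨ (u' = 4 ∧ u = 7) ∨ (u' = 6 ∧ u = 3)))
          u u' hq htu d1 d2 with hh | hh
      · exact key u u' l1 l2 hh
      · exact key u' u l2.symm l1.symm hh
  · have hq : q TP (US W) ≤ 6 := by omega
    have nU : ∀ {S : Finset (Fin 5)} {x : Fin 5}, US W = S → x ∉ S → x ∉ US W := by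
      intro S x hS hx; rwa [hS]
    rcases (by decide +kernel : ∀ U : Finset (Fin 5), U.Nonempty → q TP U ≤ 6 →
      U = {0} ∨ U = {4} ∨ (U = {1} ∨ U = {0, 1}) ∨ (U = {3} ∨ U = {3, 4}) ∨ U = {1, 2} ∨ U = {2, 3} ∨
      U = {2}) _ hne hq with hU | hU | hU | hU | hU | hU | hU
    · exact I.S hG 1 hU (by decide)
    · exact I.S hG 5 hU (by decide)
    · have hsub : ∀ u, tP u ∈ US W → u = 0 ∨ u = 1 ∨ u = 2 := by
        rcases hU with hU | hU <;> rw [hU] <;> decide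
      have hq5 : 5 ≤ q TP (US W) := by
        rcases hU with hU | hU <;> rw [hU] <;> decide +kernel
      have := I.bd1 [(0,1), (1,2)] (by decide) (by decide) 7 (by decide) (fun u hu =>
        (by decide : ∀ u : Fin 8, u = 0 ∨ u = 1 ∨ u = 2 → ∃ j, ladj [(0,1), (1,2)] u j) u (hsub u hu))
      exact I.H1 hG hY [(0,1), (1,2)] (by decide) (by decide) (by omega) (u1 := 3) (u2 := 4) (u3 := 5)
        (by decide) (by decide) (by decide) (fun hh => absurd (hsub _ hh) (by decide))
        (fun hh => absurd (hsub _ hh) (by decide)) (fun hh => absurd (hsub _ hh) (by decide))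
        (by decide) (by decide) (by decide)
    · have hsub : ∀ u, tP u ∈ US W → u = 4 ∨ u = 5 ∨ u = 6 := by
        rcases hU with hU | hU <;> rw [hU] <;> decide
      have hq5 : 5 ≤ q TP (US W) := by
        rcases hU with hU | hU <;> rw [hU] <;> decide +kernel
      have := I.bd1 [(4,5), (5,6)] (by decide) (by decide) 7 (by decide) (fun u hu =>
        (by decide : ∀ u : Fin 8, u = 4 ∨ u = 5 ∨ u = 6 → ∃ j, ladj [(4,5), (5,6)] u j) u (hsub u hu))
      exact I.H1 hG hY [(4,5), (5,6)] (by decide) (by decide) (by omega) (u1 := 3) (u2 := 1) (u3 := 2)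
        (by decide) (by decide) (by decide) (fun hh => absurd (hsub _ hh) (by decide))
        (fun hh => absurd (hsub _ hh) (by decide)) (fun hh => absurd (hsub _ hh) (by decide))
        (by decide) (by decide) (by decide)
    · have hq6 : q TP (US W) = 6 := by rw [hU]; decide +kernel
      exact I.D8 hG h hY (by omega) 5 1 (nU hU (by decide)) (nU hU (by decide)) (nU hU (by decide))
        (nU hU (by decide)) (by decide) (by decide) (by decide) o5 o1
    · have hq6 : q TP (US W) = 6 := by rw [hU]; decide +kernel
      exact I.D8 hG h hY (by omega) 1 5 (nU hU (by decide)) (nU hU (by decide)) (nU hU (by decide))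
        (nU hU (by decide)) (by decide) (by decide) (by decide) o1 o5
    · have hq5 : q TP (US W) = 5 := by rw [hU]; decide +kernel
      rcases hw' with hw' | hE
      · exact I.D8 hG h hY (by omega) 5 1 (nU hU (by decide)) (nU hU (by decide)) (nU hU (by decide))
          (nU hU (by decide)) (by decide) (by decide) (by decide) o5 o1
      · have hL : ∀ u a, L.Adj (e u) a → u = 3 ∨ u = 7 := by
          intro u a hua
          by_contra hn
          refine I.noL (nU hU ?_) a hua
          exact (by decide : ∀ u : Fin 8, ¬ (u = 3 ∨ u = 7) → tP u ∉ ({2} : Finset (Fin 5))) u hn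
        have hx : ∀ u0 u1 : Fin 8, (u0 = 3 ∧ u1 = 7) ∨ (u0 = 7 ∧ u1 = 3) → ∃ a, L.Adj (e u0) a := by
          intro u0 u1 h01
          by_contra! hn
          refine I.F.S (e u1) (by simp [hU]) ?_ (I.F.colL hG)
          intro a b hab ha
          obtain ⟨i, rfl⟩ := img_supp ha
          have : i ≠ u0 := by rintro rfl; exact hn _ hab
          rcases hL i b hab with rfl | rfl <;> grind
        obtain ⟨b, hb7⟩ := hx 7 3 (by decide)
        exact hG.star2 I hE hU hY (by omega) (hx 3 7 (by decide)) ⟨7, b, hb7, by decide⟩ T3l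
          ![0, 5, 0, 1, 0, 6, 0, 4] o1 o5 (by decide) (by decide) (by decide) (by decide)
          (by decide +kernel)

def TQ : List (Fin 5 × Fin 5) := [(0,1), (0,2), (0,3), (1,4)]
def tQ : Fin 8 → Fin 5 := ![3, 0, 1, 4, 1, 0, 2, 0]
def T6l : List (Fin 7 × Fin 7) := [(0,1), (1,2), (2,3), (3,4), (4,0), (0,5), (4,6)]

theorem Cex.caseQ {G : SimpleGraph V} (hG : Cex G) {e : Fin 8 → V} (h : Cyc G e)
    (o0 : Out G e 0) (o3 : Out G e 3) (o6 : Out G e 6) (n2 : ¬ Out G e 2) (n4 : ¬ Out G e 4)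
    (n7 : ¬ Out G e 7) (n15 : ¬ (Out G e 1 ∧ Out G e 5)) : False := by
  classical
  obtain ⟨W, L, τ, I⟩ := exists_FI hG C8l TQ tQ h.inj (img_le h.le8)
    (hG.sep8 h _ (by decide)) (by decide)
  have hb := I.bd 8 (by decide)
  have hw := I.w3
  have hne := I.F.U_ne hG
  rcases I.F.YG.lt_or_eq with hY | hY
  swap
  · have hpos := hG.pos
    rw [← hY] at hpos
    have u0 : 3 ∈ US W := I.out' hY 0 (o0.ex (b := 1) (c := 7) rfl rfl rfl (by decide))
    have u3 : 4 ∈ US W := I.out' hY 3 (o3.ex (b := 4) (c := 2) rfl rfl rfl (by decide))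
    have u6 : 2 ∈ US W := I.out' hY 6 (o6.ex (b := 7) (c := 5) rfl rfl rfl (by decide))
    have hq := (by decide +kernel : ∀ U : Finset (Fin 5), 3 ∈ U → 4 ∈ U → 2 ∈ U →
      9 ≤ q TQ U ∧ (U.card ≤ 3 → 10 ≤ q TQ U)) _ u0 u3 u6
    have := hq.2 (I.c3card hG (I.isC3 (by omega)))
    omega
  have h4 := hG.lemA hY (I.ne (by norm_num))
  have hsp : IsC3 W ∨ (pp W ≤ 2 ∧ (pp W ≤ 1 ∨ IsE W)) := by
    rcases I.F.sp with h | h | h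
    · exact Or.inr ⟨by omega, Or.inl h⟩
    · exact Or.inl h
    · exact Or.inr ⟨pp_E h, Or.inr h⟩
  have nO : ∀ u, Out G e u → u ≠ 2 ∧ u ≠ 4 ∧ u ≠ 7 := by
    intro u hu
    refine ⟨?_, ?_, ?_⟩ <;> rintro rfl <;> contradiction
  rcases hsp with hC | ⟨hw2, hw'⟩
  · rcases I.c38 hG h hC (by decide) (by decide) with hh | hh
    · obtain ⟨u, u', a, b, htu, huu, ha, hb, q1, q2, l1, l2, l3⟩ := hh
      rcases (by decide : ∀ u u' : Fin 8, tQ u = tQ u' → u ≠ u' → (u ≠ 2 ∧ u ≠ 4 ∧ u ≠ 7) →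
        (u' ≠ 2 ∧ u' ≠ 4 ∧ u' ≠ 7) → (u = 1 ∧ u' = 5) ∨ (u = 5 ∧ u' = 1))
        u u' htu huu (nO u q1) (nO u' q2) with ⟨rfl, rfl⟩ | ⟨rfl, rfl⟩
      · exact n15 ⟨q1, q2⟩
      · exact n15 ⟨q2, q1⟩
    · obtain ⟨u, y, u', hU, htu, hy, q1, q2, l1, l2, d1, d2⟩ := hh
      have key : ∀ u u', G.Adj (e u) y → G.Adj y (e u') →
          (u = 6 ∧ u' = 1) ∨ (u = 0 ∧ u' = 5) → False := by
        rintro u u' l1 l2 (⟨rfl, rfl⟩ | ⟨rfl, rfl⟩)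
        · rcases (hG.fold9 (h.rot 6) (fun _ => hy _) l1 l2 (out_rot.2 o3)).2 (out_rot.2 o0) with hh | hh
          · exact n2 (out_rot.1 hh)
          · exact n4 (out_rot.1 hh)
        · rcases (hG.fold9 (h.refl 0) (fun _ => hy _) l1 l2 (out_refl.2 o3)).2 (out_refl.2 o6) with hh | hh
          · exact n4 (out_refl.1 hh)
          · exact n2 (out_refl.1 hh)
      have hq : q TQ {tQ u, tQ u'} ≤ 7 := by rw [← hU]; omega
      rcases (by decide +kernel : ∀ u u' : Fin 8, q TQ {tQ u, tQ u'} ≤ 7 → tQ u ≠ tQ u' → u' ≠ u + 1 →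
        u ≠ u' + 1 → (u ≠ 2 ∧ u ≠ 4 ∧ u ≠ 7) → (u' ≠ 2 ∧ u' ≠ 4 ∧ u' ≠ 7) →
        ((u = 6 ∧ u' = 1) ∨ (u = 0 ∧ u' = 5)) ∨ ((u' = 6 ∧ u = 1) ∨ (u' = 0 ∧ u = 5)))
          u u' hq htu d1 d2 (nO u q1) (nO u' q2) with hh | hh
      · exact key u u' l1 l2 hh
      · exact key u' u l2.symm l1.symm hh
  · have hq : q TQ (US W) ≤ 6 := by omega
    have nU : ∀ {S : Finset (Fin 5)} {x : Fin 5}, US W = S → x ∉ S → x ∉ US W := by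
      intro S x hS hx; rwa [hS]
    rcases (by decide +kernel : ∀ U : Finset (Fin 5), U.Nonempty → q TQ U ≤ 6 →
      U = {2} ∨ U = {3} ∨ U = {4} ∨ (U = {1} ∨ U = {1, 4}) ∨ U = {0, 1} ∨ U = {0, 2} ∨ U = {0, 3} ∨
      U = {0}) _ hne hq with hU | hU | hU | hU | hU | hU | hU | hU
    · exact I.S hG 6 hU (by decide)
    · exact I.S hG 0 hU (by decide)
    · exact I.S hG 3 hU (by decide)
    · have hsub : ∀ u, tQ u ∈ US W → u = 2 ∨ u = 3 ∨ u = 4 := by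
        rcases hU with hU | hU <;> rw [hU] <;> decide
      have hq5 : 5 ≤ q TQ (US W) := by
        rcases hU with hU | hU <;> rw [hU] <;> decide +kernel
      have := I.bd1 [(2,3), (3,4)] (by decide) (by decide) 7 (by decide) (fun u hu =>
        (by decide : ∀ u : Fin 8, u = 2 ∨ u = 3 ∨ u = 4 → ∃ j, ladj [(2,3), (3,4)] u j) u (hsub u hu))
      exact I.H1 hG hY [(2,3), (3,4)] (by decide) (by decide) (by omega) (u1 := 0) (u2 := 1) (u3 := 5)
        (by decide) (by decide) (by decide) (fun hh => absurd (hsub _ hh) (by decide))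
        (fun hh => absurd (hsub _ hh) (by decide)) (fun hh => absurd (hsub _ hh) (by decide))
        (by decide) (by decide) (by decide)
    · have hq6 : q TQ (US W) = 6 := by rw [hU]; decide +kernel
      exact I.three hG hY (by omega) (u1 := 0) (u2 := 3) (u3 := 6) (by decide) (by decide) (by decide)
        (nU hU (by decide)) (nU hU (by decide)) (nU hU (by decide)) o0 o3 o6
    · have hq6 : q TQ (US W) = 6 := by rw [hU]; decide +kernel
      exact I.D8 hG h hY (by omega) 3 0 (nU hU (by decide)) (nU hU (by decide)) (nU hU (by decide))
        (nU hU (by decide)) (by decide) (by decide) (by decide) o3 o0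
    · have hq6 : q TQ (US W) = 6 := by rw [hU]; decide +kernel
      exact I.D8 hG h hY (by omega) 3 6 (nU hU (by decide)) (nU hU (by decide)) (nU hU (by decide))
        (nU hU (by decide)) (by decide) (by decide) (by decide) o3 o6
    · have hq5 : q TQ (US W) = 5 := by rw [hU]; decide +kernel
      rcases hw' with hw' | hE
      · exact I.three hG hY (by omega) (u1 := 0) (u2 := 3) (u3 := 6) (by decide) (by decide) (by decide)
          (nU hU (by decide)) (nU hU (by decide)) (nU hU (by decide)) o0 o3 o6
      · have hL : ∀ u a, L.Adj (e u) a → u = 1 ∨ u = 5 := by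
          intro u a hua
          by_contra hn
          refine I.noL (nU hU ?_) a hua
          exact (by decide : ∀ u : Fin 8, ¬ (u = 1 ∨ u = 5) → (u ≠ 2 ∧ u ≠ 4 ∧ u ≠ 7) →
            tQ u ∉ ({0} : Finset (Fin 5))) u hn (nO u (I.outL hua))
        have hx : ∀ u0 u1 : Fin 8, (u0 = 1 ∧ u1 = 5) ∨ (u0 = 5 ∧ u1 = 1) → ∃ a, L.Adj (e u0) a := by
          intro u0 u1 h01
          by_contra! hn
          refine I.F.S (e u1) (by simp [hU]) ?_ (I.F.colL hG)
          intro a b hab ha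
          obtain ⟨i, rfl⟩ := img_supp ha
          have : i ≠ u0 := by rintro rfl; exact hn _ hab
          rcases hL i b hab with rfl | rfl <;> grind
        obtain ⟨b, hb7⟩ := hx 5 1 (by decide)
        obtain ⟨a, ha7⟩ := hx 1 5 (by decide)
        exact n15 ⟨I.outL ha7, I.outL hb7⟩

theorem Cex.noC8 {G : SimpleGraph V} (hG : Cex G) {e : Fin 8 → V} (h : Cyc G e) : False := by
  classical
  have hg : ∀ i, Out G e i ∨ Out G e (i + 1) ∨ Out G e (i + 1 + 1) :=
    fun i => h.gap hG i (by revert i; decide)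
  have comb : ∀ b : Fin 8 → Bool, (∀ i, b i = true ∨ b (i + 1) = true ∨ b (i + 1 + 1) = true) →
      (∃ r, b (1 + r) = true ∧ b (5 + r) = true) ∨
      (∃ r, b (0 + r) = true ∧ b (3 + r) = true ∧ b (6 + r) = true ∧ ¬ b (2 + r) = true ∧
        ¬ b (4 + r) = true ∧ ¬ b (7 + r) = true ∧ ¬ (b (1 + r) = true ∧ b (5 + r) = true)) := by
    decide +kernel
  rcases comb (fun i => decide (Out G e i)) (by simpa using hg) with
    ⟨r, h1, h2⟩ | ⟨r, h1, h2, h3, h4, h5, h6, h7⟩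
  · simp only [decide_eq_true_eq] at h1 h2
    exact hG.caseP (h.rot r) (out_rot.2 h1) (out_rot.2 h2)
  · simp only [decide_eq_true_eq] at h1 h2 h3 h4 h5 h6 h7
    exact hG.caseQ (h.rot r) (out_rot.2 h1) (out_rot.2 h2) (out_rot.2 h3) (out_rot.not.2 h4)
      (out_rot.not.2 h5) (out_rot.not.2 h6) (fun hh => h7 ⟨out_rot.1 hh.1, out_rot.1 hh.2⟩)

theorem cyc_of_walk {G : SimpleGraph V} {v : V} (c : G.Walk v v) (hc : c.IsCycle) {n : ℕ} [NeZero n]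
    (hn : c.length = n) (hd : ∀ i : Fin n, (cycleGraph n).Adj i (i + 1)) (h3 : 3 ≤ n) :
    ∃ e : Fin n → V, Cyc G e := by
  have : cycleGraph n ⊑ G := (cycleGraph_isContained_iff h3).2 ⟨v, c, hc, hn⟩
  obtain ⟨f⟩ := this
  exact ⟨f, f.injective, fun i => f.toHom.map_adj (hd i)⟩

end C52

/-- A smallest counterexample contains no even cycle of length at most 8:
no cycle of length 4, 6, or 8. -/
theorem smallestCex_no_short_even_cycle {V : Type} [Fintype V] (G : SimpleGraph V)
    (h : SmallestCex G) :
    ∀ (v : V) (c : G.Walk v v), c.IsCycle →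
      c.length ≠ 4 ∧ c.length ≠ 6 ∧ c.length ≠ 8 := by
  intro v c hc
  have hG := C52.cex_of h
  refine ⟨fun hn => ?_, fun hn => ?_, fun hn => ?_⟩
  · obtain ⟨e, he⟩ := C52.cyc_of_walk c hc hn (by decide) (by norm_num)
    exact hG.noC4 he
  · obtain ⟨e, he⟩ := C52.cyc_of_walk c hc hn (by decide) (by norm_num)
    exact hG.noC6 he
  · obtain ⟨e, he⟩ := C52.cyc_of_walk c hc hn (by decide) (by norm_num)
    exact hG.noC8 he
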